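/- Let Λ be a ring whose additive group is ℤ^d. Then for almost all primes p, the local subring zeta function of Λ at p, written as a rational function in Y = p^{−s}, has degree −d: there exists a finite set S of primes such that for every prime p ∉ S there exist coprime polynomials P_p, Q_p ∈ ℚ[Y] with Q_p(0) = 1, satisfying the formal power series identity (∑_{i≥0} a_{p^i}(Λ)·Y^i)·Q_p(Y) = P_p(Y) and deg Q_p − deg P_p = d. -/

import Mathlib

/-- The number of subrings (additive subgroups closed under multiplication) of additive
index `n` in a not necessarily associative, commutative or unital ring `Λ`. -/
noncomputable def subringCount (Λ : Type*) [NonUnitalNonAssocRing Λ] (n : ℕ) : ℕ :=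
  Nat.card {S : NonUnitalSubring Λ // S.toAddSubgroup.index = n}

open scoped ENNReal NNReal

/-- key equality of two points with respect to a finite set of rational forms -/
def KeyEq {κ Lab : Type} [Fintype κ] (Ls : Finset (κ → ℚ)) (v w : (κ → ℚ) × Lab) : Prop :=
  v.2 = w.2 ∧ ∀ l ∈ Ls, SignType.sign (l ⬝ᵥ v.1) = SignType.sign (l ⬝ᵥ w.1) ∧
    ((∃ n : ℤ, l ⬝ᵥ v.1 = n) ↔ ∃ n : ℤ, l ⬝ᵥ w.1 = n)

theorem KeyEq.refl {κ Lab : Type} [Fintype κ] (Ls : Finset (κ → ℚ)) (v : (κ → ℚ) × Lab) :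
    KeyEq Ls v v := ⟨rfl, fun _ _ => ⟨rfl, Iff.rfl⟩⟩

theorem KeyEq.symm {κ Lab : Type} [Fintype κ] {Ls : Finset (κ → ℚ)} {v w : (κ → ℚ) × Lab}
    (h : KeyEq Ls v w) : KeyEq Ls w v :=
  ⟨h.1.symm, fun l hl => ⟨(h.2 l hl).1.symm, (h.2 l hl).2.symm⟩⟩

theorem KeyEq.trans {κ Lab : Type} [Fintype κ] {Ls : Finset (κ → ℚ)} {u v w : (κ → ℚ) × Lab}
    (h : KeyEq Ls u v) (h' : KeyEq Ls v w) : KeyEq Ls u w :=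
  ⟨h.1.trans h'.1, fun l hl => ⟨(h.2 l hl).1.trans (h'.2 l hl).1,
    (h.2 l hl).2.trans (h'.2 l hl).2⟩⟩

theorem KeyEq.mono {κ Lab : Type} [Fintype κ] {Ls Ls' : Finset (κ → ℚ)} (hs : Ls ⊆ Ls')
    {v w : (κ → ℚ) × Lab} (h : KeyEq Ls' v w) : KeyEq Ls v w :=
  ⟨h.1, fun l hl => h.2 l (hs hl)⟩

/-- admissible functions -/
def Adm {X κ Lab τ : Type} [Fintype κ] (δ : X → (κ → ℚ) × Lab) (h : X → τ) : Prop :=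
  ∃ Ls : Finset (κ → ℚ), ∀ x y, KeyEq Ls (δ x) (δ y) → h x = h y

/-- homogeneous piecewise linear functions -/
def PL {X κ Lab : Type} [Fintype κ] (δ : X → (κ → ℚ) × Lab) (f : X → ℚ) : Prop :=
  ∃ h : X → κ → ℚ, Adm δ h ∧ ∀ x, f x = h x ⬝ᵥ (δ x).1

section Closure
variable {X κ Lab τ τ' : Type} [Fintype κ] {δ : X → (κ → ℚ) × Lab}

theorem Adm.const (a : τ) : Adm δ (fun _ => a) := ⟨∅, fun _ _ _ => rfl⟩

theorem Adm.comp {h : X → τ} (hh : Adm δ h) (g : τ → τ') : Adm δ (fun x => g (h x)) := by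
  obtain ⟨Ls, H⟩ := hh
  exact ⟨Ls, fun x y e => congrArg g (H x y e)⟩

theorem Adm.pi {J : Type} [Finite J] {T : J → Type} {h : ∀ j, X → T j} (hh : ∀ j, Adm δ (h j)) :
    Adm δ (fun x j => h j x) := by
  classical
  cases nonempty_fintype J
  choose Ls H using hh
  exact ⟨Finset.univ.biUnion Ls, fun x y e => funext fun j =>
    H j x y (e.mono (Finset.subset_biUnion_of_mem Ls (Finset.mem_univ j)))⟩

theorem Adm.pair {h : X → τ} {h' : X → τ'} (hh : Adm δ h) (hh' : Adm δ h') :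
    Adm δ (fun x => (h x, h' x)) := by
  classical
  obtain ⟨Ls, H⟩ := hh
  obtain ⟨Ls', H'⟩ := hh'
  refine ⟨Ls ∪ Ls', fun x y e => ?_⟩
  exact Prod.ext (H x y (e.mono Finset.subset_union_left))
    (H' x y (e.mono Finset.subset_union_right))

theorem Adm.comp₂ {τ'' : Type} {h : X → τ} {h' : X → τ'} (hh : Adm δ h) (hh' : Adm δ h')
    (g : τ → τ' → τ'') : Adm δ (fun x => g (h x) (h' x)) :=
  (hh.pair hh').comp (fun q => g q.1 q.2)

theorem Adm.and {P Q : X → Prop} (hP : Adm δ P) (hQ : Adm δ Q) :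
    Adm δ (fun x => P x ∧ Q x) := hP.comp₂ hQ And

theorem Adm.or {P Q : X → Prop} (hP : Adm δ P) (hQ : Adm δ Q) :
    Adm δ (fun x => P x ∨ Q x) := hP.comp₂ hQ Or

theorem Adm.imp {P Q : X → Prop} (hP : Adm δ P) (hQ : Adm δ Q) :
    Adm δ (fun x => P x → Q x) := hP.comp₂ hQ (fun a b => a → b)

theorem Adm.not {P : X → Prop} (hP : Adm δ P) : Adm δ (fun x => ¬ P x) := hP.comp Not

theorem Adm.all {J : Type} [Finite J] {P : J → X → Prop} (hP : ∀ j, Adm δ (P j)) :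
    Adm δ (fun x => ∀ j, P j x) := (Adm.pi hP).comp (fun q => ∀ j, q j)

theorem Adm.ex {J : Type} [Finite J] {P : J → X → Prop} (hP : ∀ j, Adm δ (P j)) :
    Adm δ (fun x => ∃ j, P j x) := (Adm.pi hP).comp (fun q => ∃ j, q j)

theorem Adm.congr {h h' : X → τ} (hh : Adm δ h) (e : ∀ x, h' x = h x) : Adm δ h' := by
  rwa [show h' = h from funext e]

open Classical in
theorem Adm.ite {P : X → Prop} (hP : Adm δ P) {h h' : X → τ} (hh : Adm δ h) (hh' : Adm δ h') :
    Adm δ (fun x => if P x then h x else h' x) :=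
  (hP.comp₂ (hh.pair hh') (fun P q => if P then q.1 else q.2))

theorem Adm.lab : Adm δ (fun x => (δ x).2) := ⟨∅, fun _ _ e => e.1⟩

theorem Adm.cover {J : Type} [Finite J] {P : J → X → Prop} (hP : ∀ j, Adm δ (P j))
    {g : J → X → τ} (hg : ∀ j, Adm δ (g j)) {h : X → τ} (hex : ∀ x, ∃ j, P j x)
    (hval : ∀ x j, P j x → h x = g j x) : Adm δ h := by
  obtain ⟨L1, H1⟩ := Adm.pi hP
  obtain ⟨L2, H2⟩ := Adm.pi hg
  classical
  refine ⟨L1 ∪ L2, fun x y e => ?_⟩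
  have e1 := congrFun (H1 x y (e.mono Finset.subset_union_left))
  have e2 := congrFun (H2 x y (e.mono Finset.subset_union_right))
  obtain ⟨j, hj⟩ := hex x
  rw [hval x j hj, hval y j ((e1 j).mp hj)]
  exact e2 j

theorem Adm.range_finite [Finite Lab] {h : X → τ} (hh : Adm δ h) : (Set.range h).Finite := by
  classical
  obtain ⟨Ls, H⟩ := hh
  let key : X → Lab × (Ls → SignType) × (Ls → Prop) := fun x =>
    ((δ x).2, fun l => SignType.sign (l.1 ⬝ᵥ (δ x).1), fun l => ∃ n : ℤ, l.1 ⬝ᵥ (δ x).1 = n)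
  have : ∀ x y, key x = key y → h x = h y := by
    intro x y e
    simp only [key, Prod.mk.injEq] at e
    refine H x y ⟨e.1, fun l hl => ⟨congrFun e.2.1 ⟨l, hl⟩, ?_⟩⟩
    exact Eq.to_iff (congrFun e.2.2 ⟨l, hl⟩)
  by_cases hX : Nonempty X
  · have hf : Function.FactorsThrough h key := fun x y e => this x y e
    obtain ⟨x0⟩ := hX
    have : h = (Function.extend key h (fun _ => h x0)) ∘ key := by
      funext x; simp [hf.extend_apply]
    rw [this, Set.range_comp]
    exact (Set.toFinite _).image _
  · have : IsEmpty X := not_nonempty_iff.mp hX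
    rw [Set.range_eq_empty]; exact Set.finite_empty

theorem PL.coord (i : κ) : PL δ (fun x => (δ x).1 i) := by
  classical
  exact ⟨fun _ => Pi.single i 1, Adm.const _, fun x => by simp⟩

theorem PL.zero : PL δ (fun _ => 0) := ⟨fun _ => 0, Adm.const _, fun x => by simp⟩

theorem PL.add {f g : X → ℚ} (hf : PL δ f) (hg : PL δ g) : PL δ (fun x => f x + g x) := by
  obtain ⟨h, ah, eh⟩ := hf
  obtain ⟨h', ah', eh'⟩ := hg
  exact ⟨fun x => h x + h' x, ah.comp₂ ah' _, fun x => by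
    beta_reduce
    rw [eh, eh', add_dotProduct]⟩

theorem PL.smul {f : X → ℚ} (hf : PL δ f) (q : ℚ) : PL δ (fun x => q * f x) := by
  obtain ⟨h, ah, eh⟩ := hf
  exact ⟨fun x => q • h x, ah.comp _, fun x => by
    beta_reduce
    rw [eh, smul_dotProduct, smul_eq_mul]⟩

theorem PL.congr {f g : X → ℚ} (hf : PL δ f) (e : ∀ x, g x = f x) : PL δ g := by
  rwa [show g = f from funext e]

theorem PL.sub {f g : X → ℚ} (hf : PL δ f) (hg : PL δ g) : PL δ (fun x => f x - g x) :=
  (hf.add (hg.smul (-1))).congr fun x => by ring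

theorem PL.sum {J : Type} (s : Finset J) {f : J → X → ℚ} (hf : ∀ j ∈ s, PL δ (f j)) :
    PL δ (fun x => ∑ j ∈ s, f j x) := by
  classical
  induction s using Finset.induction_on with
  | empty => simpa using PL.zero
  | insert a s ha ih =>
    simp only [Finset.sum_insert ha]
    exact (hf a (by simp)).add (ih fun j hj => hf j (by simp [hj]))

theorem PL.cover {J : Type} [Finite J] {P : J → X → Prop} (hP : ∀ j, Adm δ (P j))
    {g : J → X → ℚ} (hg : ∀ j, PL δ (g j)) {f : X → ℚ} (hex : ∀ x, ∃ j, P j x)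
    (hval : ∀ x j, P j x → f x = g j x) : PL δ f := by
  classical
  choose h ah eh using hg
  let G : (J → Prop) → (J → κ → ℚ) → κ → ℚ := fun Q k =>
    if hQ : ∃ j, Q j then k hQ.choose else 0
  refine ⟨fun x => G (fun j => P j x) (fun j => h j x), (Adm.pi hP).comp₂ (Adm.pi ah) G, ?_⟩
  intro x
  have hx := hex x
  simp only [G, dif_pos hx]
  rw [← eh, hval x _ hx.choose_spec]

open Classical in
theorem PL.ite {P : X → Prop} (hP : Adm δ P) {f g : X → ℚ} (hf : PL δ f) (hg : PL δ g) :
    PL δ (fun x => if P x then f x else g x) := by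
  refine PL.cover (J := Bool) (P := fun b x => if b then P x else ¬ P x)
    (g := fun b => if b then f else g) ?_ ?_ ?_ ?_
  · rintro (_ | _)
    · simpa using hP.not
    · simpa using hP
  · rintro (_ | _) <;> simpa
  · intro x
    by_cases h : P x
    · exact ⟨true, by simpa⟩
    · exact ⟨false, by simpa⟩
  · rintro x (_ | _) h <;> simp_all

theorem PL.key [Finite Lab] {f : X → ℚ} (hf : PL δ f) :
    ∃ Ls : Finset (κ → ℚ), ∀ x y, KeyEq Ls (δ x) (δ y) →
      SignType.sign (f x) = SignType.sign (f y) ∧ ((∃ n : ℤ, f x = n) ↔ ∃ n : ℤ, f y = n) := by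
  classical
  obtain ⟨h, ah, eh⟩ := hf
  have hfin := ah.range_finite
  obtain ⟨Ls, H⟩ := ah
  refine ⟨Ls ∪ hfin.toFinset, fun x y e => ?_⟩
  have e1 := H x y (e.mono Finset.subset_union_left)
  have := e.2 (h x) (by simp)
  rw [eh, eh, ← e1]
  exact this

theorem PL.sign [Finite Lab] {f : X → ℚ} (hf : PL δ f) : Adm δ (fun x => SignType.sign (f x)) := by
  obtain ⟨Ls, H⟩ := hf.key
  exact ⟨Ls, fun x y e => (H x y e).1⟩

theorem PL.int [Finite Lab] {f : X → ℚ} (hf : PL δ f) : Adm δ (fun x => ∃ n : ℤ, f x = n) := by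
  obtain ⟨Ls, H⟩ := hf.key
  exact ⟨Ls, fun x y e => propext (H x y e).2⟩

theorem PL.lt [Finite Lab] {f g : X → ℚ} (hf : PL δ f) (hg : PL δ g) : Adm δ (fun x => f x < g x) :=
  ((hg.sub hf).sign.comp (fun s => s = 1)).congr fun x => by
    simp [sign_eq_one_iff]

theorem PL.le [Finite Lab] {f g : X → ℚ} (hf : PL δ f) (hg : PL δ g) : Adm δ (fun x => f x ≤ g x) :=
  (hg.lt hf).not.congr fun x => by simp

theorem PL.eq [Finite Lab] {f g : X → ℚ} (hf : PL δ f) (hg : PL δ g) : Adm δ (fun x => f x = g x) :=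
  ((hf.le hg).and (hg.le hf)).congr fun x => by simp [le_antisymm_iff]

/-- extension to the universal space -/
theorem Adm.extend {h : X → τ} [Nonempty τ] (hh : Adm δ h) :
    ∃ H : (κ → ℚ) × Lab → τ, Adm (id : (κ → ℚ) × Lab → (κ → ℚ) × Lab) H ∧ ∀ x, h x = H (δ x) := by
  classical
  obtain ⟨Ls, H⟩ := hh
  let G : (κ → ℚ) × Lab → τ := fun v =>
    if hv : ∃ x, KeyEq Ls (δ x) v then h hv.choose else Classical.arbitrary τ
  refine ⟨G, ⟨Ls, fun v w e => ?_⟩, fun x => ?_⟩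
  · by_cases hv : ∃ x, KeyEq Ls (δ x) v
    · have hw : ∃ x, KeyEq Ls (δ x) w := ⟨_, hv.choose_spec.trans e⟩
      simp only [G, dif_pos hv, dif_pos hw]
      exact H _ _ ((hv.choose_spec.trans e).trans hw.choose_spec.symm)
    · have hw : ¬ ∃ x, KeyEq Ls (δ x) w := fun ⟨x, hx⟩ => hv ⟨x, hx.trans e.symm⟩
      simp only [G, dif_neg hv, dif_neg hw]
  · have hv : ∃ y, KeyEq Ls (δ y) (δ x) := ⟨x, KeyEq.refl _ _⟩
    simp only [G, dif_pos hv]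
    exact H _ _ hv.choose_spec.symm

theorem PL.extend {f : X → ℚ} (hf : PL δ f) :
    ∃ F : (κ → ℚ) × Lab → ℚ, PL (id : (κ → ℚ) × Lab → (κ → ℚ) × Lab) F ∧ ∀ x, f x = F (δ x) := by
  obtain ⟨h, ah, eh⟩ := hf
  obtain ⟨H, aH, eH⟩ := ah.extend
  exact ⟨fun v => H v ⬝ᵥ v.1, ⟨H, aH, fun x => rfl⟩, fun x => by rw [eh, eH]⟩

/-- adding a coordinate -/
def optData (δ : X → (κ → ℚ) × Lab) : X × ℕ → (Option κ → ℚ) × Lab :=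
  fun q => (fun o => o.elim (q.2 : ℚ) (δ q.1).1, (δ q.1).2)

theorem Adm.lift {h : X → τ} (hh : Adm δ h) : Adm (optData δ) (fun q => h q.1) := by
  classical
  obtain ⟨Ls, H⟩ := hh
  refine ⟨Ls.image (fun l o => o.elim 0 l), fun q r e => H _ _ ⟨e.1, fun l hl => ?_⟩⟩
  have := e.2 _ (Finset.mem_image_of_mem _ hl)
  simpa [optData, dotProduct, Fintype.sum_option] using this

theorem PL.lift {f : X → ℚ} (hf : PL δ f) : PL (optData δ) (fun q => f q.1) := by
  obtain ⟨h, ah, eh⟩ := hf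
  exact ⟨fun q o => o.elim 0 (h q.1), ah.lift.comp (fun k o => Option.elim o 0 k), fun q => by
    simp [optData, dotProduct, Fintype.sum_option, eh]⟩

theorem PL.last : PL (optData δ) (fun q => (q.2 : ℚ)) :=
  (PL.coord (δ := optData δ) none).congr fun q => by simp [optData]

end Closure

open scoped ENNReal NNReal
set_option linter.unusedSectionVars false

/-- cast of nonnegative rationals -/
noncomputable def nn (q : ℚ≥0) : ℝ≥0∞ := ((q : ℝ≥0) : ℝ≥0∞)

theorem nn_mul (a b : ℚ≥0) : nn (a * b) = nn a * nn b := by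
  unfold nn; push_cast; rfl
theorem nn_one : nn 1 = 1 := by unfold nn; push_cast; rfl
theorem nn_pow (a : ℚ≥0) (n : ℕ) : nn (a ^ n) = nn a ^ n := by
  unfold nn; push_cast; rfl
theorem nn_ne_zero {a : ℚ≥0} (h : a ≠ 0) : nn a ≠ 0 := by
  unfold nn; simpa using h
theorem nn_ne_top (a : ℚ≥0) : nn a ≠ ⊤ := by unfold nn; simp
theorem nn_prod {J : Type} (s : Finset J) (f : J → ℚ≥0) :
    nn (∏ i ∈ s, f i) = ∏ i ∈ s, nn (f i) := by
  unfold nn; push_cast; rfl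

/-- open rational cones with shifted lattice points and geometric weights -/
structure Cell (κ Lab : Type) where
  ι : Type
  [fin : Fintype ι]
  [dec : DecidableEq ι]
  lab : Lab
  c : ℚ≥0
  A : ι → κ → ℚ
  θ : ι → ℚ
  ρ : ι → ℚ≥0
  hc : c ≠ 0
  hθ : ∀ i, 0 < θ i
  hθ1 : ∀ i, θ i ≤ 1
  hρ : ∀ i, ρ i ≠ 0

attribute [instance] Cell.fin Cell.dec

namespace Cell
variable {κ Lab : Type} [Fintype κ]

/-- points of a cell -/
def pt (β : Cell κ Lab) (ℓ : β.ι → ℕ) : (κ → ℚ) × Lab :=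
  (∑ i, ((ℓ i : ℚ) + β.θ i) • β.A i, β.lab)

/-- weights of a cell -/
noncomputable def wt (β : Cell κ Lab) (ℓ : β.ι → ℕ) : ℝ≥0∞ :=
  nn β.c * ∏ i, nn (β.ρ i) ^ ℓ i

/-- the functional of a cell -/
noncomputable def eval (β : Cell κ Lab) (φ : (κ → ℚ) × Lab → ℝ≥0∞) : ℝ≥0∞ :=
  ∑' ℓ, β.wt ℓ * φ (β.pt ℓ)

theorem wt_ne_zero (β : Cell κ Lab) (ℓ : β.ι → ℕ) : β.wt ℓ ≠ 0 := by
  unfold wt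
  refine mul_ne_zero (nn_ne_zero β.hc) (Finset.prod_ne_zero_iff.mpr fun i _ => ?_)
  exact pow_ne_zero _ (nn_ne_zero (β.hρ i))

theorem eval_eq_zero {β : Cell κ Lab} {φ : (κ → ℚ) × Lab → ℝ≥0∞} (h : β.eval φ = 0)
    (ℓ : β.ι → ℕ) : φ (β.pt ℓ) = 0 := by
  unfold eval at h
  rw [ENNReal.tsum_eq_zero] at h
  exact (mul_eq_zero.mp (h ℓ)).resolve_left (β.wt_ne_zero ℓ)

/-- total of a list of cells -/
noncomputable def evalL (L : List (Cell κ Lab)) (φ : (κ → ℚ) × Lab → ℝ≥0∞) : ℝ≥0∞ :=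
  (L.map fun β => β.eval φ).sum

@[simp] theorem evalL_nil (φ : (κ → ℚ) × Lab → ℝ≥0∞) : evalL [] φ = 0 := rfl
@[simp] theorem evalL_cons (β : Cell κ Lab) (L : List (Cell κ Lab)) (φ : (κ → ℚ) × Lab → ℝ≥0∞) :
    evalL (β :: L) φ = β.eval φ + evalL L φ := by simp [evalL]
@[simp] theorem evalL_append (L L' : List (Cell κ Lab)) (φ : (κ → ℚ) × Lab → ℝ≥0∞) :
    evalL (L ++ L') φ = evalL L φ + evalL L' φ := by simp [evalL]

theorem evalL_eq_zero {L : List (Cell κ Lab)} {φ : (κ → ℚ) × Lab → ℝ≥0∞} (h : evalL L φ = 0)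
    {β : Cell κ Lab} (hβ : β ∈ L) (ℓ : β.ι → ℕ) : φ (β.pt ℓ) = 0 := by
  induction L with
  | nil => simp at hβ
  | cons γ L ih =>
    rw [evalL_cons, add_eq_zero] at h
    rcases List.mem_cons.mp hβ with rfl | hβ
    · exact eval_eq_zero h.1 ℓ
    · exact ih h.2 hβ

theorem mem_range_of_evalL {L L' : List (Cell κ Lab)} (h : ∀ φ, evalL L φ = evalL L' φ)
    {β : Cell κ Lab} (hβ : β ∈ L') (ℓ : β.ι → ℕ) : ∃ γ ∈ L, ∃ m : γ.ι → ℕ, γ.pt m = β.pt ℓ := by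
  classical
  by_contra hcon
  push Not at hcon
  have : evalL L (fun v => if v = β.pt ℓ then 1 else 0) = 0 := by
    unfold evalL
    rw [List.sum_eq_zero]
    intro x hx
    obtain ⟨γ, hγ, rfl⟩ := List.mem_map.mp hx
    unfold eval
    rw [ENNReal.tsum_eq_zero]
    intro m
    beta_reduce
    rw [if_neg (hcon γ hγ m), mul_zero]
  rw [h] at this
  simpa using evalL_eq_zero this hβ ℓ

/-- a property of cells can be achieved by refinement -/
def CanRefine (P : Cell κ Lab → Prop) (β : Cell κ Lab) : Prop :=
  ∃ L : List (Cell κ Lab), (∀ φ, β.eval φ = evalL L φ) ∧ ∀ γ ∈ L, P γ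

theorem CanRefine.self {P : Cell κ Lab → Prop} {β : Cell κ Lab} (h : P β) : CanRefine P β :=
  ⟨[β], fun φ => by simp, by simpa⟩

theorem canRefineL {P : Cell κ Lab → Prop} {L : List (Cell κ Lab)}
    (h : ∀ γ ∈ L, CanRefine P γ) :
    ∃ L' : List (Cell κ Lab), (∀ φ, evalL L φ = evalL L' φ) ∧ ∀ γ ∈ L', P γ := by
  induction L with
  | nil => exact ⟨[], fun φ => rfl, by simp⟩
  | cons β L ih =>
    obtain ⟨L1, h1, h1'⟩ := h β (by simp)
    obtain ⟨L2, h2, h2'⟩ := ih fun γ hγ => h γ (by simp [hγ])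
    refine ⟨L1 ++ L2, fun φ => by simp [h1, h2], fun γ hγ => ?_⟩
    rcases List.mem_append.mp hγ with hγ | hγ
    · exact h1' γ hγ
    · exact h2' γ hγ

theorem CanRefine.bind {P Q : Cell κ Lab → Prop} {β : Cell κ Lab} (h : CanRefine P β)
    (h' : ∀ γ, P γ → CanRefine Q γ) : CanRefine Q β := by
  obtain ⟨L, h1, h2⟩ := h
  obtain ⟨L', h3, h4⟩ := canRefineL (fun γ hγ => h' γ (h2 γ hγ))
  exact ⟨L', fun φ => by rw [h1, h3], h4⟩

/-- range condition comes for free -/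
theorem CanRefine.range {P : Cell κ Lab → Prop} {β : Cell κ Lab} (h : CanRefine P β) :
    CanRefine (fun γ => P γ ∧ ∀ ℓ, ∃ m, β.pt m = γ.pt ℓ) β := by
  obtain ⟨L, h1, h2⟩ := h
  refine ⟨L, h1, fun γ hγ => ⟨h2 γ hγ, fun ℓ => ?_⟩⟩
  obtain ⟨γ', h', m, hm⟩ := mem_range_of_evalL (L := [β]) (L' := L)
    (fun φ => by simpa using h1 φ) hγ ℓ
  simp only [List.mem_singleton] at h'
  subst h'
  exact ⟨m, hm⟩

/-- the value of a form on a point -/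
theorem dot_pt (β : Cell κ Lab) (l : κ → ℚ) (ℓ : β.ι → ℕ) :
    l ⬝ᵥ (β.pt ℓ).1 = ∑ i, ((ℓ i : ℚ) + β.θ i) * (l ⬝ᵥ β.A i) := by
  simp [pt, dotProduct_sum, dotProduct_smul]

end Cell

open scoped ENNReal NNReal
set_option linter.unusedSectionVars false

namespace Cell
variable {κ Lab : Type} [Fintype κ]

/-- scaling -/
theorem canRefine_scale (β : Cell κ Lab) (N : β.ι → ℕ) (hN : ∀ i, 0 < N i) :
    CanRefine (fun γ => ∃ e : γ.ι ≃ β.ι, ∀ i, γ.A i = (N (e i) : ℚ) • β.A (e i)) β := by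
  classical
  have : ∀ i, NeZero (N i) := fun i => ⟨(hN i).ne'⟩
  let γ : (∀ i, Fin (N i)) → Cell κ Lab := fun r =>
    { ι := β.ι
      lab := β.lab
      c := β.c * ∏ i, β.ρ i ^ (r i : ℕ)
      A := fun i => (N i : ℚ) • β.A i
      θ := fun i => (β.θ i + (r i : ℕ)) / N i
      ρ := fun i => β.ρ i ^ N i
      hc := mul_ne_zero β.hc (Finset.prod_ne_zero_iff.mpr fun i _ => pow_ne_zero _ (β.hρ i))
      hθ := fun i => by
        have := β.hθ i
        have := hN i
        positivity
      hθ1 := fun i => by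
        have h1 := β.hθ1 i
        have h2 : (0 : ℚ) < N i := by exact_mod_cast hN i
        rw [div_le_one h2]
        have h3 : ((r i : ℕ) : ℚ) + 1 ≤ N i := by exact_mod_cast (r i).2
        linarith
      hρ := fun i => pow_ne_zero _ (β.hρ i) }
  refine ⟨(Finset.univ : Finset (∀ i, Fin (N i))).toList.map γ, fun φ => ?_, ?_⟩
  · have e1 : evalL ((Finset.univ : Finset (∀ i, Fin (N i))).toList.map γ) φ
        = ∑ r, (γ r).eval φ := by
      unfold evalL
      rw [List.map_map]
      exact Finset.sum_map_toList _ _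
    rw [e1, ← tsum_fintype (L := .unconditional _)]
    change ∑' ℓ : β.ι → ℕ, β.wt ℓ * φ (β.pt ℓ) = ∑' (b : ∀ i, Fin (N i)) (ℓ : β.ι → ℕ),
      (γ b).wt ℓ * φ ((γ b).pt ℓ)
    rw [← ENNReal.tsum_prod (f := fun b (ℓ : β.ι → ℕ) => (γ b).wt ℓ * φ ((γ b).pt ℓ))]
    let E : ((∀ i, Fin (N i)) × (β.ι → ℕ)) ≃ (β.ι → ℕ) :=
      { toFun := fun q i => q.2 i * N i + (q.1 i : ℕ)
        invFun := fun ℓ => (fun i => Fin.ofNat (N i) (ℓ i), fun i => ℓ i / N i)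
        left_inv := fun q => by
          refine Prod.ext ?_ ?_
          · funext i
            apply Fin.ext
            simp [Nat.mod_eq_of_lt (q.1 i).2]
          · funext i
            simp only
            rw [Nat.add_div_of_dvd_right (Dvd.intro_left _ rfl), Nat.mul_div_cancel _ (hN i),
              Nat.div_eq_of_lt (q.1 i).2, add_zero]
        right_inv := fun ℓ => by
          funext i
          simp only [Fin.val_ofNat]
          rw [mul_comm]
          exact Nat.div_add_mod _ _ }
    rw [← E.tsum_eq]
    refine tsum_congr fun q => ?_
    have hw : β.wt (E q) = (γ q.1).wt q.2 := by
      simp only [wt, γ, E, Equiv.coe_fn_mk, nn_mul, nn_prod, nn_pow, mul_assoc,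
        ← Finset.prod_mul_distrib]
      congr 1
      refine Finset.prod_congr rfl fun i _ => ?_
      rw [pow_add, mul_comm, ← pow_mul, mul_comm (N i)]
    have hp : β.pt (E q) = (γ q.1).pt q.2 := by
      simp only [pt, γ, E, Equiv.coe_fn_mk]
      congr 1
      refine Finset.sum_congr rfl fun i _ => ?_
      rw [smul_smul]
      congr 1
      have h2 : (N i : ℚ) ≠ 0 := by exact_mod_cast (hN i).ne'
      field_simp
      push_cast
      ring
    rw [hw, hp]
  · intro δ hδ
    obtain ⟨r, _, rfl⟩ := List.mem_map.mp hδ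
    exact ⟨Equiv.refl _, fun i => rfl⟩

theorem tsum_shift {ι : Type} [DecidableEq ι] (f : (ι → ℕ) → ℝ≥0∞) {i j : ι} (hij : i ≠ j) (ε : ℕ) :
    ∑' ℓ : (ι → ℕ), (if ℓ j + ε ≤ ℓ i then f ℓ else 0)
      = ∑' ℓ : (ι → ℕ), f (Function.update ℓ i (ℓ i + ℓ j + ε)) := by
  classical
  let g : (ι → ℕ) → (ι → ℕ) := fun ℓ => Function.update ℓ i (ℓ i + ℓ j + ε)
  have hg : Function.Injective g := by
    intro a b hab
    have hj : a j = b j := by simpa [g, hij.symm] using congrFun hab j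
    have hi : a i = b i := by
      have := congrFun hab i
      simp [g] at this; omega
    funext x
    by_cases hx : x = i
    · rw [hx, hi]
    · simpa [g, hx] using congrFun hab x
  have hr : Set.range g = {ℓ | ℓ j + ε ≤ ℓ i} := by
    ext ℓ
    constructor
    · rintro ⟨m, rfl⟩
      simp only [g, Set.mem_ofPred_eq, Function.update_self, Function.update_of_ne hij.symm]
      omega
    · intro h
      refine ⟨Function.update ℓ i (ℓ i - ℓ j - ε), ?_⟩
      funext x
      by_cases hx : x = i
      · subst hx
        simp only [g, Function.update_self, Function.update_of_ne hij.symm]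
        simp only [Set.mem_ofPred_eq] at h
        omega
      · simp [g, hx]
  have h1 := tsum_range f hg
  rw [hr, tsum_subtype] at h1
  rw [← h1]
  refine tsum_congr fun ℓ => ?_
  simp [Set.indicator]

theorem tsum_diag {ι : Type} [DecidableEq ι] (f : (ι → ℕ) → ℝ≥0∞) {i j : ι} (hij : i ≠ j) :
    ∑' ℓ : (ι → ℕ), (if ℓ i = ℓ j then f ℓ else 0)
      = ∑' ℓ : (ι → ℕ), nn (1/2) * nn (1/2) ^ ℓ i * f (Function.update ℓ i (ℓ j)) := by
  classical
  have key : ∀ F : (ι → ℕ) → ℝ≥0∞, ∑' ℓ, F ℓ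
      = ∑' g : ({x // x ≠ i} → ℕ), ∑' n : ℕ, F ((Equiv.funSplitAt i ℕ).symm (n, g)) := by
    intro F
    rw [← (Equiv.funSplitAt i ℕ).symm.tsum_eq, ENNReal.tsum_prod', ENNReal.tsum_comm]
  rw [key, key]
  refine tsum_congr fun g => ?_
  have e1 : ∀ n : ℕ, (Equiv.funSplitAt i ℕ).symm (n, g) i = n := fun n => by
    simp [Equiv.funSplitAt, Equiv.piSplitAt]
  have e2 : ∀ n : ℕ, (Equiv.funSplitAt i ℕ).symm (n, g) j = g ⟨j, hij.symm⟩ := fun n => by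
    simp [Equiv.funSplitAt, Equiv.piSplitAt, hij.symm]
  have e3 : ∀ n : ℕ, Function.update ((Equiv.funSplitAt i ℕ).symm (n, g)) i (g ⟨j, hij.symm⟩)
      = (Equiv.funSplitAt i ℕ).symm (g ⟨j, hij.symm⟩, g) := fun n => by
    funext x
    by_cases hx : x = i
    · subst hx; simp [Equiv.funSplitAt, Equiv.piSplitAt]
    · simp [Equiv.funSplitAt, Equiv.piSplitAt, hx]
  simp only [e1, e2, e3]
  rw [ENNReal.tsum_mul_right, ENNReal.tsum_mul_left, ENNReal.tsum_geometric]
  have h2 : nn (1/2) = 2⁻¹ := by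
    unfold nn
    push_cast
    simp
  rw [h2, ENNReal.one_sub_inv_two, inv_inv, ENNReal.inv_mul_cancel (by simp) (by simp), one_mul]
  rw [tsum_eq_single (g ⟨j, hij.symm⟩)]
  · simp
  · intro n hn; simp [hn]

/-- the star subdivision: part where `s i > s j` -/
def star (β : Cell κ Lab) (i j : β.ι) (ε : ℕ) (h0 : 0 < β.θ i - β.θ j + ε)
    (h1 : β.θ i - β.θ j + ε ≤ 1) : Cell κ Lab where
  ι := β.ι
  lab := β.lab
  c := β.c * β.ρ i ^ ε
  A := Function.update β.A j (β.A i + β.A j)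
  θ := Function.update β.θ i (β.θ i - β.θ j + ε)
  ρ := Function.update β.ρ j (β.ρ i * β.ρ j)
  hc := mul_ne_zero β.hc (pow_ne_zero _ (β.hρ i))
  hθ x := by
    by_cases hx : x = i
    · subst hx; simpa
    · simpa [hx] using β.hθ x
  hθ1 x := by
    by_cases hx : x = i
    · subst hx; simpa
    · simpa [hx] using β.hθ1 x
  hρ x := by
    by_cases hx : x = j
    · subst hx; simpa using ⟨β.hρ i, β.hρ _⟩
    · simpa [hx] using β.hρ x

theorem sum_two {ι M : Type} [Fintype ι] [DecidableEq ι] [AddCommMonoid M] {i j : ι} (hij : i ≠ j)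
    (f : ι → M) : ∑ x, f x = f i + (f j + ∑ x ∈ (Finset.univ.erase i).erase j, f x) := by
  rw [Finset.add_sum_erase _ f (by simp [hij.symm]), Finset.add_sum_erase _ f (by simp)]

theorem prod_two {ι M : Type} [Fintype ι] [DecidableEq ι] [CommMonoid M] {i j : ι} (hij : i ≠ j)
    (f : ι → M) : ∏ x, f x = f i * (f j * ∏ x ∈ (Finset.univ.erase i).erase j, f x) := by
  rw [Finset.mul_prod_erase _ f (by simp [hij.symm]), Finset.mul_prod_erase _ f (by simp)]

theorem eval_star (β : Cell κ Lab) {i j : β.ι} (hij : i ≠ j) (ε : ℕ)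
    (h0 : 0 < β.θ i - β.θ j + ε) (h1 : β.θ i - β.θ j + ε ≤ 1) (φ : (κ → ℚ) × Lab → ℝ≥0∞) :
    (β.star i j ε h0 h1).eval φ
      = ∑' ℓ : β.ι → ℕ, (if ℓ j + ε ≤ ℓ i then β.wt ℓ * φ (β.pt ℓ) else 0) := by
  rw [tsum_shift _ hij]
  change ∑' ℓ : β.ι → ℕ, (nn (β.c * β.ρ i ^ ε) *
    ∏ x : β.ι, nn (Function.update β.ρ j (β.ρ i * β.ρ j) x) ^ ℓ x) *
    φ (∑ x : β.ι, ((ℓ x : ℚ) + Function.update β.θ i (β.θ i - β.θ j + ε) x) •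
      Function.update β.A j (β.A i + β.A j) x, β.lab) = _
  refine tsum_congr fun ℓ => ?_
  congr 1
  · simp only [wt]
    rw [prod_two (ι := β.ι) hij, prod_two (ι := β.ι) hij]
    simp only [Function.update_self, Function.update_of_ne hij, Function.update_of_ne hij.symm,
      nn_mul, nn_pow]
    have hE : ∀ x ∈ (Finset.univ.erase i).erase j, 
        nn (Function.update β.ρ j (β.ρ i * β.ρ j) x) ^ ℓ x = nn (β.ρ x) ^ (Function.update ℓ i (ℓ i + ℓ j + ε) x) := by
      intro x hx
      simp only [Finset.mem_erase] at hx
      simp [hx]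
    rw [Finset.prod_congr rfl hE]
    ring
  · congr 1
    simp only [pt]
    congr 1
    rw [sum_two (ι := β.ι) hij, sum_two (ι := β.ι) hij]
    simp only [Function.update_self, Function.update_of_ne hij, Function.update_of_ne hij.symm]
    have hE : ∀ x ∈ (Finset.univ.erase i).erase j, 
        ((ℓ x : ℚ) + Function.update β.θ i (β.θ i - β.θ j + ε) x) •
          Function.update β.A j (β.A i + β.A j) x = (((Function.update ℓ i (ℓ i + ℓ j + ε) x : ℕ) : ℚ) + β.θ x) • β.A x := by
      intro x hx
      simp only [Finset.mem_erase] at hx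
      simp [hx]
    rw [Finset.sum_congr rfl hE]
    push_cast
    module

/-- the diagonal part -/
def diag (β : Cell κ Lab) (i j : β.ι) : Cell κ Lab where
  ι := β.ι
  lab := β.lab
  c := β.c * (1 / 2)
  A := Function.update (Function.update β.A j (β.A i + β.A j)) i 0
  θ := β.θ
  ρ := Function.update (Function.update β.ρ j (β.ρ i * β.ρ j)) i (1 / 2)
  hc := mul_ne_zero β.hc (by norm_num)
  hθ := β.hθ
  hθ1 := β.hθ1
  hρ x := by
    by_cases hx : x = i
    · subst hx; simp
    · by_cases hx' : x = j
      · subst hx'; simpa [hx] using ⟨β.hρ i, β.hρ _⟩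
      · simpa [hx, hx'] using β.hρ x

theorem eval_diag (β : Cell κ Lab) {i j : β.ι} (hij : i ≠ j) (hθ : β.θ i = β.θ j)
    (φ : (κ → ℚ) × Lab → ℝ≥0∞) :
    (β.diag i j).eval φ
      = ∑' ℓ : β.ι → ℕ, (if ℓ i = ℓ j then β.wt ℓ * φ (β.pt ℓ) else 0) := by
  rw [tsum_diag _ hij]
  change ∑' ℓ : β.ι → ℕ, (nn (β.c * (1 / 2)) *
    ∏ x : β.ι, nn (Function.update (Function.update β.ρ j (β.ρ i * β.ρ j)) i (1 / 2) x) ^ ℓ x) *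
    φ (∑ x : β.ι, ((ℓ x : ℚ) + β.θ x) •
      Function.update (Function.update β.A j (β.A i + β.A j)) i 0 x, β.lab) = _
  refine tsum_congr fun ℓ => ?_
  rw [← mul_assoc]
  congr 1
  · simp only [wt]
    rw [prod_two (ι := β.ι) hij, prod_two (ι := β.ι) hij]
    simp only [Function.update_self, Function.update_of_ne hij, Function.update_of_ne hij.symm,
      nn_mul]
    have hE : ∀ x ∈ (Finset.univ.erase i).erase j, 
        nn (Function.update (Function.update β.ρ j (β.ρ i * β.ρ j)) i (1 / 2) x) ^ ℓ x = nn (β.ρ x) ^ (Function.update ℓ i (ℓ j) x) := by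
      intro x hx
      simp only [Finset.mem_erase] at hx
      simp [hx]
    rw [Finset.prod_congr rfl hE]
    ring
  · congr 1
    simp only [pt]
    congr 1
    rw [sum_two (ι := β.ι) hij, sum_two (ι := β.ι) hij]
    simp only [Function.update_self, Function.update_of_ne hij, Function.update_of_ne hij.symm]
    have hE : ∀ x ∈ (Finset.univ.erase i).erase j, 
        ((ℓ x : ℚ) + β.θ x) •
          Function.update (Function.update β.A j (β.A i + β.A j)) i 0 x = (((Function.update ℓ i (ℓ j) x : ℕ) : ℚ) + β.θ x) • β.A x := by
      intro x hx
      simp only [Finset.mem_erase] at hx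
      simp [hx]
    rw [Finset.sum_congr rfl hE]
    rw [hθ]
    module

end Cell

open scoped ENNReal NNReal
set_option linter.unusedSectionVars false

namespace Cell
variable {κ Lab : Type} [Fintype κ]

theorem card_filter_drop {ι : Type} [Fintype ι] {b b' : ι → ℚ} {n : ℕ}
    (h : ∀ x, b' x = 0 ∨ b' x = b x) {j : ι} (hj : b' j = 0) (hj' : b j ≠ 0)
    (hn : (Finset.univ.filter fun i => b i ≠ 0).card ≤ n + 1) :
    (Finset.univ.filter fun i => b' i ≠ 0).card ≤ n := by
  refine Nat.le_of_lt_succ (lt_of_lt_of_le (Finset.card_lt_card ?_) hn)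
  rw [Finset.ssubset_iff_of_subset]
  · exact ⟨j, by simpa using hj', by simpa using hj⟩
  · intro x hx
    have h1 := (Finset.mem_filter.mp hx).2
    refine Finset.mem_filter.mpr ⟨Finset.mem_univ _, ?_⟩
    rcases h x with h | h
    · exact absurd h h1
    · rwa [← h]

theorem canRefine_sign (l : κ → ℚ) (P : ℚ) (hP : 0 < P) (n : ℕ) : ∀ β : Cell κ Lab,
    (∀ i, l ⬝ᵥ β.A i = 0 ∨ l ⬝ᵥ β.A i = P ∨ l ⬝ᵥ β.A i = -P) →
    (Finset.univ.filter fun i => l ⬝ᵥ β.A i ≠ 0).card ≤ n →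
    CanRefine (fun γ => ∀ ℓ ℓ', SignType.sign (l ⬝ᵥ (γ.pt ℓ).1) = SignType.sign (l ⬝ᵥ (γ.pt ℓ').1)) β := by
  induction n with
  | zero =>
    intro β hb hn
    refine CanRefine.self ?_
    have h0 : ∀ i, l ⬝ᵥ β.A i = 0 := by
      simpa [Finset.filter_eq_empty_iff] using hn
    intro ℓ ℓ'
    simp [dot_pt, h0]
  | succ n ih =>
    intro β hb hn
    by_cases hij : ∃ i j, l ⬝ᵥ β.A i = P ∧ l ⬝ᵥ β.A j = -P
    · obtain ⟨i, j, hi, hj⟩ := hij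
      have hne : i ≠ j := by
        rintro rfl
        linarith
      have hAij : ∀ (i j : β.ι), l ⬝ᵥ β.A i + l ⬝ᵥ β.A j = 0 → l ⬝ᵥ β.A j ≠ 0 →
          ∀ ε h0 h1, CanRefine (fun γ => ∀ ℓ ℓ', SignType.sign (l ⬝ᵥ (γ.pt ℓ).1)
            = SignType.sign (l ⬝ᵥ (γ.pt ℓ').1)) (β.star i j ε h0 h1) := by
        intro i j hs hj0 ε h0 h1
        have hA : ∀ x : β.ι, l ⬝ᵥ (β.star i j ε h0 h1).A x
            = if x = j then 0 else l ⬝ᵥ β.A x := by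
          intro x
          by_cases hx : x = j
          · subst hx; simp [star, dotProduct_add, hs]
          · simp [star, hx]
        have hA' := hA
        refine ih _ (fun (x : β.ι) => ?_) ?_
        · rw [hA' x]
          split_ifs
          · simp
          · exact hb x
        · refine card_filter_drop (ι := β.ι) (b := fun x => l ⬝ᵥ β.A x) (fun x => ?_) (j := j) ?_ ?_ hn
          · rw [hA x]
            split_ifs <;> simp
          · rw [hA j]; simp
          · exact hj0
      have hdiag : CanRefine (fun γ => ∀ ℓ ℓ', SignType.sign (l ⬝ᵥ (γ.pt ℓ).1)
            = SignType.sign (l ⬝ᵥ (γ.pt ℓ').1)) (β.diag i j) := by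
        have hA : ∀ x : β.ι, l ⬝ᵥ (β.diag i j).A x
            = if x = i ∨ x = j then 0 else l ⬝ᵥ β.A x := by
          intro x
          by_cases hx : x = i
          · subst hx; simp [diag]
          · by_cases hx' : x = j
            · subst hx'; simp [diag, hx, dotProduct_add, hi, hj]
            · simp [diag, hx, hx']
        have hA' := hA
        refine ih _ (fun (x : β.ι) => ?_) ?_
        · rw [hA' x]
          split_ifs
          · simp
          · exact hb x
        · refine card_filter_drop (ι := β.ι) (b := fun x => l ⬝ᵥ β.A x) (fun x => ?_) (j := j) ?_ ?_ hn
          · rw [hA x]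
            split_ifs <;> simp
          · rw [hA j]; simp
          · simpa [hj] using hP.ne'
      have h1 : l ⬝ᵥ β.A i ≠ 0 := by rw [hi]; exact hP.ne'
      have h2 : l ⬝ᵥ β.A j ≠ 0 := by rw [hj]; simpa using hP.ne'
      have S1 := hAij i j (by rw [hi, hj]; ring) h2
      have S2 := hAij j i (by rw [hi, hj]; ring) h1
      have hti := β.hθ i
      have htj := β.hθ j
      have hti1 := β.hθ1 i
      have htj1 := β.hθ1 j
      have key : ∀ L : List (Cell κ Lab), (∀ φ, β.eval φ = evalL L φ) →
          (∀ γ ∈ L, CanRefine (fun γ => ∀ ℓ ℓ', SignType.sign (l ⬝ᵥ (γ.pt ℓ).1)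
            = SignType.sign (l ⬝ᵥ (γ.pt ℓ').1)) γ) →
          CanRefine (fun γ => ∀ ℓ ℓ', SignType.sign (l ⬝ᵥ (γ.pt ℓ).1)
            = SignType.sign (l ⬝ᵥ (γ.pt ℓ').1)) β := fun L hL hL' => by
        obtain ⟨L', h3, h4⟩ := canRefineL hL'
        exact ⟨L', fun φ => by rw [hL, h3], h4⟩
      rcases lt_trichotomy (β.θ i) (β.θ j) with h | h | h
      · refine key [β.star i j 1 (by push_cast; linarith) (by push_cast; linarith),
          β.star j i 0 (by push_cast; linarith) (by push_cast; linarith)] (fun φ => ?_) ?_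
        · simp only [evalL_cons, evalL_nil, add_zero]
          rw [eval_star _ hne, eval_star _ hne.symm, ← ENNReal.tsum_add]
          refine tsum_congr fun ℓ => ?_
          by_cases hc : ℓ j + 1 ≤ ℓ i
          · rw [if_pos hc, if_neg (by omega), add_zero]
          · rw [if_neg hc, if_pos (by omega), zero_add]
        · simp only [List.mem_cons, List.not_mem_nil, or_false, forall_eq_or_imp, forall_eq]
          exact ⟨S1 _ _ _, S2 _ _ _⟩
      · refine key [β.star i j 1 (by push_cast; linarith) (by push_cast; linarith),
          β.star j i 1 (by push_cast; linarith) (by push_cast; linarith), β.diag i j]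
          (fun φ => ?_) ?_
        · simp only [evalL_cons, evalL_nil, add_zero]
          rw [eval_star _ hne, eval_star _ hne.symm, eval_diag _ hne h, ← ENNReal.tsum_add,
            ← ENNReal.tsum_add]
          refine tsum_congr fun ℓ => ?_
          rcases lt_trichotomy (ℓ i) (ℓ j) with hc | hc | hc
          · rw [if_neg (by omega), if_pos (by omega), if_neg (by omega), add_zero, zero_add]
          · rw [if_neg (by omega), if_neg (by omega), if_pos (by omega), zero_add, zero_add]
          · rw [if_pos (by omega), if_neg (by omega), if_neg (by omega), zero_add, add_zero]
        · simp only [List.mem_cons, List.not_mem_nil, or_false, forall_eq_or_imp, forall_eq]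
          exact ⟨S1 _ _ _, S2 _ _ _, hdiag⟩
      · refine key [β.star i j 0 (by push_cast; linarith) (by push_cast; linarith),
          β.star j i 1 (by push_cast; linarith) (by push_cast; linarith)] (fun φ => ?_) ?_
        · simp only [evalL_cons, evalL_nil, add_zero]
          rw [eval_star _ hne, eval_star _ hne.symm, ← ENNReal.tsum_add]
          refine tsum_congr fun ℓ => ?_
          by_cases hc : ℓ j + 0 ≤ ℓ i
          · rw [if_pos hc, if_neg (by omega), add_zero]
          · rw [if_neg hc, if_pos (by omega), zero_add]
        · simp only [List.mem_cons, List.not_mem_nil, or_false, forall_eq_or_imp, forall_eq]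
          exact ⟨S1 _ _ _, S2 _ _ _⟩
    · refine CanRefine.self ?_
      have hs : ∀ (ℓ : β.ι → ℕ) (i : β.ι), (0 : ℚ) < ℓ i + β.θ i := fun ℓ i => by
        have := β.hθ i
        positivity
      by_cases hpos : ∃ i, l ⬝ᵥ β.A i = P
      · have hnn : ∀ j, 0 ≤ l ⬝ᵥ β.A j := by
          intro j
          rcases hb j with h | h | h
          · exact h.ge
          · exact h ▸ hP.le
          · obtain ⟨i, hi⟩ := hpos
            exact absurd ⟨i, j, hi, h⟩ hij
        have : ∀ ℓ, SignType.sign (l ⬝ᵥ (β.pt ℓ).1) = 1 := by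
          intro ℓ
          rw [sign_eq_one_iff, dot_pt]
          obtain ⟨i, hi⟩ := hpos
          refine Finset.sum_pos' (fun j _ => mul_nonneg (hs ℓ j).le (hnn j)) ⟨i, Finset.mem_univ _, ?_⟩
          rw [hi]
          exact mul_pos (hs ℓ i) hP
        intro ℓ ℓ'
        rw [this, this]
      · by_cases hneg : ∃ i, l ⬝ᵥ β.A i = -P
        · have hnn : ∀ j, l ⬝ᵥ β.A j ≤ 0 := by
            intro j
            rcases hb j with h | h | h
            · exact h.le
            · exact absurd ⟨j, h⟩ hpos
            · rw [h]; linarith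
          have : ∀ ℓ, SignType.sign (l ⬝ᵥ (β.pt ℓ).1) = -1 := by
            intro ℓ
            rw [sign_eq_neg_one_iff, dot_pt]
            obtain ⟨i, hi⟩ := hneg
            refine Finset.sum_neg' (fun j _ => mul_nonpos_of_nonneg_of_nonpos (hs ℓ j).le (hnn j))
              ⟨i, Finset.mem_univ _, ?_⟩
            rw [hi]
            exact mul_neg_of_pos_of_neg (hs ℓ i) (by linarith)
          intro ℓ ℓ'
          rw [this, this]
        · have h0 : ∀ j, l ⬝ᵥ β.A j = 0 := by
            intro j
            rcases hb j with h | h | h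
            · exact h
            · exact absurd ⟨j, h⟩ hpos
            · exact absurd ⟨j, h⟩ hneg
          intro ℓ ℓ'
          simp [dot_pt, h0]

theorem canRefine_one (l : κ → ℚ) (β : Cell κ Lab) :
    CanRefine (fun γ => ∀ ℓ ℓ', KeyEq {l} (γ.pt ℓ) (γ.pt ℓ')) β := by
  let b : β.ι → ℚ := fun i => l ⬝ᵥ β.A i
  let nu : β.ι → ℕ := fun i => if b i = 0 then 1 else (b i).num.natAbs
  have hnu : ∀ i, 0 < nu i := fun i => by
    simp only [nu]
    split_ifs with h
    · simp
    · simpa [Int.natAbs_pos] using h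
  let N : β.ι → ℕ := fun i => (b i).den * ∏ j ∈ Finset.univ.erase i, nu j
  have hN : ∀ i, 0 < N i := fun i => Nat.mul_pos (b i).den_pos (Finset.prod_pos fun j _ => hnu j)
  let P : ℕ := ∏ j, nu j
  have hP : 0 < P := Finset.prod_pos fun j _ => hnu j
  refine (canRefine_scale β N hN).bind ?_
  rintro γ ⟨e, he⟩
  have hb : ∀ i, l ⬝ᵥ γ.A i = 0 ∨ l ⬝ᵥ γ.A i = (P : ℚ) ∨ l ⬝ᵥ γ.A i = -(P : ℚ) := by
    intro i
    rw [he, dotProduct_smul, smul_eq_mul]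
    change (N (e i) : ℚ) * b (e i) = 0 ∨ (N (e i) : ℚ) * b (e i) = P ∨ (N (e i) : ℚ) * b (e i) = -(P : ℚ)
    generalize e i = x
    by_cases h0 : b x = 0
    · left; rw [h0, mul_zero]
    · right
      have hPx : (P : ℚ) = nu x * (∏ j ∈ Finset.univ.erase x, nu j : ℕ) := by
        rw [← Nat.cast_mul, Finset.mul_prod_erase _ _ (Finset.mem_univ x)]
      have h1 : ((b x).den : ℚ) * b x = (b x).num := Rat.den_mul_eq_num _
      have h2 : (N x : ℚ) * b x = (b x).num * (∏ j ∈ Finset.univ.erase x, nu j : ℕ) := by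
        simp only [N]
        rw [Nat.cast_mul, ← h1]; ring
      have h3 : (nu x : ℚ) = |((b x).num : ℚ)| := by
        simp only [nu, if_neg h0]
        rw [Nat.cast_natAbs]; push_cast; rfl
      rw [h2, hPx, h3]
      rcases abs_choice ((b x).num : ℚ) with h | h
      · left; rw [h]
      · right; rw [h]; ring
  have hInt : ∀ ℓ ℓ', (∃ n : ℤ, l ⬝ᵥ (γ.pt ℓ).1 = n) → ∃ n : ℤ, l ⬝ᵥ (γ.pt ℓ').1 = n := by
    have hbi : ∀ i, ∃ n : ℤ, l ⬝ᵥ γ.A i = n := by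
      intro i
      rcases hb i with h | h | h
      · exact ⟨0, by simp [h]⟩
      · exact ⟨P, by simp [h]⟩
      · exact ⟨-P, by simp [h]⟩
    choose B hB using hbi
    rintro ℓ ℓ' ⟨n, hn⟩
    refine ⟨n + ∑ i, ((ℓ' i : ℤ) - ℓ i) * B i, ?_⟩
    push_cast
    rw [← hn, dot_pt, dot_pt, ← Finset.sum_add_distrib]
    refine Finset.sum_congr rfl fun i _ => ?_
    rw [hB]; ring
  obtain ⟨L, hL, hL'⟩ := (canRefine_sign l P (by exact_mod_cast hP) _ γ hb le_rfl).range
  refine ⟨L, hL, fun δ hδ ℓ ℓ' => ⟨rfl, fun l' hl' => ?_⟩⟩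
  rw [Finset.mem_singleton] at hl'
  subst hl'
  refine ⟨(hL' δ hδ).1 ℓ ℓ', ?_⟩
  obtain ⟨m, hm⟩ := (hL' δ hδ).2 ℓ
  obtain ⟨m', hm'⟩ := (hL' δ hδ).2 ℓ'
  rw [← hm, ← hm']
  exact ⟨hInt _ _, hInt _ _⟩

theorem canRefine_key (Ls : Finset (κ → ℚ)) (β : Cell κ Lab) :
    CanRefine (fun γ => ∀ ℓ ℓ', KeyEq Ls (γ.pt ℓ) (γ.pt ℓ')) β := by
  classical
  induction Ls using Finset.induction_on generalizing β with
  | empty => exact CanRefine.self fun ℓ ℓ' => ⟨rfl, by simp⟩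
  | insert l Ls hl ih =>
    refine (canRefine_one l β).bind fun γ hγ => ?_
    obtain ⟨L, hL, hL'⟩ := (ih γ).range
    refine ⟨L, hL, fun δ hδ ℓ ℓ' => ⟨rfl, fun l' hl' => ?_⟩⟩
    rcases Finset.mem_insert.mp hl' with rfl | hl'
    · obtain ⟨m, hm⟩ := (hL' δ hδ).2 ℓ
      obtain ⟨m', hm'⟩ := (hL' δ hδ).2 ℓ'
      rw [← hm, ← hm']
      exact (hγ m m').2 l' (by simp)
    · exact ((hL' δ hδ).1 ℓ ℓ').2 l' hl'

theorem canRefine_adm {τ : Type} {h : (κ → ℚ) × Lab → τ}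
    (hh : Adm (id : (κ → ℚ) × Lab → (κ → ℚ) × Lab) h) (β : Cell κ Lab) :
    CanRefine (fun γ => ∃ a, ∀ ℓ, h (γ.pt ℓ) = a) β := by
  obtain ⟨Ls, H⟩ := hh
  obtain ⟨L, h1, h2⟩ := canRefine_key Ls β
  exact ⟨L, h1, fun γ hγ => ⟨h (γ.pt 0), fun ℓ => H _ _ (h2 γ hγ ℓ 0)⟩⟩

/-- conic functionals -/
def Conic (Ψ : ((κ → ℚ) × Lab → ℝ≥0∞) → ℝ≥0∞) : Prop :=
  ∃ L : List (Cell κ Lab), ∀ φ, Ψ φ = evalL L φ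

theorem Conic.refine {Ψ : ((κ → ℚ) × Lab → ℝ≥0∞) → ℝ≥0∞} (hΨ : Conic Ψ) {τ : Type}
    {h : (κ → ℚ) × Lab → τ} (hh : Adm (id : (κ → ℚ) × Lab → (κ → ℚ) × Lab) h) :
    ∃ L : List (Cell κ Lab), (∀ φ, Ψ φ = evalL L φ) ∧ ∀ γ ∈ L, ∃ a, ∀ ℓ, h (γ.pt ℓ) = a := by
  obtain ⟨L, hL⟩ := hΨ
  obtain ⟨L', h1, h2⟩ := canRefineL (L := L) (fun γ _ => canRefine_adm hh γ)
  exact ⟨L', fun φ => by rw [hL, h1], h2⟩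

theorem conic_list {κ' Lab' : Type} [Fintype κ'] (L : List (Cell κ Lab))
    (T : ((κ' → ℚ) × Lab' → ℝ≥0∞) → ((κ → ℚ) × Lab → ℝ≥0∞))
    (h : ∀ γ ∈ L, Conic (fun φ => γ.eval (T φ))) : Conic (fun φ => evalL L (T φ)) := by
  induction L with
  | nil => exact ⟨[], fun φ => by simp⟩
  | cons γ L ih =>
    obtain ⟨L1, h1⟩ := h γ (by simp)
    obtain ⟨L2, h2⟩ := ih fun γ hγ => h γ (by simp [hγ])
    exact ⟨L1 ++ L2, fun φ => by
      beta_reduce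
      rw [evalL_cons, evalL_append, ← h1, ← h2]⟩

/-- linear image of a cell -/
def push {κ' Lab' : Type} [Fintype κ'] (β : Cell κ Lab) (a : κ' → κ → ℚ) (b : Lab') :
    Cell κ' Lab' where
  ι := β.ι
  lab := b
  c := β.c
  A := fun i k => a k ⬝ᵥ β.A i
  θ := β.θ
  ρ := β.ρ
  hc := β.hc
  hθ := β.hθ
  hθ1 := β.hθ1
  hρ := β.hρ

theorem Conic.push {κ' Lab' : Type} [Fintype κ'] {Ψ : ((κ → ℚ) × Lab → ℝ≥0∞) → ℝ≥0∞}
    (hΨ : Conic Ψ) {F : κ' → (κ → ℚ) × Lab → ℚ} {h : (κ → ℚ) × Lab → Lab'}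
    (hF : ∀ k, PL (id : (κ → ℚ) × Lab → (κ → ℚ) × Lab) (F k))
    (hh : Adm (id : (κ → ℚ) × Lab → (κ → ℚ) × Lab) h) :
    Conic (fun φ => Ψ (fun v => φ (fun k => F k v, h v))) := by
  choose a ha ha' using hF
  obtain ⟨L, hL, hL'⟩ := hΨ.refine ((Adm.pi ha).pair hh)
  simp only [hL]
  refine conic_list L (fun φ v => φ (fun k => F k v, h v)) fun γ hγ => ?_
  obtain ⟨⟨a0, b0⟩, h0⟩ := hL' γ hγ
  refine ⟨[γ.push a0 b0], fun φ => ?_⟩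
  simp only [evalL_cons, evalL_nil, add_zero]
  change ∑' ℓ : γ.ι → ℕ, γ.wt ℓ * φ (fun k => F k (γ.pt ℓ), h (γ.pt ℓ))
    = ∑' ℓ : γ.ι → ℕ, γ.wt ℓ * φ (∑ i : γ.ι, ((ℓ i : ℚ) + γ.θ i) • (fun k => a0 k ⬝ᵥ γ.A i), b0)
  refine tsum_congr fun ℓ => ?_
  have h1 := h0 ℓ
  simp only [Prod.mk.injEq] at h1
  rw [h1.2]
  congr 3
  funext k
  rw [ha', congrFun h1.1 k, id, dot_pt]
  simp

open Classical in
theorem Conic.restrict {Ψ : ((κ → ℚ) × Lab → ℝ≥0∞) → ℝ≥0∞}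
    (hΨ : Conic Ψ) {P : (κ → ℚ) × Lab → Prop}
    (hh : Adm (id : (κ → ℚ) × Lab → (κ → ℚ) × Lab) P) :
    Conic (fun φ => Ψ (fun v => if P v then φ v else 0)) := by
  obtain ⟨L, hL, hL'⟩ := hΨ.refine hh
  simp only [hL]
  refine conic_list L (fun φ v => if P v then φ v else 0) fun γ hγ => ?_
  obtain ⟨a0, h0⟩ := hL' γ hγ
  by_cases ha : a0
  · refine ⟨[γ], fun φ => ?_⟩
    simp only [evalL_cons, evalL_nil, add_zero]
    unfold eval
    refine tsum_congr fun ℓ => ?_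
    beta_reduce
    rw [if_pos (by rw [h0]; exact ha)]
  · refine ⟨[], fun φ => ?_⟩
    simp only [evalL_nil]
    unfold eval
    rw [ENNReal.tsum_eq_zero]
    intro ℓ
    beta_reduce
    rw [if_neg (by rw [h0]; exact ha), mul_zero]

theorem Conic.add {Ψ Ψ' : ((κ → ℚ) × Lab → ℝ≥0∞) → ℝ≥0∞} (h : Conic Ψ) (h' : Conic Ψ') :
    Conic (fun φ => Ψ φ + Ψ' φ) := by
  obtain ⟨L, hL⟩ := h
  obtain ⟨L', hL'⟩ := h'
  exact ⟨L ++ L', fun φ => by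
    beta_reduce
    rw [evalL_append, hL, hL']⟩

theorem Conic.sum {J : Type} (s : Finset J) {Ψ : J → ((κ → ℚ) × Lab → ℝ≥0∞) → ℝ≥0∞}
    (h : ∀ j ∈ s, Conic (Ψ j)) : Conic (fun φ => ∑ j ∈ s, Ψ j φ) := by
  classical
  induction s using Finset.induction_on with
  | empty => exact ⟨[], fun φ => by simp⟩
  | insert a s ha ih =>
    simp only [Finset.sum_insert ha]
    exact (h a (by simp)).add (ih fun j hj => h j (by simp [hj]))

/-- linear natural-valued functions on a cell -/
theorem exists_nat_linear (β : Cell κ Lab) (l : κ → ℚ) (g : (β.ι → ℕ) → ℕ)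
    (hg : ∀ ℓ, l ⬝ᵥ (β.pt ℓ).1 = g ℓ) :
    ∃ b : β.ι → ℕ, (∀ ℓ, g ℓ = g 0 + ∑ i, ℓ i * b i) ∧ (g 0 : ℚ) = ∑ i, β.θ i * b i ∧
      ∀ i, l ⬝ᵥ β.A i = b i := by
  have hlin : ∀ ℓ, (g ℓ : ℚ) = g 0 + ∑ i, (ℓ i : ℚ) * (l ⬝ᵥ β.A i) := by
    intro ℓ
    rw [← hg, ← hg, dot_pt, dot_pt, ← Finset.sum_add_distrib]
    refine Finset.sum_congr rfl fun i _ => ?_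
    simp; ring
  have hnn : ∀ i, ∃ b : ℕ, l ⬝ᵥ β.A i = b := by
    intro i
    have hsingle : ∀ n : ℕ, (g (Pi.single i n) : ℚ) = g 0 + n * (l ⬝ᵥ β.A i) := by
      intro n
      rw [hlin, Finset.sum_eq_single i]
      · simp
      · intro j _ hj; simp [hj]
      · simp
    have h1 : l ⬝ᵥ β.A i = ((g (Pi.single i 1) : ℤ) - g 0 : ℤ) := by
      have := hsingle 1
      push_cast at this ⊢
      linarith
    set z : ℤ := (g (Pi.single i 1) : ℤ) - g 0 with hz
    have h2 : 0 ≤ z := by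
      by_contra hneg
      have hz1 : (z : ℚ) ≤ -1 := by
        have : z ≤ -1 := by omega
        exact_mod_cast this
      have := hsingle (g 0 + 1)
      rw [h1] at this
      have h3 : (0 : ℚ) ≤ g (Pi.single i (g 0 + 1)) := by positivity
      rw [this] at h3
      push_cast at h3
      have h4 : (0 : ℚ) ≤ g 0 := by positivity
      nlinarith
    refine ⟨z.toNat, ?_⟩
    rw [h1]
    exact_mod_cast (Int.toNat_of_nonneg h2).symm
  choose b hb using hnn
  refine ⟨b, fun ℓ => ?_, ?_, hb⟩
  · have := hlin ℓ
    simp only [hb] at this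
    exact_mod_cast this
  · rw [← hg, dot_pt]
    simp [hb]

/-- multiplying weights by a power -/
theorem Conic.weight {Ψ : ((κ → ℚ) × Lab → ℝ≥0∞) → ℝ≥0∞} (hΨ : Conic Ψ)
    {f : (κ → ℚ) × Lab → ℚ} (hf : PL (id : (κ → ℚ) × Lab → (κ → ℚ) × Lab) f)
    {P : (κ → ℚ) × Lab → Prop} (hP : Ψ (fun v => open Classical in if P v then 0 else 1) = 0)
    (g : (κ → ℚ) × Lab → ℕ) (hg : ∀ v, P v → f v = g v) (q : ℚ≥0) (hq : q ≠ 0) :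
    Conic (fun φ => Ψ (fun v => nn q ^ g v * φ v)) := by
  obtain ⟨a, ha, ha'⟩ := hf
  obtain ⟨L, hL, hL'⟩ := hΨ.refine ha
  rw [hL] at hP
  simp only [hL]
  refine conic_list L (fun φ v => nn q ^ g v * φ v) fun γ hγ => ?_
  obtain ⟨a0, h0⟩ := hL' γ hγ
  have hPt : ∀ ℓ, P (γ.pt ℓ) := fun ℓ => by
    have := evalL_eq_zero hP hγ ℓ
    by_contra hcon
    simp [hcon] at this
  obtain ⟨b, hb, -⟩ := γ.exists_nat_linear a0 (fun ℓ => g (γ.pt ℓ)) (fun ℓ => by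
    rw [← hg _ (hPt ℓ), ha', h0]; rfl)
  refine ⟨[{ γ with
    c := γ.c * q ^ g (γ.pt 0)
    ρ := fun i => γ.ρ i * q ^ b i
    hc := mul_ne_zero γ.hc (pow_ne_zero _ hq)
    hρ := fun i => mul_ne_zero (γ.hρ i) (pow_ne_zero _ hq) }], fun φ => ?_⟩
  simp only [evalL_cons, evalL_nil, add_zero]
  change ∑' ℓ : γ.ι → ℕ, (nn γ.c * ∏ i, nn (γ.ρ i) ^ ℓ i) * (nn q ^ g (γ.pt ℓ) * φ (γ.pt ℓ))
    = ∑' ℓ : γ.ι → ℕ, (nn (γ.c * q ^ g (γ.pt 0)) * ∏ i, nn (γ.ρ i * q ^ b i) ^ ℓ i) * φ (γ.pt ℓ)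
  refine tsum_congr fun ℓ => ?_
  have hb1 := hb ℓ
  rw [hb1, pow_add, ← Finset.prod_pow_eq_pow_sum, ← mul_assoc]
  congr 1
  simp only [nn_mul, nn_pow, mul_pow, Finset.prod_mul_distrib, ← pow_mul, mul_comm (b _)]
  ring

theorem Conic.const_mul {Ψ : ((κ → ℚ) × Lab → ℝ≥0∞) → ℝ≥0∞} (hΨ : Conic Ψ) (q : ℚ≥0)
    (hq : q ≠ 0) : Conic (fun φ => nn q * Ψ φ) := by
  obtain ⟨L, hL⟩ := hΨ
  refine ⟨L.map fun γ => { γ with c := q * γ.c, hc := mul_ne_zero hq γ.hc }, fun φ => ?_⟩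
  beta_reduce
  rw [hL]
  unfold evalL
  rw [List.map_map, ← List.sum_map_mul_left]
  congr 1
  refine List.map_congr_left fun γ _ => ?_
  change nn q * ∑' ℓ : γ.ι → ℕ, (nn γ.c * ∏ i, nn (γ.ρ i) ^ ℓ i) * φ (γ.pt ℓ)
    = ∑' ℓ : γ.ι → ℕ, (nn (q * γ.c) * ∏ i, nn (γ.ρ i) ^ ℓ i) * φ (γ.pt ℓ)
  rw [← ENNReal.tsum_mul_left]
  refine tsum_congr fun ℓ => ?_
  rw [nn_mul]
  ring

end Cell

section Padic
open Polynomial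
set_option linter.unusedSectionVars false
variable {p : ℕ} [hp : Fact p.Prime]

/-- angular component -/
noncomputable def ac (a : ℤ_[p]) : ZMod p :=
  open Classical in
  if h : a = 0 then 0 else PadicInt.toZMod ((PadicInt.unitCoeff h : ℤ_[p]ˣ) : ℤ_[p])

/-- `a = p ^ m * u` with `u` reducing to `s` -/
def Lead (a : ℤ_[p]) (m : ℕ) (s : ZMod p) : Prop :=
  ∃ u : ℤ_[p], a = (p : ℤ_[p]) ^ m * u ∧ PadicInt.toZMod u = s

theorem pp_ne (m : ℕ) : ((p : ℤ_[p]) ^ m) ≠ 0 :=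
  pow_ne_zero _ (by exact_mod_cast hp.out.ne_zero)

theorem Lead.add {a b : ℤ_[p]} {m : ℕ} {s t : ZMod p} (h : Lead a m s) (h' : Lead b m t) :
    Lead (a + b) m (s + t) := by
  obtain ⟨u, rfl, rfl⟩ := h
  obtain ⟨w, rfl, rfl⟩ := h'
  exact ⟨u + w, by ring, by simp⟩

theorem Lead.zero (m : ℕ) : Lead (0 : ℤ_[p]) m 0 := ⟨0, by simp, by simp⟩

theorem Lead.sum {J : Type} (S : Finset J) {a : J → ℤ_[p]} {m : ℕ} {s : J → ZMod p}
    (h : ∀ j ∈ S, Lead (a j) m (s j)) : Lead (∑ j ∈ S, a j) m (∑ j ∈ S, s j) := by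
  classical
  induction S using Finset.induction_on with
  | empty => simpa using Lead.zero m
  | insert j S hj ih =>
    rw [Finset.sum_insert hj, Finset.sum_insert hj]
    exact (h j (Finset.mem_insert_self _ _)).add
      (ih fun i hi => h i (Finset.mem_insert_of_mem hi))

theorem Lead.mul {a b : ℤ_[p]} {m n : ℕ} {s t : ZMod p} (h : Lead a m s) (h' : Lead b n t) :
    Lead (a * b) (m + n) (s * t) := by
  obtain ⟨u, rfl, rfl⟩ := h
  obtain ⟨w, rfl, rfl⟩ := h'
  exact ⟨u * w, by ring, by simp⟩

theorem Lead.neg {a : ℤ_[p]} {m : ℕ} {s : ZMod p} (h : Lead a m s) : Lead (-a) m (-s) := by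
  obtain ⟨u, rfl, rfl⟩ := h
  exact ⟨-u, by ring, by simp⟩

theorem Lead.sub {a b : ℤ_[p]} {m : ℕ} {s t : ZMod p} (h : Lead a m s) (h' : Lead b m t) :
    Lead (a - b) m (s - t) := by
  simpa [sub_eq_add_neg] using h.add h'.neg

theorem Lead.pow {a : ℤ_[p]} {m : ℕ} {s : ZMod p} (h : Lead a m s) (l : ℕ) :
    Lead (a ^ l) (m * l) (s ^ l) := by
  obtain ⟨u, rfl, rfl⟩ := h
  exact ⟨u ^ l, by rw [mul_pow, pow_mul], by simp⟩

theorem Lead.unique {a : ℤ_[p]} {m : ℕ} {s t : ZMod p} (h : Lead a m s) (h' : Lead a m t) :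
    s = t := by
  obtain ⟨u, rfl, rfl⟩ := h
  obtain ⟨w, e, rfl⟩ := h'
  rw [mul_left_cancel₀ (pp_ne m) e]

theorem toZMod_eq_zero_iff (u : ℤ_[p]) : PadicInt.toZMod u = 0 ↔ (p : ℤ_[p]) ∣ u := by
  rw [← RingHom.mem_ker, PadicInt.ker_toZMod, PadicInt.maximalIdeal_eq_span_p,
    Ideal.mem_span_singleton]

theorem lead_self {a : ℤ_[p]} (h : a ≠ 0) : Lead a a.valuation (ac a) := by
  refine ⟨PadicInt.unitCoeff h, ?_, by rw [ac, dif_neg h]⟩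
  rw [mul_comm]; exact PadicInt.unitCoeff_spec h

theorem ac_ne_zero {a : ℤ_[p]} (h : a ≠ 0) : ac a ≠ 0 := by
  rw [ac, dif_neg h]
  exact ((PadicInt.unitCoeff h).isUnit.map PadicInt.toZMod).ne_zero

theorem ac_zero : ac (0 : ℤ_[p]) = 0 := by simp [ac]

theorem Lead.ne_zero {a : ℤ_[p]} {m : ℕ} {s : ZMod p} (h : Lead a m s) (hs : s ≠ 0) : a ≠ 0 := by
  obtain ⟨u, rfl, rfl⟩ := h
  refine mul_ne_zero (pp_ne m) ?_
  rintro rfl; simp at hs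

theorem isUnit_of_toZMod {u : ℤ_[p]} (h : PadicInt.toZMod u ≠ 0) : IsUnit u := by
  by_contra hu
  apply h
  rw [← RingHom.mem_ker, PadicInt.ker_toZMod]
  exact (IsLocalRing.mem_maximalIdeal _).mpr hu

theorem Lead.val {a : ℤ_[p]} {m : ℕ} {s : ZMod p} (h : Lead a m s) (hs : s ≠ 0) :
    a.valuation = m := by
  obtain ⟨u, rfl, rfl⟩ := h
  have hu := isUnit_of_toZMod hs
  rw [PadicInt.valuation_p_pow_mul _ _ hu.ne_zero]
  have := PadicInt.norm_eq_zpow_neg_valuation hu.ne_zero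
  rw [PadicInt.isUnit_iff.mp hu] at this
  have h1 : (1:ℝ) < p := by exact_mod_cast hp.out.one_lt
  have h2 : (p:ℝ) ^ (-(u.valuation : ℤ)) = (p:ℝ) ^ (0:ℤ) := by rw [← this]; simp
  have := zpow_right_injective₀ (by linarith) (ne_of_gt h1) h2
  omega

theorem Lead.ac {a : ℤ_[p]} {m : ℕ} {s : ZMod p} (h : Lead a m s) (hs : s ≠ 0) : ac a = s := by
  have h1 := lead_self (h.ne_zero hs)
  rw [h.val hs] at h1
  exact h1.unique h

theorem lead_iff {a : ℤ_[p]} {m : ℕ} {s : ZMod p} (hs : s ≠ 0) :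
    Lead a m s ↔ a ≠ 0 ∧ a.valuation = m ∧ _root_.ac a = s := by
  refine ⟨fun h => ⟨h.ne_zero hs, h.val hs, h.ac hs⟩, ?_⟩
  rintro ⟨h, rfl, rfl⟩
  exact lead_self h

theorem lead_of_lt {a : ℤ_[p]} {m : ℕ} (h : m < a.valuation) : Lead a m 0 := by
  have ha : a ≠ 0 := by rintro rfl; simp at h
  obtain ⟨u, hu, -⟩ := lead_self ha
  obtain ⟨e, he⟩ := Nat.exists_eq_add_of_lt h
  refine ⟨(p : ℤ_[p]) ^ (e + 1) * u, ?_, ?_⟩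
  · rw [← mul_assoc, ← pow_add, ← add_assoc, ← he]; exact hu
  · rw [toZMod_eq_zero_iff]; exact Dvd.dvd.mul_right (dvd_pow_self _ (by omega)) _

theorem Lead.mono {a : ℤ_[p]} {m n : ℕ} {s : ZMod p} (h : Lead a m s) (hn : n < m) :
    Lead a n 0 := by
  obtain ⟨u, rfl, -⟩ := h
  obtain ⟨e, rfl⟩ := Nat.exists_eq_add_of_lt hn
  refine ⟨(p : ℤ_[p]) ^ (e + 1) * u, by ring, ?_⟩
  rw [toZMod_eq_zero_iff]; exact Dvd.dvd.mul_right (dvd_pow_self _ (by omega)) _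

theorem lead_zero_iff {a : ℤ_[p]} {m : ℕ} : Lead a m 0 ↔ a = 0 ∨ m < a.valuation := by
  constructor
  · rintro ⟨u, rfl, hu⟩
    by_cases h : u = 0
    · left; simp [h]
    right
    rw [toZMod_eq_zero_iff] at hu
    obtain ⟨w, rfl⟩ := hu
    have hw : w ≠ 0 := by rintro rfl; simp at h
    rw [PadicInt.valuation_p_pow_mul _ _ h]
    have := PadicInt.valuation_p_pow_mul 1 w hw
    rw [pow_one] at this
    omega
  · rintro (rfl | h)
    · exact Lead.zero m
    · exact lead_of_lt h

theorem valuation_mul' {a b : ℤ_[p]} (ha : a ≠ 0) (hb : b ≠ 0) :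
    (a * b).valuation = a.valuation + b.valuation :=
  ((lead_self ha).mul (lead_self hb)).val (mul_ne_zero (ac_ne_zero ha) (ac_ne_zero hb))

theorem ac_mul (a b : ℤ_[p]) : ac (a * b) = ac a * ac b := by
  by_cases ha : a = 0
  · simp [ha, ac_zero]
  by_cases hb : b = 0
  · simp [hb, ac_zero]
  exact ((lead_self ha).mul (lead_self hb)).ac (mul_ne_zero (ac_ne_zero ha) (ac_ne_zero hb))

/-- residual polynomial of `f` on the ball of radius `k` round `c` -/
def Resid (f : ℤ_[p][X]) (c : ℤ_[p]) (k m : ℕ) (R : (ZMod p)[X]) : Prop :=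
  ∃ g : ℤ_[p][X], f.comp (C c + C ((p : ℤ_[p]) ^ k) * X) = C ((p : ℤ_[p]) ^ m) * g ∧
    g.map PadicInt.toZMod = R ∧ g.natDegree ≤ f.natDegree

theorem exists_resid (f : ℤ_[p][X]) (c : ℤ_[p]) (k m D : ℕ) (hD : f.natDegree ≤ D) (r : ℕ → ZMod p)
    (h : ∀ l ≤ D, Lead ((taylor c f).coeff l * (p : ℤ_[p]) ^ (k * l)) m (r l)) :
    Resid f c k m (∑ l ∈ Finset.range (D + 1), C (r l) * X ^ l) := by
  have h' : ∀ l : ℕ, ∃ u : ℤ_[p], l ≤ D →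
      ((taylor c f).coeff l * (p : ℤ_[p]) ^ (k * l) = (p : ℤ_[p]) ^ m * u ∧ PadicInt.toZMod u = r l) := by
    intro l
    by_cases hl : l ≤ D
    · obtain ⟨u, hu⟩ := h l hl
      exact ⟨u, fun _ => hu⟩
    · exact ⟨0, fun h => absurd h hl⟩
  choose u hu using h'
  have key : f.comp (C c + C ((p : ℤ_[p]) ^ k) * X) =
      C ((p : ℤ_[p]) ^ m) * ∑ l ∈ Finset.range (D + 1), C (u l) * X ^ l := by
    have e1 : f.comp (C c + C ((p : ℤ_[p]) ^ k) * X) =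
        (taylor c f).comp (C ((p : ℤ_[p]) ^ k) * X) := by
      rw [taylor_apply, comp_assoc]; simp [add_comm]
    ext l
    rw [e1, comp_C_mul_X_coeff, coeff_C_mul, finsetSum_coeff]
    simp only [coeff_C_mul_X_pow]
    rw [Finset.sum_ite_eq]
    by_cases hl : l ≤ D
    · rw [if_pos (by simp; omega), ← (hu l hl).1, pow_mul]
    · rw [if_neg (by simp; omega), coeff_eq_zero_of_natDegree_lt]
      · simp
      · rw [natDegree_taylor]; omega
  refine ⟨_, key, ?_, ?_⟩
  · rw [Polynomial.map_sum]
    refine Finset.sum_congr rfl fun l hl => ?_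
    have : l ≤ D := by have := Finset.mem_range.mp hl; omega
    simp [(hu l this).2]
  · set g := ∑ l ∈ Finset.range (D + 1), C (u l) * X ^ l with hg
    have h1 : g.natDegree = (C ((p : ℤ_[p]) ^ m) * g).natDegree := by
      rw [natDegree_C_mul (pp_ne m)]
    rw [h1, ← key, natDegree_comp]
    calc _ ≤ f.natDegree * 1 := by
          gcongr
          refine (natDegree_add_le _ _).trans ?_
          rw [natDegree_C, Nat.zero_max]
          exact (natDegree_C_mul_le _ _).trans natDegree_X_le
      _ = _ := mul_one _

theorem Resid.lead {f : ℤ_[p][X]} {c : ℤ_[p]} {k m : ℕ} {R : (ZMod p)[X]} (h : Resid f c k m R)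
    {t : ℤ_[p]} {σ : ZMod p} (ht : Lead (t - c) k σ) : Lead (f.eval t) m (R.eval σ) := by
  obtain ⟨g, e, rfl, -⟩ := h
  obtain ⟨u, hu, rfl⟩ := ht
  refine ⟨g.eval u, ?_, ?_⟩
  · have := congrArg (eval u) e
    simp only [eval_comp, eval_add, eval_mul, eval_C, eval_X] at this
    rw [← this, ← hu]; congr 1; ring
  · rw [eval_map, ← eval₂_hom]

theorem natDegree_map_derivative_ne {R : (ZMod p)[X]} (hd : R.natDegree < p)
    (h0 : R ≠ 0) {σ : ZMod p} (hr : R.eval σ = 0) : derivative R ≠ 0 := by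
  intro h
  have hpos : 0 < R.natDegree := by
    by_contra hn
    have : R.natDegree = 0 := by omega
    rw [natDegree_eq_zero] at this
    obtain ⟨a, rfl⟩ := this
    simp at hr; simp [hr] at h0
  have h1 : (derivative R).coeff (R.natDegree - 1) = 0 := by rw [h]; simp
  rw [coeff_derivative] at h1
  have h2 : R.natDegree - 1 + 1 = R.natDegree := by omega
  rw [h2] at h1
  have h3 : (((R.natDegree - 1 : ℕ) : ZMod p) + 1) = ((R.natDegree : ℕ) : ZMod p) := by
    exact_mod_cast congrArg (Nat.cast : ℕ → ZMod p) h2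
  rw [h3] at h1
  rcases mul_eq_zero.mp h1 with h4 | h4
  · exact h0 (leadingCoeff_eq_zero.mp h4)
  · rw [ZMod.natCast_eq_zero_iff] at h4
    exact absurd (Nat.le_of_dvd hpos h4) (by omega)

theorem hensel_mod (g : ℤ_[p][X]) (σ : ZMod p) (h0 : (g.map PadicInt.toZMod).eval σ = 0)
    (h1 : (derivative (g.map PadicInt.toZMod)).eval σ ≠ 0) :
    ∃ z : ℤ_[p], PadicInt.toZMod z = σ ∧ g.eval z = 0 ∧
      ∀ y : ℤ_[p], PadicInt.toZMod y = σ → g.eval y = 0 → y = z := by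
  obtain ⟨a, ha⟩ := ZMod.ringHom_surjective (PadicInt.toZMod (p := p)) σ
  subst ha
  have e0 : PadicInt.toZMod (g.eval a) = 0 := by rw [← h0, eval_map, ← eval₂_hom]
  have e1 : PadicInt.toZMod ((derivative g).eval a) ≠ 0 := by
    rw [derivative_map] at h1
    rwa [eval_map, eval₂_hom] at h1
  have n1 : ‖(derivative g).eval a‖ = 1 := PadicInt.isUnit_iff.mp (isUnit_of_toZMod e1)
  have n0 : ‖g.eval a‖ < 1 := by
    rw [toZMod_eq_zero_iff] at e0
    exact (PadicInt.norm_lt_one_iff_dvd _).mpr e0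
  obtain ⟨z, hz, hza, -, hu⟩ := hensels_lemma (R := ℤ_[p]) (F := g) (a := a)
    (by simpa [n1] using n0)
  have iff : ∀ y : ℤ_[p], PadicInt.toZMod y = PadicInt.toZMod a ↔ ‖y - a‖ < 1 := by
    intro y
    rw [PadicInt.norm_lt_one_iff_dvd, ← toZMod_eq_zero_iff, map_sub, sub_eq_zero]
  simp only [coe_aeval_eq_eval, n1] at hz hza hu
  refine ⟨z, (iff z).mpr hza, hz, fun y hy hy' => hu y hy' ((iff y).mp hy)⟩

theorem closeness (n : ℕ) : ∀ (g : ℤ_[p][X]) (σ : ZMod p), g.natDegree < n → g.natDegree < p →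
    g.map PadicInt.toZMod ≠ 0 → (g.map PadicInt.toZMod).eval σ = 0 →
    ∃ (j : ℕ) (z : ℤ_[p]), PadicInt.toZMod z = σ ∧ derivative^[j] g ≠ 0 ∧
      (derivative^[j] g).eval z = 0 := by
  induction n with
  | zero => intro g σ h; omega
  | succ n ih =>
    intro g σ hn hp' h0 hr
    by_cases h1 : (derivative (g.map PadicInt.toZMod)).eval σ = 0
    · have hd := natDegree_map_derivative_ne (natDegree_map_le.trans_lt hp') h0 hr
      rw [derivative_map] at hd h1
      have hne : g.natDegree ≠ 0 := by
        intro h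
        rw [natDegree_eq_zero] at h
        obtain ⟨a, rfl⟩ := h
        simp at hd
      have hlt := natDegree_derivative_lt hne
      obtain ⟨j, z, hz, h2, h3⟩ := ih (derivative g) σ (by omega) (by omega) hd h1
      exact ⟨j + 1, z, hz, h2, h3⟩
    · obtain ⟨z, hz, h2, -⟩ := hensel_mod g σ hr h1
      refine ⟨0, z, hz, ?_, h2⟩
      rintro h; simp only [Function.iterate_zero, id] at h; simp [h] at h0

theorem iterate_derivative_comp_lin (f : ℤ_[p][X]) (c b : ℤ_[p]) (j : ℕ) :
    derivative^[j] (f.comp (C c + C b * X)) = C (b ^ j) * (derivative^[j] f).comp (C c + C b * X) := by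
  induction j with
  | zero => simp
  | succ j ih =>
    rw [Function.iterate_succ_apply', ih, derivative_C_mul, derivative_comp,
      Function.iterate_succ_apply']
    simp only [derivative_add, derivative_C, derivative_C_mul, derivative_X, map_pow, zero_add]
    ring

theorem transfer {f g : ℤ_[p][X]} {c : ℤ_[p]} {k m j : ℕ}
    (e : f.comp (C c + C ((p : ℤ_[p]) ^ k) * X) = C ((p : ℤ_[p]) ^ m) * g) {z : ℤ_[p]}
    (h1 : derivative^[j] g ≠ 0) (h2 : (derivative^[j] g).eval z = 0) :
    hasseDeriv j f ≠ 0 ∧ (hasseDeriv j f).eval (c + (p : ℤ_[p]) ^ k * z) = 0 := by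
  have e' := congrArg (derivative^[j]) e
  rw [iterate_derivative_comp_lin, iterate_derivative_C_mul] at e'
  have hf : derivative^[j] f = (Nat.factorial j : ℤ_[p][X]) * hasseDeriv j f := by
    rw [← factorial_smul_hasseDeriv]; simp
  constructor
  · intro h
    rw [hf, h] at e'
    simp only [mul_zero, zero_comp] at e'
    rcases mul_eq_zero.mp e'.symm with h3 | h3
    · exact pp_ne m (C_eq_zero.mp h3)
    · exact h1 h3
  · have e2 := congrArg (eval z) e'
    rw [eval_mul, eval_mul, h2, mul_zero, eval_C, eval_comp, hf] at e2
    simp only [eval_add, eval_mul, eval_C, eval_X, eval_natCast] at e2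
    rcases mul_eq_zero.mp e2 with h3 | h3
    · exact absurd h3 (pow_ne_zero _ (pp_ne k))
    · rcases mul_eq_zero.mp h3 with h4 | h4
      · exact absurd h4 (by exact_mod_cast Nat.factorial_ne_zero j)
      · exact h4

theorem Resid.close {f : ℤ_[p][X]} {c : ℤ_[p]} {k m : ℕ} {R : (ZMod p)[X]} (h : Resid f c k m R)
    (hf : f.natDegree < p) (hR : R ≠ 0) {σ : ZMod p} (h0 : R.eval σ = 0) :
    ∃ (j : ℕ) (t : ℤ_[p]), Lead (t - c) k σ ∧ hasseDeriv j f ≠ 0 ∧ (hasseDeriv j f).eval t = 0 := by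
  obtain ⟨g, e, rfl, hd⟩ := h
  obtain ⟨j, z, hz, h1, h2⟩ := closeness _ g σ (Nat.lt_succ_self _) (by omega) hR h0
  refine ⟨j, c + (p : ℤ_[p]) ^ k * z, ⟨z, by ring, hz⟩, transfer e h1 h2⟩

theorem Resid.close' {f : ℤ_[p][X]} {c : ℤ_[p]} {k m : ℕ} {R : (ZMod p)[X]} (h : Resid f c k m R)
    (hf : f.natDegree < p) (hR : R ≠ 0) {σ : ZMod p} (h0 : R.eval σ = 0)
    (h1 : (derivative R).eval σ = 0) :
    ∃ (j : ℕ) (t : ℤ_[p]), 1 ≤ j ∧ Lead (t - c) k σ ∧ hasseDeriv j f ≠ 0 ∧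
      (hasseDeriv j f).eval t = 0 := by
  obtain ⟨g, e, rfl, hd⟩ := h
  have hd' := natDegree_map_derivative_ne (natDegree_map_le.trans_lt (by omega)) hR h0
  rw [derivative_map] at hd' h1
  obtain ⟨j, z, hz, h3, h2⟩ := closeness _ (derivative g) σ (Nat.lt_succ_self _)
    ((natDegree_derivative_le g).trans_lt (by omega)) hd' h1
  refine ⟨j + 1, c + (p : ℤ_[p]) ^ k * z, by omega, ⟨z, by ring, hz⟩, ?_⟩
  exact transfer e (j := j + 1) h3 h2

theorem Resid.root {f : ℤ_[p][X]} {c : ℤ_[p]} {k m : ℕ} {R : (ZMod p)[X]} (h : Resid f c k m R)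
    {σ : ZMod p} (h0 : R.eval σ = 0) (h1 : (derivative R).eval σ ≠ 0) :
    ∃ t : ℤ_[p], Lead (t - c) k σ ∧ f.eval t = 0 ∧
      ∀ y : ℤ_[p], Lead (y - c) k σ → f.eval y = 0 → y = t := by
  obtain ⟨g, e, rfl, hd⟩ := h
  have ev : ∀ z, f.eval (c + (p : ℤ_[p]) ^ k * z) = (p : ℤ_[p]) ^ m * g.eval z := by
    intro z
    have := congrArg (eval z) e
    simpa only [eval_comp, eval_add, eval_mul, eval_C, eval_X] using this
  obtain ⟨z, hz, h2, h3⟩ := hensel_mod g σ h0 h1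
  refine ⟨c + (p : ℤ_[p]) ^ k * z, ⟨z, by ring, hz⟩, by rw [ev, h2, mul_zero], ?_⟩
  rintro y ⟨u, hu, hu'⟩ hy
  have : y = c + (p : ℤ_[p]) ^ k * u := by rw [← hu]; ring
  subst this
  rw [ev] at hy
  rw [h3 u hu' ((mul_eq_zero.mp hy).resolve_left (pp_ne m))]

end Padic

section TameSec
open Polynomial
set_option linter.unusedSectionVars false
set_option linter.unusedVariables false
variable {p : ℕ} [hp : Fact p.Prime]
variable {X κ Lab : Type} [Fintype κ] [Finite Lab] {δ : X → (κ → ℚ) × Lab}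

theorem Adm.pull {W τ : Type} (u : W → X) {h : X → τ} (hh : Adm δ h) :
    Adm (fun w => δ (u w)) (fun w => h (u w)) := by
  obtain ⟨Ls, H⟩ := hh
  exact ⟨Ls, fun x y e => H _ _ e⟩

theorem PL.pull {W : Type} (u : W → X) {f : X → ℚ} (hf : PL δ f) :
    PL (fun w => δ (u w)) (fun w => f (u w)) := by
  obtain ⟨h, ah, eh⟩ := hf
  exact ⟨fun w => h (u w), ah.pull u, fun w => eh (u w)⟩

/-- functions with piecewise linear valuation and admissible angular component -/
def Tame (δ : X → (κ → ℚ) × Lab) (g : X → ℤ_[p]) : Prop :=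
  PL δ (fun x => ((g x).valuation : ℚ)) ∧ Adm δ (fun x => ac (g x))

theorem Tame.pull {W : Type} (u : W → X) {g : X → ℤ_[p]} (hg : Tame δ g) :
    Tame (fun w => δ (u w)) (fun w => g (u w)) := ⟨hg.1.pull u, hg.2.pull u⟩

theorem Tame.congr {g g' : X → ℤ_[p]} (hg : Tame δ g) (e : ∀ x, g' x = g x) : Tame δ g' := by
  rwa [show g' = g from funext e]

theorem ac_eq_zero {a : ℤ_[p]} : ac a = 0 ↔ a = 0 :=
  ⟨fun h => by_contra fun h' => ac_ne_zero h' h, fun h => h ▸ ac_zero⟩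

theorem Tame.eq_zero {g : X → ℤ_[p]} (hg : Tame δ g) : Adm δ (fun x => g x = 0) :=
  (hg.2.comp (fun s => s = 0)).congr fun x => propext ac_eq_zero.symm

theorem Tame.zero : Tame (p := p) δ (fun _ => 0) :=
  ⟨PL.zero.congr fun x => by simp, Adm.const _⟩

theorem Tame.cover {J : Type} [Finite J] {P : J → X → Prop} (hP : ∀ j, Adm δ (P j))
    (hex : ∀ x, ∃ j, P j x) {g : X → ℤ_[p]}
    (h : ∀ j, Tame (fun w : {x // P j x} => δ w.1) (fun w => g w.1)) : Tame δ g := by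
  have h1 := fun j => (h j).1.extend
  have h2 := fun j => (h j).2.extend
  choose F aF eF using h1
  choose G aG eG using h2
  exact ⟨PL.cover hP (fun j => (aF j).pull δ) hex fun x j hj => eF j ⟨x, hj⟩,
    Adm.cover hP (fun j => (aG j).pull δ) hex fun x j hj => eG j ⟨x, hj⟩⟩

theorem Tame.cases {P : X → Prop} (hP : Adm δ P) {g : X → ℤ_[p]}
    (h : Tame (fun w : {x // P x} => δ w.1) (fun w => g w.1))
    (h' : Tame (fun w : {x // ¬ P x} => δ w.1) (fun w => g w.1)) : Tame δ g := by
  refine Tame.cover (J := Bool) (P := fun b x => if b then P x else ¬ P x) ?_ ?_ ?_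
  · rintro (_ | _)
    · simpa using hP.not
    · simpa using hP
  · intro x
    by_cases h : P x
    · exact ⟨true, by simpa⟩
    · exact ⟨false, by simpa⟩
  · rintro (_ | _)
    · simpa using h'
    · simpa using h

theorem Tame.mul {g h : X → ℤ_[p]} (hg : Tame δ g) (hh : Tame δ h) :
    Tame δ (fun x => g x * h x) := by
  classical
  refine ⟨?_, (hg.2.comp₂ hh.2 (fun a b => a * b)).congr fun x => ac_mul _ _⟩
  refine (PL.ite (hg.eq_zero.or hh.eq_zero) PL.zero (hg.1.add hh.1)).congr fun x => ?_
  split_ifs with hx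
  · rcases hx with hx | hx <;> simp [hx]
  · push Not at hx
    rw [valuation_mul' hx.1 hx.2]; push_cast; rfl

theorem Tame.pow {g : X → ℤ_[p]} (hg : Tame δ g) (hne : ∀ x, g x ≠ 0) (e : ℕ) :
    Tame δ (fun x => g x ^ e) := by
  induction e with
  | zero =>
    have h1 : Lead (1 : ℤ_[p]) 0 1 := ⟨1, by simp, by simp⟩
    refine ⟨PL.zero.congr fun x => ?_, (Adm.const (1 : ZMod p)).congr fun x => ?_⟩
    · simp
    · simp only [pow_zero]; exact h1.ac one_ne_zero
  | succ e ih => simpa [pow_succ] using ih.mul hg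

theorem Tame.of_mul {g h : X → ℤ_[p]} (hg : Tame δ g) (hne : ∀ x, g x ≠ 0)
    (hh : Tame δ (fun x => g x * h x)) : Tame δ h := by
  classical
  refine ⟨?_, (hg.2.comp₂ hh.2 (fun a b => a⁻¹ * b)).congr fun x => ?_⟩
  · refine (PL.ite hh.eq_zero PL.zero (hh.1.sub hg.1)).congr fun x => ?_
    have := hne x
    split_ifs with hx
    · rcases mul_eq_zero.mp hx with hx | hx
      · exact absurd hx this
      · simp [hx]
    · rw [valuation_mul' this (fun h => hx (by simp [h]))]; push_cast; ring
  · rw [ac_mul, inv_mul_cancel_left₀ (ac_ne_zero (hne x))]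

theorem Tame.neg {g : X → ℤ_[p]} (hg : Tame δ g) : Tame δ (fun x => - g x) := by
  have h1 : Lead (-1 : ℤ_[p]) 0 (-1) := ⟨-1, by simp, by simp⟩
  have : Tame δ (fun _ => (-1 : ℤ_[p])) := by
    refine ⟨PL.zero.congr fun x => ?_, Adm.const _⟩
    rw [h1.val (by simp)]; simp
  exact (this.mul hg).congr fun x => by ring

theorem Tame.sub {g h : X → ℤ_[p]} (hg : Tame δ g) (hh : Tame δ h)
    (H : ∀ x, g x ≠ 0 → h x ≠ 0 → (g x).valuation = (h x).valuation → ac (g x) = ac (h x) →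
      g x = h x) : Tame δ (fun x => g x - h x) := by
  classical
  have aeq : Adm δ (fun x => ac (g x) = ac (h x)) := hg.2.comp₂ hh.2 (fun a b => a = b)
  have key : ∀ x, ((g x - h x).valuation : ℚ) = (if h x = 0 then ((g x).valuation : ℚ) else
      if g x = 0 then ((h x).valuation : ℚ) else if ((g x).valuation : ℚ) < (h x).valuation then
      ((g x).valuation : ℚ) else if ((h x).valuation : ℚ) < (g x).valuation then
      ((h x).valuation : ℚ) else if ac (g x) = ac (h x) then 0 else ((g x).valuation : ℚ)) ∧
      ac (g x - h x) = (if h x = 0 then ac (g x) else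
      if g x = 0 then - ac (h x) else if ((g x).valuation : ℚ) < (h x).valuation then
      ac (g x) else if ((h x).valuation : ℚ) < (g x).valuation then
      - ac (h x) else if ac (g x) = ac (h x) then 0 else ac (g x) - ac (h x)) := by
    intro x
    by_cases h1 : h x = 0
    · simp [h1]
    have Lh := lead_self h1
    have nh := ac_ne_zero h1
    by_cases h2 : g x = 0
    · simp only [h1, h2, if_false, if_true, zero_sub]
      exact ⟨by rw [Lh.neg.val (neg_ne_zero.mpr nh)], Lh.neg.ac (neg_ne_zero.mpr nh)⟩
    have Lg := lead_self h2
    have ng := ac_ne_zero h2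
    simp only [h1, h2, if_false, Nat.cast_lt]
    rcases lt_trichotomy (g x).valuation (h x).valuation with h3 | h3 | h3
    · simp only [h3, if_true]
      have := Lg.sub (lead_of_lt h3)
      rw [sub_zero] at this
      exact ⟨by rw [this.val ng], this.ac ng⟩
    · simp only [h3, lt_irrefl, if_false]
      by_cases h4 : ac (g x) = ac (h x)
      · rw [H x h2 h1 h3 h4]; simp [ac_zero]
      · rw [h3] at Lg
        have := Lg.sub Lh
        have n4 := sub_ne_zero.mpr h4
        simp only [h4, if_false]
        exact ⟨by rw [this.val n4], this.ac n4⟩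
    · simp only [h3, h3.not_gt, if_true, if_false]
      have := (lead_of_lt h3).sub Lh
      rw [zero_sub] at this
      have n4 := neg_ne_zero.mpr nh
      exact ⟨by rw [this.val n4], this.ac n4⟩
  refine ⟨(PL.ite hh.eq_zero hg.1 <| PL.ite hg.eq_zero hh.1 <| PL.ite (hg.1.lt hh.1) hg.1 <|
    PL.ite (hh.1.lt hg.1) hh.1 <| PL.ite aeq PL.zero hg.1).congr fun x => by convert (key x).1,
    (Adm.ite hh.eq_zero hg.2 <| Adm.ite hg.eq_zero (hh.2.comp (fun a => -a)) <|
      Adm.ite (hg.1.lt hh.1) hg.2 <| Adm.ite (hh.1.lt hg.1) (hh.2.comp (fun a => -a)) <|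
      Adm.ite aeq (Adm.const 0) (hg.2.comp₂ hh.2 (fun a b => a - b))).congr fun x => by convert (key x).2⟩

/-- residual coefficients -/
noncomputable def rcoef (A : ℕ → ℤ_[p]) (q m : ℚ) (l : ℕ) : ZMod p :=
  open Classical in if A l ≠ 0 ∧ ((A l).valuation : ℚ) + q * l = m then ac (A l) else 0

/-- residual polynomial -/
noncomputable def rpoly (A : ℕ → ℤ_[p]) (D : ℕ) (q m : ℚ) : (ZMod p)[X] :=
  ∑ l ∈ Finset.range (D + 1), C (rcoef A q m l) * Polynomial.X ^ l

/-- `l0` attains the minimum -/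
def MinAt (A : ℕ → ℤ_[p]) (D : ℕ) (q : ℚ) (l0 : ℕ) : Prop :=
  l0 ≤ D ∧ A l0 ≠ 0 ∧ ∀ l ≤ D, A l ≠ 0 →
    ((A l0).valuation : ℚ) + q * l0 ≤ (A l).valuation + q * l

theorem rpoly_coeff (A : ℕ → ℤ_[p]) (D : ℕ) (q m : ℚ) {l : ℕ} (hl : l ≤ D) :
    (rpoly A D q m).coeff l = rcoef A q m l := by
  rw [rpoly, finsetSum_coeff]
  simp only [coeff_C_mul_X_pow]
  rw [Finset.sum_ite_eq, if_pos (by simp; omega)]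

theorem MinAt.resid {f : ℤ_[p][X]} {c : ℤ_[p]} {k D l0 : ℕ} (hD : f.natDegree ≤ D)
    (h : MinAt (fun l => (taylor c f).coeff l) D k l0) :
    Resid f c k (((taylor c f).coeff l0).valuation + k * l0)
      (rpoly (fun l => (taylor c f).coeff l) D k
        ((((taylor c f).coeff l0).valuation + k * l0 : ℕ) : ℚ)) := by
  classical
  refine exists_resid f c k _ D hD _ fun l hl => ?_
  rw [rcoef]
  have hk : Lead ((p : ℤ_[p]) ^ (k * l)) (k * l) 1 := ⟨1, by simp, by simp⟩
  by_cases h0 : (taylor c f).coeff l = 0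
  · simp only [h0, ne_eq, not_true_eq_false, false_and, if_false, zero_mul]
    exact Lead.zero _
  have hle := h.2.2 l hl h0
  have h1 := (lead_self h0).mul hk
  rw [mul_one] at h1
  norm_cast at hle
  split_ifs with h2
  · have h3 := h2.2
    norm_cast at h3
    rw [h3] at h1
    exact h1
  · refine h1.mono (lt_of_le_of_ne hle fun h3 => h2 ⟨h0, ?_⟩)
    rw [h3]; push_cast; rfl

theorem MinAt.rcoef_ne {A : ℕ → ℤ_[p]} {D : ℕ} {q : ℚ} {l0 : ℕ} (h : MinAt A D q l0) :
    rcoef A q ((A l0).valuation + q * l0) l0 ≠ 0 := by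
  rw [rcoef, if_pos ⟨h.2.1, rfl⟩]
  exact ac_ne_zero h.2.1

theorem MinAt.rpoly_ne {A : ℕ → ℤ_[p]} {D : ℕ} {q : ℚ} {l0 : ℕ} (h : MinAt A D q l0) :
    rpoly A D q ((A l0).valuation + q * l0) ≠ 0 := by
  intro h0
  apply h.rcoef_ne
  rw [← rpoly_coeff A D _ _ h.1, h0]; simp

theorem exists_minAt {f : ℤ_[p][X]} {c : ℤ_[p]} {D : ℕ} (q : ℚ) (hD : f.natDegree ≤ D)
    (hf : f ≠ 0) : ∃ l0, MinAt (fun l => (taylor c f).coeff l) D q l0 := by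
  classical
  have hne : ((Finset.range (D + 1)).filter fun l => (taylor c f).coeff l ≠ 0).Nonempty := by
    refine ⟨f.natDegree, ?_⟩
    rw [Finset.mem_filter, Finset.mem_range]
    refine ⟨by omega, ?_⟩
    rw [← natDegree_taylor f c]
    change (taylor c f).leadingCoeff ≠ 0
    rw [leadingCoeff_ne_zero]
    intro h
    exact hf ((taylor_injective c) (by rw [h, map_zero]))
  obtain ⟨l0, hl0, hmin⟩ := Finset.exists_min_image _
    (fun l => (((taylor c f).coeff l).valuation : ℚ) + q * l) hne
  rw [Finset.mem_filter, Finset.mem_range] at hl0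
  refine ⟨l0, by omega, hl0.2, fun l hl h => hmin l ?_⟩
  rw [Finset.mem_filter, Finset.mem_range]
  exact ⟨by omega, h⟩

theorem adm_rcoef {A : ℕ → X → ℤ_[p]} (hA : ∀ l, Tame δ (A l)) {q m : X → ℚ}
    (hq : PL δ q) (hm : PL δ m) (l : ℕ) :
    Adm δ (fun x => rcoef (fun l => A l x) (q x) (m x) l) := by
  classical
  refine (Adm.ite (((hA l).eq_zero.not).and (((hA l).1.add (hq.smul l)).eq hm)) (hA l).2
    (Adm.const 0)).congr fun x => ?_
  rw [rcoef]
  simp only [mul_comm, ne_eq]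

theorem adm_rpoly {A : ℕ → X → ℤ_[p]} (hA : ∀ l, Tame δ (A l)) {q m : X → ℚ}
    (hq : PL δ q) (hm : PL δ m) (D : ℕ) :
    Adm δ (fun x => rpoly (fun l => A l x) D (q x) (m x)) := by
  refine ((Adm.pi (J := Fin (D + 1)) fun l => adm_rcoef hA hq hm l.1).comp
    (fun r : Fin (D + 1) → ZMod p => ∑ l : Fin (D + 1), C (r l) * Polynomial.X ^ l.1)).congr fun x => ?_
  rw [rpoly, Finset.sum_range]

theorem adm_minAt {A : ℕ → X → ℤ_[p]} (hA : ∀ l, Tame δ (A l)) {q : X → ℚ}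
    (hq : PL δ q) (D l0 : ℕ) : Adm δ (fun x => MinAt (fun l => A l x) D (q x) l0) := by
  refine ((Adm.const (l0 ≤ D)).and ((hA l0).eq_zero.not.and (Adm.all (J := Fin (D + 1)) fun l =>
    (hA l.1).eq_zero.not.imp (((hA l0).1.add (hq.smul l0)).le
      ((hA l.1).1.add (hq.smul l.1)))))).congr fun x => ?_
  rw [MinAt]
  simp only [mul_comm, ne_eq, eq_iff_iff]
  refine and_congr Iff.rfl (and_congr Iff.rfl ⟨fun h l => h l.1 (by omega), fun h l hl =>
    h ⟨l, by omega⟩⟩)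

theorem ball_value {f : X → ℤ_[p][X]} {c t : X → ℤ_[p]} {K : X → ℕ} {σ : ZMod p} {D : ℕ}
    (hD : ∀ x, (f x).natDegree ≤ D) (hf : ∀ x, f x ≠ 0)
    (hA : ∀ l, Tame δ (fun x => (taylor (c x) (f x)).coeff l))
    (hK : PL δ (fun x => (K x : ℚ))) (ht : ∀ x, Lead (t x - c x) (K x) σ)
    (hnv : ∀ x m R, Resid (f x) (c x) (K x) m R → R ≠ 0 → R.eval σ ≠ 0) :
    Tame δ (fun x => (f x).eval (t x)) := by
  refine Tame.cover (J := Fin (D + 1)) (P := fun l0 x =>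
    MinAt (fun l => (taylor (c x) (f x)).coeff l) D (K x) l0.1)
    (fun l0 => adm_minAt hA hK D l0.1) ?_ ?_
  · intro x
    obtain ⟨l0, h⟩ := exists_minAt (c := c x) (K x : ℚ) (hD x) (hf x)
    exact ⟨⟨l0, Nat.lt_succ_of_le h.1⟩, h⟩
  · intro l0
    set W := {x // MinAt (fun l => (taylor (c x) (f x)).coeff l) D (K x) l0.1}
    let M : W → ℕ := fun w => ((taylor (c w.1) (f w.1)).coeff l0.1).valuation + K w.1 * l0.1
    have hM : PL (fun w : W => δ w.1) (fun w => (M w : ℚ)) := by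
      refine (((hA l0.1).1.add (hK.smul l0.1)).pull (Subtype.val : W → X)).congr fun w => ?_
      simp only [M]; push_cast; ring
    have hR : ∀ w : W, Resid (f w.1) (c w.1) (K w.1) (M w)
        (rpoly (fun l => (taylor (c w.1) (f w.1)).coeff l) D (K w.1) (M w)) :=
      fun w => w.2.resid (hD w.1)
    have hne : ∀ w : W, (rpoly (fun l => (taylor (c w.1) (f w.1)).coeff l) D (K w.1) (M w)).eval σ
        ≠ 0 := fun w => hnv _ _ _ (hR w) (by
          have := w.2.rpoly_ne
          simp only [M]; push_cast; exact this)
    have hL := fun w : W => (hR w).lead (ht w.1)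
    have hadm := adm_rpoly (fun l => (hA l).pull (Subtype.val : W → X)) (hK.pull Subtype.val) hM D
    refine ⟨hM.congr fun w => ?_, (hadm.comp (fun R => R.eval σ)).congr fun w => ?_⟩
    · rw [(hL w).val (hne w)]
    · exact (hL w).ac (hne w)

end TameSec

section TableSec
open Polynomial
set_option linter.unusedSectionVars false
set_option linter.unusedVariables false
variable {p : ℕ} [hp : Fact p.Prime]
variable {X κ Lab : Type} [Fintype κ] [Finite Lab] {δ : X → (κ → ℚ) × Lab}

/-- A finite family of polynomials over `X`, closed under Hasse derivatives and
pseudo-remainders. -/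
structure Fam (p : ℕ) [Fact p.Prime] {X κ Lab : Type} [Fintype κ]
    (δ : X → (κ → ℚ) × Lab) (Φ : Type) where
  f : Φ → X → ℤ_[p][X]
  D : Φ → ℕ
  hD : ∀ φ x, (f φ x).natDegree = D φ
  h0 : ∀ φ x, f φ x ≠ 0
  hp : ∀ φ, D φ < p
  tame : ∀ φ l, Tame δ (fun x => (f φ x).coeff l)
  hder : ∀ φ j, 1 ≤ j → (∀ x, hasseDeriv j (f φ x) = 0) ∨
    ∃ ψ, D ψ < D φ ∧ ∀ x, hasseDeriv j (f φ x) = f ψ x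
  hrem : ∀ ψ χ, D ψ ≤ D χ → ∃ (e : ℕ) (q r : X → ℤ_[p][X]),
    (∀ x, C ((f ψ x).leadingCoeff ^ e) * f χ x = q x * f ψ x + r x) ∧
    ((∀ x, r x = 0) ∨ ∃ χ', D χ' < D ψ ∧ ∀ x, r x = f χ' x)

/-- table of centers -/
structure Table {Φ : Type} (F : Fam p δ Φ) (s : Finset Φ) (J : Type) where
  c : J → X → ℤ_[p]
  zero : ∃ j0, ∀ x, c j0 x = 0
  roots : ∀ φ ∈ s, ∀ x t, (F.f φ x).eval t = 0 → ∃ j, c j x = t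
  val : ∀ χ j, Tame δ (fun x => (F.f χ x).eval (c j x))
  diff : ∀ i j, Tame δ (fun x => c i x - c j x)

variable {Φ : Type} {F : Fam p δ Φ}

theorem Fam.taylor_tame {c : X → ℤ_[p]} (hc : ∀ χ, Tame δ (fun x => (F.f χ x).eval (c x)))
    (χ : Φ) (l : ℕ) : Tame δ (fun x => (taylor (c x) (F.f χ x)).coeff l) := by
  simp only [taylor_coeff]
  rcases Nat.eq_zero_or_pos l with rfl | hl
  · simpa using hc χ
  · rcases F.hder χ l hl with h | ⟨ψ, -, h⟩
    · simp only [h, eval_zero]; exact Tame.zero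
    · simp only [h]; exact hc ψ

/-- value tameness on balls free of centers -/
theorem Table.ball {s : Finset Φ} {J : Type} (T : Table F s J) (χ : Φ)
    (hs : χ ∈ s) (hcl : ∀ ψ, F.D ψ < F.D χ → ψ ∈ s)
    {W : Type} {κ' : Type} [Fintype κ'] {Lab' : Type} [Finite Lab'] {δ' : W → (κ' → ℚ) × Lab'}
    (u : W → X) (i : J) (t : W → ℤ_[p]) (K : W → ℕ) (σ : ZMod p)
    (hA : ∀ l, Tame δ' (fun w => (taylor (T.c i (u w)) (F.f χ (u w))).coeff l))
    (hK : PL δ' (fun w => (K w : ℚ)))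
    (ht : ∀ w, Lead (t w - T.c i (u w)) (K w) σ)
    (hno : ∀ w j, ¬ Lead (T.c j (u w) - T.c i (u w)) (K w) σ) :
    Tame δ' (fun w => (F.f χ (u w)).eval (t w)) := by
  refine ball_value (D := F.D χ) (K := K) (σ := σ) (c := fun w => T.c i (u w))
    (fun w => (F.hD _ _).le) (fun w => F.h0 _ _) hA hK ht ?_
  intro w m R hR hne h0
  obtain ⟨j, t', ht', hj, hj'⟩ := hR.close (by rw [F.hD]; exact F.hp χ) hne h0
  have : ∃ ψ ∈ s, hasseDeriv j (F.f χ (u w)) = F.f ψ (u w) := by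
    rcases Nat.eq_zero_or_pos j with rfl | hj1
    · exact ⟨χ, hs, by simp⟩
    · rcases F.hder χ j hj1 with h | ⟨ψ, h1, h⟩
      · exact absurd (h _) hj
      · exact ⟨ψ, hcl ψ h1, h _⟩
  obtain ⟨ψ, hψ, e⟩ := this
  rw [e] at hj'
  obtain ⟨j', hj''⟩ := T.roots ψ hψ _ _ hj'
  exact hno w j' (hj'' ▸ ht')

/-- the rational radius -/
noncomputable def Table.rad {s : Finset Φ} {J : Type} (T : Table F s J) (φ : Φ) (i : J) (a b : ℕ)
    (x : X) : ℚ :=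
  ((b : ℚ) - a)⁻¹ * ((((taylor (T.c i x) (F.f φ x)).coeff a).valuation : ℚ) -
    ((taylor (T.c i x) (F.f φ x)).coeff b).valuation)

/-- the height -/
noncomputable def Table.ht {s : Finset Φ} {J : Type} (T : Table F s J) (φ : Φ) (i : J) (a b : ℕ)
    (x : X) : ℚ :=
  (((taylor (T.c i x) (F.f φ x)).coeff a).valuation : ℚ) + T.rad φ i a b x * a

/-- condition for a new center -/
def Table.Cond {s : Finset Φ} {J : Type} (T : Table F s J) (φ : Φ) (i : J) (a b : ℕ)
    (σ : ZMod p) (x : X) : Prop :=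
  MinAt (fun l => (taylor (T.c i x) (F.f φ x)).coeff l) (F.D φ) (T.rad φ i a b x) a ∧
  ((∃ n : ℤ, T.rad φ i a b x = n) ∧ 0 ≤ T.rad φ i a b x) ∧ σ ≠ 0 ∧
  ((rpoly (fun l => (taylor (T.c i x) (F.f φ x)).coeff l) (F.D φ) (T.rad φ i a b x)
    (T.ht φ i a b x)).eval σ = 0 ∧
  (derivative (rpoly (fun l => (taylor (T.c i x) (F.f φ x)).coeff l) (F.D φ) (T.rad φ i a b x)
    (T.ht φ i a b x))).eval σ ≠ 0) ∧
  ∀ j, ¬ (((T.c j x - T.c i x).valuation : ℚ) = T.rad φ i a b x ∧ ac (T.c j x - T.c i x) = σ)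

theorem Table.taylor {s : Finset Φ} {J : Type} (T : Table F s J) (χ : Φ) (i : J) (l : ℕ) :
    Tame δ (fun x => (Polynomial.taylor (T.c i x) (F.f χ x)).coeff l) :=
  F.taylor_tame (fun χ => T.val χ i) χ l

theorem Table.rad_PL {s : Finset Φ} {J : Type} (T : Table F s J) (φ : Φ) (i : J) (a b : ℕ) :
    PL δ (T.rad φ i a b) :=
  (((T.taylor φ i a).1.sub (T.taylor φ i b).1).smul _).congr fun x => rfl

theorem Table.ht_PL {s : Finset Φ} {J : Type} (T : Table F s J) (φ : Φ) (i : J) (a b : ℕ) :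
    PL δ (T.ht φ i a b) :=
  ((T.taylor φ i a).1.add ((T.rad_PL φ i a b).smul a)).congr fun x => by
    rw [Table.ht, mul_comm]

theorem Table.cond_Adm {s : Finset Φ} {J : Type} [Finite J] (T : Table F s J) (φ : Φ) (i : J)
    (a b : ℕ) (σ : ZMod p) : Adm δ (T.Cond φ i a b σ) := by
  have h1 := T.rad_PL φ i a b
  have h2 := T.ht_PL φ i a b
  have h3 := adm_rpoly (T.taylor φ i) h1 h2 (F.D φ)
  refine ((adm_minAt (T.taylor φ i) h1 (F.D φ) a).and ((h1.int.and (PL.zero.le h1)).and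
    ((Adm.const (σ ≠ 0)).and (((h3.comp (fun R => R.eval σ = 0)).and
      (h3.comp (fun R => (derivative R).eval σ ≠ 0))).and
    (Adm.all fun j => (((T.diff j i).1.eq h1).and
      ((T.diff j i).2.comp (fun s => s = σ))).not))))).congr fun x => ?_
  rfl

/-- unpacking the condition -/
theorem Table.Cond.out {s : Finset Φ} {J : Type} {T : Table F s J} {φ : Φ} {i : J}
    {a b : ℕ} {σ : ZMod p} {x : X} (h : T.Cond φ i a b σ x) :
    ∃ k : ℕ, T.rad φ i a b x = k ∧ σ ≠ 0 ∧ (∀ j, ¬ Lead (T.c j x - T.c i x) k σ) ∧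
      ∃ t : ℤ_[p], Lead (t - T.c i x) k σ ∧ (F.f φ x).eval t = 0 ∧
      ∀ y : ℤ_[p], Lead (y - T.c i x) k σ → (F.f φ x).eval y = 0 → y = t := by
  obtain ⟨hmin, ⟨⟨n, hn⟩, hpos⟩, hσ, ⟨h0, h1⟩, hno⟩ := h
  have hn0 : 0 ≤ n := by rw [hn] at hpos; exact_mod_cast hpos
  lift n to ℕ using hn0
  have hk : T.rad φ i a b x = (n : ℕ) := by rw [hn]; norm_cast
  refine ⟨n, hk, hσ, ?_, ?_⟩
  · intro j hj
    refine hno j ⟨?_, hj.ac hσ⟩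
    rw [hj.val hσ, hk]
  · rw [hk] at hmin h0 h1
    have hr := hmin.resid (F.hD φ x).le
    have e : T.ht φ i a b x = ((((Polynomial.taylor (T.c i x) (F.f φ x)).coeff a).valuation
        + n * a : ℕ) : ℚ) := by
      rw [Table.ht, hk]; push_cast; rfl
    rw [e] at h0 h1
    exact hr.root h0 h1

open Classical in
/-- the new centers -/
noncomputable def Table.newc {s : Finset Φ} {J : Type} (T : Table F s J) (φ : Φ) (i : J) (a b : ℕ)
    (σ : ZMod p) (x : X) : ℤ_[p] :=
  if h : T.Cond φ i a b σ x then h.out.choose_spec.2.2.2.choose else 0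

theorem Table.newc_spec {s : Finset Φ} {J : Type} {T : Table F s J} {φ : Φ} {i : J}
    {a b : ℕ} {σ : ZMod p} {x : X} (h : T.Cond φ i a b σ x) :
    ∃ k : ℕ, T.rad φ i a b x = k ∧ σ ≠ 0 ∧ (∀ j, ¬ Lead (T.c j x - T.c i x) k σ) ∧
      Lead (T.newc φ i a b σ x - T.c i x) k σ ∧ (F.f φ x).eval (T.newc φ i a b σ x) = 0 ∧
      ∀ y : ℤ_[p], Lead (y - T.c i x) k σ → (F.f φ x).eval y = 0 → y = T.newc φ i a b σ x := by
  rw [Table.newc, dif_pos h]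
  have h1 := h.out.choose_spec
  exact ⟨_, h1.1, h1.2.1, h1.2.2.1, h1.2.2.2.choose_spec⟩

section step
variable {s : Finset Φ} {J : Type} [Finite J] (T : Table F s J) (φ : Φ) (i : J) (a b : ℕ)
  (σ : ZMod p)

theorem Table.new_ball :
    Tame (fun w : {x // T.Cond φ i a b σ x} => δ w.1)
      (fun w => T.newc φ i a b σ w.1 - T.c i w.1) := by
  refine ⟨((T.rad_PL φ i a b).pull Subtype.val).congr fun w => ?_, (Adm.const σ).congr fun w => ?_⟩
  · obtain ⟨k, hk, hσ, -, hl, -⟩ := Table.newc_spec w.2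
    rw [hk, hl.val hσ]
  · obtain ⟨k, hk, hσ, -, hl, -⟩ := Table.newc_spec w.2
    exact hl.ac hσ

theorem Table.new_old (j : J) : Tame δ (fun x => T.newc φ i a b σ x - T.c j x) := by
  refine Tame.cases (T.cond_Adm φ i a b σ) ?_ ?_
  · refine ((T.new_ball φ i a b σ).sub ((T.diff j i).pull Subtype.val) ?_).congr fun w => ?_
    · intro w h1 h2 h3 h4
      obtain ⟨k, hk, hσ, hno, hl, -⟩ := Table.newc_spec w.2
      refine absurd ?_ (hno j)
      rw [lead_iff hσ]
      exact ⟨h2, by rw [← h3, hl.val hσ], by rw [← h4, hl.ac hσ]⟩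
    · ring
  · obtain ⟨j0, h0⟩ := T.zero
    refine ((T.diff j0 j).pull Subtype.val).congr fun w => ?_
    rw [Table.newc, dif_neg w.2, h0]

theorem Table.new_new (i' : J) (a' b' : ℕ) (σ' : ZMod p) :
    Tame δ (fun x => T.newc φ i a b σ x - T.newc φ i' a' b' σ' x) := by
  refine Tame.cases (T.cond_Adm φ i a b σ) ?_ ?_
  · refine ((T.new_ball φ i a b σ).sub ((T.new_old φ i' a' b' σ' i).pull Subtype.val) ?_).congr
      fun w => ?_
    · intro w h1 h2 h3 h4
      obtain ⟨k, hk, hσ, hno, hl, h0, hu⟩ := Table.newc_spec w.2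
      have hL : Lead (T.newc φ i' a' b' σ' w.1 - T.c i w.1) k σ := by
        rw [lead_iff hσ]
        exact ⟨h2, by rw [← h3, hl.val hσ], by rw [← h4, hl.ac hσ]⟩
      by_cases hc : T.Cond φ i' a' b' σ' w.1
      · obtain ⟨-, -, -, -, -, h0', -⟩ := Table.newc_spec hc
        rw [hu _ hL h0']
      · obtain ⟨j0, hj0⟩ := T.zero
        refine absurd ?_ (hno j0)
        rw [Table.newc, dif_neg hc] at hL
        rwa [hj0]
    · ring
  · obtain ⟨j0, h0⟩ := T.zero
    refine ((T.new_old φ i' a' b' σ' j0).neg.pull Subtype.val).congr fun w => ?_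
    rw [h0]
    conv_lhs => rw [Table.newc, dif_neg w.2]
    ring

theorem Table.new_val (hs : ∀ ψ, F.D ψ < F.D φ → ψ ∈ s) (χ : Φ) :
    Tame δ (fun x => (F.f χ x).eval (T.newc φ i a b σ x)) := by
  have low : ∀ χ, F.D χ < F.D φ → Tame (fun w : {x // T.Cond φ i a b σ x} => δ w.1)
      (fun w => (F.f χ w.1).eval (T.newc φ i a b σ w.1)) := by
    intro χ hχ
    have hsp := fun w : {x // T.Cond φ i a b σ x} => Table.newc_spec w.2
    choose K hK hσ hno hl h0 hu using hsp
    refine T.ball χ (hs χ hχ) (fun ψ h => hs ψ (h.trans hχ)) Subtype.val i _ K σ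
      (fun l => (T.taylor χ i l).pull Subtype.val) ?_ hl hno
    exact ((T.rad_PL φ i a b).pull Subtype.val).congr fun w => (hK w).symm
  refine Tame.cases (T.cond_Adm φ i a b σ) ?_ ?_
  · by_cases hχ : F.D χ < F.D φ
    · exact low χ hχ
    · obtain ⟨e, q, r, h1, h2⟩ := F.hrem φ χ (not_lt.mp hχ)
      have hlc : Tame δ (fun x => (F.f φ x).leadingCoeff) := by
        refine (F.tame φ (F.D φ)).congr fun x => ?_
        rw [leadingCoeff, F.hD]
      have hne : ∀ x, (F.f φ x).leadingCoeff ≠ 0 := fun x => leadingCoeff_ne_zero.mpr (F.h0 _ _)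
      refine Tame.of_mul ((hlc.pow hne e).pull Subtype.val) (fun w => pow_ne_zero _ (hne _)) ?_
      have key : ∀ w : {x // T.Cond φ i a b σ x}, (F.f φ w.1).leadingCoeff ^ e *
          (F.f χ w.1).eval (T.newc φ i a b σ w.1) = (r w.1).eval (T.newc φ i a b σ w.1) := by
        intro w
        obtain ⟨-, -, -, -, -, h0, -⟩ := Table.newc_spec w.2
        have := congrArg (eval (T.newc φ i a b σ w.1)) (h1 w.1)
        simp only [eval_mul, eval_add, eval_C, h0, mul_zero, zero_add] at this
        exact this
      rcases h2 with h2 | ⟨χ', h3, h2⟩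
      · exact Tame.zero.congr fun w => by rw [key, h2, eval_zero]
      · exact (low χ' h3).congr fun w => by rw [key, h2]
  · obtain ⟨j0, h0⟩ := T.zero
    refine ((T.val χ j0).pull Subtype.val).congr fun w => ?_
    rw [h0, Table.newc, dif_neg w.2]

end step

theorem Table.new_roots {s : Finset Φ} {J : Type} [Finite J] (T : Table F s J) (φ : Φ)
    (hs : ∀ ψ, F.D ψ < F.D φ → ψ ∈ s) (x : X) (t : ℤ_[p]) (ht : (F.f φ x).eval t = 0) :
    (∃ j, T.c j x = t) ∨ ∃ (i : J) (a b : Fin (F.D φ + 1)) (σ : ZMod p),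
      T.newc φ i a.1 b.1 σ x = t := by
  classical
  by_cases hex : ∃ j, T.c j x = t
  · exact Or.inl hex
  right
  push Not at hex
  obtain ⟨j0, -⟩ := T.zero
  haveI : Nonempty J := ⟨j0⟩
  obtain ⟨i, hi⟩ := Finite.exists_max (fun j => (t - T.c j x).valuation)
  have hti : t - T.c i x ≠ 0 := sub_ne_zero.mpr (hex i).symm
  set k := (t - T.c i x).valuation with hk
  set σ := ac (t - T.c i x) with hσd
  have hσ : σ ≠ 0 := ac_ne_zero hti
  have hL : Lead (t - T.c i x) k σ := lead_self hti
  have hno : ∀ j, ¬ Lead (T.c j x - T.c i x) k σ := by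
    intro j hj
    have h1 := hL.sub hj
    rw [sub_self, sub_sub_sub_cancel_right, lead_zero_iff] at h1
    rcases h1 with h1 | h1
    · exact hex j (sub_eq_zero.mp h1).symm
    · exact absurd (hi j) (not_le.mpr h1)
  obtain ⟨l0, hmin⟩ := exists_minAt (c := T.c i x) (k : ℚ) (F.hD φ x).le (F.h0 φ x)
  have hr := hmin.resid (F.hD φ x).le
  set A : ℕ → ℤ_[p] := fun l => (Polynomial.taylor (T.c i x) (F.f φ x)).coeff l with hA
  have hne := hmin.rpoly_ne
  set m : ℕ := (A l0).valuation + k * l0 with hm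
  have hmq : ((A l0).valuation : ℚ) + k * l0 = (m : ℚ) := by rw [hm]; push_cast; rfl
  rw [hmq] at hne
  have h0 : (rpoly A (F.D φ) k m).eval σ = 0 := by
    have := hr.lead hL
    rw [ht] at this
    exact this.unique (Lead.zero _)
  have h1 : (derivative (rpoly A (F.D φ) k m)).eval σ ≠ 0 := by
    intro h1
    obtain ⟨j, t', hj, ht', h2, h3⟩ := hr.close' (by rw [F.hD]; exact F.hp φ) hne h0 h1
    rcases F.hder φ j hj with h | ⟨ψ, h4, h⟩
    · exact h2 (h x)
    · rw [h] at h3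
      obtain ⟨j', hj'⟩ := T.roots ψ (hs ψ h4) _ _ h3
      exact hno j' (hj' ▸ ht')
  have hr0 : rcoef A k m l0 ≠ 0 := by
    have := hmin.rcoef_ne
    rwa [hmq] at this
  have : ∃ l ≤ F.D φ, l ≠ l0 ∧ rcoef A k m l ≠ 0 := by
    by_contra hcon
    push Not at hcon
    rw [rpoly, eval_finset_sum, Finset.sum_eq_single l0] at h0
    · simp only [eval_mul, eval_C, eval_pow, eval_X] at h0
      rcases mul_eq_zero.mp h0 with h | h
      · exact hr0 h
      · exact pow_ne_zero _ hσ h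
    · intro l hl hll
      rw [hcon l (by have := Finset.mem_range.mp hl; omega) hll]; simp
    · intro h; exact absurd (Finset.mem_range.mpr (by have := hmin.1; omega)) h
  obtain ⟨l1, hl1, hl01, hr1⟩ := this
  have hget : ∀ l, rcoef A k m l ≠ 0 → A l ≠ 0 ∧ ((A l).valuation : ℚ) + k * l = m := by
    intro l hl
    rw [rcoef] at hl
    by_contra hcon
    rw [if_neg hcon] at hl
    exact hl rfl
  have : ∃ a b, a ≤ F.D φ ∧ b ≤ F.D φ ∧ a < b ∧ rcoef A k m a ≠ 0 ∧ rcoef A k m b ≠ 0 := by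
    rcases lt_or_gt_of_ne hl01 with h | h
    · exact ⟨l1, l0, hl1, hmin.1, h, hr1, hr0⟩
    · exact ⟨l0, l1, hmin.1, hl1, h, hr0, hr1⟩
  obtain ⟨a, b, ha, hb, hab, hra, hrb⟩ := this
  obtain ⟨hAa, hma⟩ := hget a hra
  obtain ⟨hAb, hmb⟩ := hget b hrb
  have hrad : T.rad φ i a b x = k := by
    rw [Table.rad]
    change ((b : ℚ) - a)⁻¹ * (((A a).valuation : ℚ) - (A b).valuation) = k
    have hba : (b : ℚ) - a ≠ 0 := by
      have : (a : ℚ) < b := by exact_mod_cast hab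
      linarith
    field_simp
    linarith
  have hht : T.ht φ i a b x = m := by
    rw [Table.ht, hrad]; exact hma
  have hcond : T.Cond φ i a b σ x := by
    refine ⟨?_, ?_, hσ, ?_, ?_⟩
    · rw [hrad]
      refine ⟨ha, hAa, fun l hl hne => ?_⟩
      have := hmin.2.2 l hl hne
      change ((A a).valuation : ℚ) + k * a ≤ _
      rw [hma, ← hmq]; exact this
    · rw [hrad]; exact ⟨⟨k, by norm_cast⟩, by positivity⟩
    · rw [hrad, hht]; exact ⟨h0, h1⟩
    · intro j hj
      rw [hrad] at hj
      refine hno j ((lead_iff hσ).mpr ⟨?_, by exact_mod_cast hj.1, hj.2⟩)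
      intro h; rw [h, ac_zero] at hj; exact hσ hj.2.symm
  obtain ⟨k', hk', -, -, -, -, hu⟩ := Table.newc_spec hcond
  have : k' = k := by rw [hrad] at hk'; exact_mod_cast hk'.symm
  subst this
  exact ⟨i, ⟨a, by omega⟩, ⟨b, by omega⟩, σ, (hu t hL ht).symm⟩

theorem exists_table [Finite Φ] (F : Fam p δ Φ) (n : ℕ) : ∀ s : Finset Φ, s.card = n →
    (∀ φ ∈ s, ∀ ψ, F.D ψ < F.D φ → ψ ∈ s) → ∃ J : Type, Finite J ∧ Nonempty (Table F s J) := by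
  classical
  induction n with
  | zero =>
    intro s hs _
    rw [Finset.card_eq_zero] at hs
    subst hs
    refine ⟨Unit, inferInstance, ⟨⟨fun _ _ => 0, ⟨(), fun _ => rfl⟩, by simp, fun χ _ => ?_,
      fun _ _ => ?_⟩⟩⟩
    · refine (F.tame χ 0).congr fun x => ?_
      rw [coeff_zero_eq_eval_zero]
    · simp only [sub_self]; exact Tame.zero
  | succ n ih =>
    intro s hs hcl
    have hne : s.Nonempty := by rw [← Finset.card_pos]; omega
    obtain ⟨φ, hφ, hmax⟩ := Finset.exists_max_image s F.D hne
    obtain ⟨J, hJ, ⟨T⟩⟩ := ih (s.erase φ) (by rw [Finset.card_erase_of_mem hφ]; omega) (by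
      intro χ hχ ψ hlt
      have hχ' := Finset.mem_of_mem_erase hχ
      refine Finset.mem_erase.mpr ⟨?_, hcl χ hχ' ψ hlt⟩
      rintro rfl
      exact absurd (hmax χ hχ') (by omega))
    have hlow : ∀ ψ, F.D ψ < F.D φ → ψ ∈ s.erase φ := by
      intro ψ h
      refine Finset.mem_erase.mpr ⟨?_, hcl φ hφ ψ h⟩
      rintro rfl; omega
    let J' := J ⊕ (J × Fin (F.D φ + 1) × Fin (F.D φ + 1) × ZMod p)
    haveI : NeZero p := ⟨hp.out.ne_zero⟩
    let c' : J' → X → ℤ_[p] := Sum.elim T.c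
      (fun q => T.newc φ q.1 q.2.1.1 q.2.2.1.1 q.2.2.2)
    refine ⟨J', inferInstance, ⟨⟨c', ?_, ?_, ?_, ?_⟩⟩⟩
    · obtain ⟨j0, h⟩ := T.zero
      exact ⟨Sum.inl j0, h⟩
    · intro ψ hψ x t ht
      by_cases e : ψ = φ
      · subst e
        rcases T.new_roots ψ hlow x t ht with ⟨j, h⟩ | ⟨i, a, b, σ, h⟩
        · exact ⟨Sum.inl j, h⟩
        · exact ⟨Sum.inr (i, a, b, σ), h⟩
      · obtain ⟨j, h⟩ := T.roots ψ (Finset.mem_erase.mpr ⟨e, hψ⟩) x t ht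
        exact ⟨Sum.inl j, h⟩
    · rintro χ (j | ⟨i, a, b, σ⟩)
      · exact T.val χ j
      · exact T.new_val φ i a.1 b.1 σ hlow χ
    · rintro (j | ⟨i, a, b, σ⟩) (j' | ⟨i', a', b', σ'⟩)
      · exact T.diff j j'
      · refine (T.new_old φ i' a'.1 b'.1 σ' j).neg.congr fun x => ?_
        simp [c']
      · exact T.new_old φ i a.1 b.1 σ j'
      · exact T.new_new φ i a.1 b.1 σ i' a'.1 b'.1 σ'

end TableSec

section ClosureAlg
open Polynomial
set_option linter.unusedVariables false
variable {A : Type} [CommRing A] [IsDomain A]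

theorem exists_pseudo_rem (ψ : A[X]) (hψ : ψ ≠ 0) (n : ℕ) : ∀ χ : A[X], χ.natDegree < n →
    ∃ (e : ℕ) (q r : A[X]), C (ψ.leadingCoeff ^ e) * χ = q * ψ + r ∧ r.degree < ψ.degree := by
  induction n with
  | zero => intro χ h; omega
  | succ n ih =>
    intro χ hn
    by_cases hd : χ.degree < ψ.degree
    · exact ⟨0, 0, χ, by simp, hd⟩
    have hd' := not_lt.mp hd
    by_cases h0 : χ.natDegree = 0
    · have hψ0 : ψ.natDegree = 0 := by
        have := natDegree_le_natDegree hd'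
        omega
      rw [natDegree_eq_zero] at hψ0
      obtain ⟨a, rfl⟩ := hψ0
      refine ⟨1, χ, 0, by simp [mul_comm], ?_⟩
      rw [degree_zero, bot_lt_iff_ne_bot]
      simpa [degree_eq_bot] using hψ
    set χ' := C ψ.leadingCoeff * χ -
      C χ.leadingCoeff * X ^ (χ.natDegree - ψ.natDegree) * ψ with hχ'
    have hle := natDegree_le_natDegree hd'
    have hlt : χ'.natDegree < χ.natDegree := by
      have h1 : χ'.natDegree ≤ χ.natDegree := by
        refine (natDegree_sub_le _ _).trans (max_le (natDegree_C_mul_le _ _) ?_)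
        refine natDegree_mul_le.trans ?_
        have := natDegree_C_mul_X_pow_le χ.leadingCoeff (χ.natDegree - ψ.natDegree)
        omega
      refine lt_of_le_of_ne h1 fun h2 => ?_
      have h3 : χ'.coeff χ.natDegree = 0 := by
        rw [hχ', coeff_sub, coeff_C_mul, mul_assoc, coeff_C_mul, coeff_X_pow_mul']
        rw [if_pos (by omega), show χ.natDegree - (χ.natDegree - ψ.natDegree) = ψ.natDegree by omega]
        simp only [coeff_natDegree]; ring
      rw [← h2] at h3
      have h4 : χ' = 0 := leadingCoeff_eq_zero.mp h3
      rw [h4] at h2; simp at h2; omega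
    obtain ⟨e, q, r, h1, h2⟩ := ih χ' (by omega)
    refine ⟨e + 1, q + C (ψ.leadingCoeff ^ e) * (C χ.leadingCoeff *
      X ^ (χ.natDegree - ψ.natDegree)), r, ?_, h2⟩
    rw [pow_succ, C_mul]
    have : C ψ.leadingCoeff * χ = χ' + C χ.leadingCoeff * X ^ (χ.natDegree - ψ.natDegree) * ψ := by
      rw [hχ']; ring
    rw [mul_assoc, this, mul_add, h1]; ring

theorem exists_pseudo (ψ χ : A[X]) (hψ : ψ ≠ 0) : ∃ r : A[X], (∃ (e : ℕ) (q : A[X]),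
    C (ψ.leadingCoeff ^ e) * χ = q * ψ + r) ∧ (r ≠ 0 → r.natDegree < ψ.natDegree) := by
  obtain ⟨e, q, r, h1, h2⟩ := exists_pseudo_rem ψ hψ _ χ (Nat.lt_succ_self _)
  exact ⟨r, ⟨e, q, h1⟩, fun h => natDegree_lt_natDegree h h2⟩

theorem natDegree_hasse_lt (f : A[X]) (j : ℕ) (hj : 1 ≤ j) (h : hasseDeriv j f ≠ 0) :
    (hasseDeriv j f).natDegree < f.natDegree := by
  have h1 : f.natDegree ≥ j := by
    by_contra hc
    exact h (hasseDeriv_eq_zero_of_lt_natDegree f j (by omega))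
  have := natDegree_hasseDeriv_le f j
  omega

/-- closedness at degrees at least `m` -/
structure ClosedAt (S : Finset A[X]) (m : ℕ) : Prop where
  der : ∀ φ ∈ S, m ≤ φ.natDegree → ∀ j, 1 ≤ j → hasseDeriv j φ ≠ 0 → hasseDeriv j φ ∈ S
  rem : ∀ ψ ∈ S, ∀ χ ∈ S, m ≤ ψ.natDegree → ψ.natDegree ≤ χ.natDegree →
    ∃ (e : ℕ) (q r : A[X]), C (ψ.leadingCoeff ^ e) * χ = q * ψ + r ∧
      (r ≠ 0 → r ∈ S ∧ r.natDegree < ψ.natDegree)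

theorem exists_closure (G : Finset A[X]) (hG : 0 ∉ G) :
    ∃ S : Finset A[X], G ⊆ S ∧ 0 ∉ S ∧ ClosedAt S 0 := by
  classical
  set N := G.sup natDegree with hN
  have main : ∀ k m : ℕ, m + k = N + 1 → ∃ S : Finset A[X], G ⊆ S ∧ 0 ∉ S ∧
      (∀ φ ∈ S, φ.natDegree ≤ N) ∧ ClosedAt S m := by
    intro k
    induction k with
    | zero =>
      intro m hm
      have hb : ∀ φ ∈ G, φ.natDegree ≤ N := fun φ h => Finset.le_sup (f := natDegree) h
      refine ⟨G, subset_rfl, hG, hb, ⟨fun φ h h' => ?_, fun ψ h χ _ h' => ?_⟩⟩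
      · have := hb φ h; omega
      · have := hb ψ h; omega
    | succ k ih =>
      intro m hm
      obtain ⟨S, hGS, h0, hb, hc⟩ := ih (m + 1) (by omega)
      have hrem : ∀ ψ χ : A[X], ∃ r : A[X], ψ ≠ 0 → (∃ (e : ℕ) (q : A[X]),
          C (ψ.leadingCoeff ^ e) * χ = q * ψ + r) ∧ (r ≠ 0 → r.natDegree < ψ.natDegree) := by
        intro ψ χ
        by_cases h : ψ = 0
        · exact ⟨0, fun h' => absurd h h'⟩
        · obtain ⟨r, hr⟩ := exists_pseudo ψ χ h
          exact ⟨r, fun _ => hr⟩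
      choose R hR using hrem
      set E1 := ((S.filter fun φ => φ.natDegree = m) ×ˢ Finset.Icc 1 N).image
        (fun q => hasseDeriv q.2 q.1) with hE1
      set E2 := ((S.filter fun φ => φ.natDegree = m) ×ˢ S).image (fun q => R q.1 q.2) with hE2
      set E := (E1 ∪ E2).filter (fun r => r ≠ 0) with hE
      have hdeg : ∀ r ∈ E, r.natDegree < m := by
        intro r hr
        rw [hE, Finset.mem_filter, Finset.mem_union] at hr
        obtain ⟨hr, hr0⟩ := hr
        rcases hr with hr | hr
        · rw [hE1, Finset.mem_image] at hr
          obtain ⟨⟨φ, j⟩, h1, rfl⟩ := hr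
          rw [Finset.mem_product, Finset.mem_filter, Finset.mem_Icc] at h1
          have h3 : (hasseDeriv j φ).natDegree < φ.natDegree := natDegree_hasse_lt φ j h1.2.1 hr0
          have h4 : φ.natDegree = m := h1.1.2
          change (hasseDeriv j φ).natDegree < m
          omega
        · rw [hE2, Finset.mem_image] at hr
          obtain ⟨⟨ψ, χ⟩, h1, rfl⟩ := hr
          rw [Finset.mem_product, Finset.mem_filter] at h1
          have h2 : ψ ≠ 0 := fun h => h0 (h ▸ h1.1.1)
          have h3 : (R ψ χ).natDegree < ψ.natDegree := (hR ψ χ h2).2 hr0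
          have h4 : ψ.natDegree = m := h1.1.2
          change (R ψ χ).natDegree < m
          omega
      have hdS : ∀ φ ∈ S ∪ E, m ≤ φ.natDegree → φ ∈ S := by
        intro φ h hm'
        rcases Finset.mem_union.mp h with h | h
        · exact h
        · have := hdeg φ h; omega
      refine ⟨S ∪ E, hGS.trans Finset.subset_union_left, ?_, ?_, ⟨?_, ?_⟩⟩
      · rw [Finset.mem_union, not_or]
        exact ⟨h0, by rw [hE, Finset.mem_filter]; simp⟩
      · intro φ h
        rcases Finset.mem_union.mp h with h | h
        · exact hb φ h
        · have := hdeg φ h; omega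
      · intro φ h hm' j hj hne
        have hS := hdS φ h hm'
        rcases Nat.lt_or_ge m φ.natDegree with h1 | h1
        · exact Finset.mem_union_left _ (hc.der φ hS h1 j hj hne)
        · refine Finset.mem_union_right _ ?_
          rw [hE, Finset.mem_filter]
          refine ⟨Finset.mem_union_left _ (Finset.mem_image.mpr ⟨(φ, j), ?_, rfl⟩), hne⟩
          rw [Finset.mem_product, Finset.mem_filter, Finset.mem_Icc]
          refine ⟨⟨hS, by simp only; omega⟩, hj, ?_⟩
          by_contra hc'
          refine hne (hasseDeriv_eq_zero_of_lt_natDegree φ j ?_)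
          have := hb φ hS
          simp only at hc'; omega
      · intro ψ h χ h' hm' hle
        have hS := hdS ψ h hm'
        have hS' := hdS χ h' (hm'.trans hle)
        rcases Nat.lt_or_ge m ψ.natDegree with h1 | h1
        · obtain ⟨e, q, r, h2, h3⟩ := hc.rem ψ hS χ hS' h1 hle
          exact ⟨e, q, r, h2, fun hr => ⟨Finset.mem_union_left _ (h3 hr).1, (h3 hr).2⟩⟩
        · have hne : ψ ≠ 0 := fun h => h0 (h ▸ hS)
          obtain ⟨⟨e, q, h2⟩, h3⟩ := hR ψ χ hne
          refine ⟨e, q, R ψ χ, h2, fun hr => ⟨Finset.mem_union_right _ ?_, h3 hr⟩⟩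
          rw [hE, Finset.mem_filter]
          refine ⟨Finset.mem_union_right _ (Finset.mem_image.mpr ⟨(ψ, χ), ?_, rfl⟩), hr⟩
          rw [Finset.mem_product, Finset.mem_filter]
          exact ⟨⟨hS, by simp only; omega⟩, hS'⟩
  obtain ⟨S, h1, h2, -, h3⟩ := main (N + 1) 0 (by omega)
  exact ⟨S, h1, h2, h3⟩

theorem hasseDeriv_map' {B : Type} [CommRing B] (h : A →+* B) (f : A[X]) (j : ℕ) :
    hasseDeriv j (f.map h) = (hasseDeriv j f).map h := by
  ext l; simp [hasseDeriv_coeff]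

end ClosureAlg

section MvEval
variable {p : ℕ} [hp : Fact p.Prime]

/-- evaluation of an integral polynomial at a p-adic point -/
noncomputable def ev {n : ℕ} (x : Fin n → ℤ_[p]) : MvPolynomial (Fin n) ℤ →+* ℤ_[p] :=
  MvPolynomial.eval₂Hom (Int.castRingHom _) x

theorem ev_cons {n : ℕ} (x : Fin n → ℤ_[p]) (t : ℤ_[p]) (f : MvPolynomial (Fin (n + 1)) ℤ) :
    ev (Fin.cons t x : Fin (n + 1) → ℤ_[p]) f =
      ((MvPolynomial.finSuccEquiv ℤ n f).map (ev x)).eval t := by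
  have : ev (Fin.cons t x : Fin (n + 1) → ℤ_[p]) =
      ((Polynomial.evalRingHom t).comp (Polynomial.mapRingHom (ev x))).comp
        (MvPolynomial.finSuccEquiv ℤ n).toRingEquiv.toRingHom := by
    refine MvPolynomial.ringHom_ext (fun r => ?_) (fun i => ?_)
    · simp [ev]
    · refine Fin.cases ?_ (fun i => ?_) i
      · simp [ev, MvPolynomial.finSuccEquiv_X_zero]
      · simp [ev, MvPolynomial.finSuccEquiv_X_succ]
  rw [this]; rfl

end MvEval

open scoped ENNReal NNReal
set_option linter.unusedSectionVars false
namespace Cell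
variable {κ Lab : Type} [Fintype κ]

/-- cell with an additional zero coordinate -/
def optZero (γ : Cell κ Lab) : Cell (Option κ) Lab :=
  { γ with A := fun i o => o.elim 0 (γ.A i) }

/-- cell with an additional free coordinate -/
def optFree (γ : Cell κ Lab) (q : ℚ≥0) (hq : q ≠ 0) : Cell (Option κ) Lab where
  ι := Option γ.ι
  lab := γ.lab
  c := γ.c * q
  A := fun i => i.elim (fun o => o.elim 1 (fun _ => 0)) (fun i o => o.elim 0 (γ.A i))
  θ := fun i => i.elim 1 γ.θ
  ρ := fun i => i.elim q γ.ρ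
  hc := mul_ne_zero γ.hc hq
  hθ := fun i => by cases i <;> simp [γ.hθ]
  hθ1 := fun i => by cases i <;> simp [γ.hθ1]
  hρ := fun i => by cases i <;> simp [γ.hρ, hq]

theorem optZero_eval (γ : Cell κ Lab) (φ : (Option κ → ℚ) × Lab → ℝ≥0∞) :
    γ.optZero.eval φ = ∑' ℓ, γ.wt ℓ * φ (optData id (γ.pt ℓ, 0)) := by
  refine tsum_congr fun ℓ => ?_
  congr 2
  refine Prod.ext (funext fun o => ?_) rfl
  cases o
  · simp [pt, optZero, optData]
  · simp [pt, optZero, optData]; rfl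

theorem optFree_eval (γ : Cell κ Lab) (q : ℚ≥0) (hq : q ≠ 0)
    (φ : (Option κ → ℚ) × Lab → ℝ≥0∞) :
    (γ.optFree q hq).eval φ =
      ∑' ℓ, γ.wt ℓ * ∑' k : ℕ, nn q ^ (k + 1) * φ (optData id (γ.pt ℓ, k + 1)) := by
  simp_rw [← ENNReal.tsum_mul_left]
  rw [ENNReal.tsum_comm, ← ENNReal.tsum_prod, ← Equiv.tsum_eq
    (Equiv.piOptionEquivProd (α := γ.ι) (β := fun _ => ℕ))]
  refine tsum_congr fun (ℓ : Option γ.ι → ℕ) => ?_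
  have h1 : (γ.optFree q hq).wt ℓ = γ.wt (fun i => ℓ (some i)) * nn q ^ (ℓ none + 1) := by
    unfold wt
    change nn (γ.c * q) * ∏ i : Option γ.ι, nn (i.elim q γ.ρ) ^ ℓ i = _
    rw [Fintype.prod_option, nn_mul]
    simp only [Option.elim]
    ring
  have h2 : (γ.optFree q hq).pt ℓ = optData id (γ.pt (fun i => ℓ (some i)), ℓ none + 1) := by
    refine Prod.ext (funext fun o => ?_) rfl
    change (∑ i : Option γ.ι, ((ℓ i : ℚ) + i.elim 1 γ.θ) •
      (i.elim (fun o => o.elim 1 (fun _ => 0)) (fun i o => o.elim 0 (γ.A i)) : Option κ → ℚ)) o = _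
    rw [Fintype.sum_option]
    cases o <;> simp [pt, optData]
  rw [h1, h2, mul_assoc]
  rfl

theorem Conic.opt {Ψ : ((κ → ℚ) × Lab → ℝ≥0∞) → ℝ≥0∞} (hΨ : Conic Ψ) (q : ℚ≥0)
    (hq : q ≠ 0) :
    Conic (fun φ : (Option κ → ℚ) × Lab → ℝ≥0∞ =>
      Ψ (fun v => ∑' k : ℕ, nn q ^ k * φ (optData id (v, k)))) := by
  obtain ⟨L, hL⟩ := hΨ
  simp only [hL]
  refine conic_list L (fun φ v => ∑' k : ℕ, nn q ^ k * φ (optData id (v, k))) fun γ _ => ?_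
  refine ⟨[γ.optZero, γ.optFree q hq], fun φ => ?_⟩
  simp only [evalL_cons, evalL_nil, add_zero]
  rw [optZero_eval, optFree_eval, ← ENNReal.tsum_add]
  refine tsum_congr fun ℓ => ?_
  rw [← mul_add]
  congr 1
  beta_reduce
  rw [tsum_eq_zero_add' (f := fun k : ℕ => nn q ^ k * φ (optData id (γ.pt ℓ, k))) ENNReal.summable]
  simp
end Cell

open scoped ENNReal NNReal
set_option linter.unusedSectionVars false

section PadicMeas
open MeasureTheory
variable {p : ℕ} [hp : Fact p.Prime]

noncomputable instance padicIntMeasurableSpace : MeasurableSpace ℤ_[p] := borel _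
instance padicIntBorelSpace : BorelSpace ℤ_[p] := ⟨rfl⟩

variable (p) in
/-- Haar probability measure -/
noncomputable def pmeas : Measure ℤ_[p] := Measure.addHaarMeasure ⊤

instance pmeas_prob : IsProbabilityMeasure (pmeas p) := ⟨by
  have := Measure.addHaarMeasure_self (K₀ := (⊤ : TopologicalSpace.PositiveCompacts ℤ_[p]))
  simpa [pmeas] using this⟩

instance pmeas_inv : (pmeas p).IsAddLeftInvariant := by unfold pmeas; infer_instance

theorem isOpen_dvd (k : ℕ) : IsOpen {t : ℤ_[p] | (p : ℤ_[p]) ^ k ∣ t} := by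
  have : {t : ℤ_[p] | (p : ℤ_[p]) ^ k ∣ t} = {t | ‖t‖ < (p : ℝ) ^ (-(k : ℤ) + 1)} := by
    ext t
    rw [Set.mem_ofPred_eq, Set.mem_ofPred_eq, ← PadicInt.norm_le_pow_iff_norm_lt_pow_add_one,
      PadicInt.norm_le_pow_iff_mem_span_pow, Ideal.mem_span_singleton]
  rw [this]
  exact isOpen_lt continuous_norm continuous_const

theorem measure_dvd (k : ℕ) : pmeas p {t : ℤ_[p] | (p : ℤ_[p]) ^ k ∣ t} = (nn (1 / p)) ^ k := by
  let H : AddSubgroup ℤ_[p] := (PadicInt.toZModPow k : ℤ_[p] →+* ZMod (p ^ k)).toAddMonoidHom.ker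
  have hH : (H : Set ℤ_[p]) = {t : ℤ_[p] | (p : ℤ_[p]) ^ k ∣ t} := by
    ext t
    have := (PadicInt.ker_toZModPow (p := p) k)
    have h2 : t ∈ RingHom.ker (PadicInt.toZModPow k : ℤ_[p] →+* ZMod (p ^ k)) ↔
      (p : ℤ_[p]) ^ k ∣ t := by rw [this, Ideal.mem_span_singleton]
    exact h2
  have hi : H.index = p ^ k := by
    rw [AddSubgroup.index_ker, AddMonoidHom.range_eq_top.mpr]
    · simp
    · exact ZMod.ringHom_surjective (PadicInt.toZModPow k)
  have hpk : p ^ k ≠ 0 := pow_ne_zero _ hp.out.ne_zero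
  have : H.FiniteIndex := ⟨by rw [hi]; exact hpk⟩
  have h := H.index_mul_measure (by rw [hH]; exact (isOpen_dvd k).measurableSet) (pmeas p)
  rw [hH, hi, measure_univ] at h
  have h3 : nn (1 / p) ^ k * (p ^ k : ℕ) = 1 := by
    rw [Nat.cast_pow, ← mul_pow]
    have : nn (1 / (p : ℚ≥0)) * (p : ℝ≥0∞) = 1 := by
      have h4 : (p : ℝ≥0∞) = nn (p : ℚ≥0) := by simp [nn]
      rw [h4, ← nn_mul, one_div, inv_mul_cancel₀ (by exact_mod_cast hp.out.ne_zero), nn_one]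
    rw [this, one_pow]
  calc _ = (nn (1 / p) ^ k * (p ^ k : ℕ)) * pmeas p {t : ℤ_[p] | (p : ℤ_[p]) ^ k ∣ t} := by
        rw [h3, one_mul]
    _ = _ := by rw [mul_assoc, h, mul_one]

theorem exists_lift (σ : ZMod p) : ∃ a : ℤ_[p], PadicInt.toZMod a = σ :=
  ZMod.ringHom_surjective PadicInt.toZMod σ

theorem lead_set (c : ℤ_[p]) (k : ℕ) (σ : ZMod p) : ∃ b : ℤ_[p],
    {t : ℤ_[p] | Lead (t - c) k σ} = (fun t => b + t) ⁻¹' {t | (p : ℤ_[p]) ^ (k + 1) ∣ t} := by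
  obtain ⟨a, ha⟩ := exists_lift σ
  refine ⟨-(c + p ^ k * a), ?_⟩
  ext t
  simp only [Set.mem_ofPred_eq, Set.mem_preimage]
  constructor
  · rintro ⟨u, h1, h2⟩
    have : (p : ℤ_[p]) ∣ u - a := by rw [← toZMod_eq_zero_iff, map_sub, h2, ha, sub_self]
    obtain ⟨w, hw⟩ := this
    exact ⟨w, by linear_combination h1 + p ^ k * hw⟩
  · rintro ⟨w, hw⟩
    refine ⟨a + p * w, by linear_combination hw, ?_⟩
    rw [map_add, ha, (toZMod_eq_zero_iff _).mpr (dvd_mul_right _ _), add_zero]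

theorem isOpen_lead (c : ℤ_[p]) (k : ℕ) (σ : ZMod p) : IsOpen {t : ℤ_[p] | Lead (t - c) k σ} := by
  obtain ⟨b, hb⟩ := lead_set c k σ
  rw [hb]
  exact (isOpen_dvd _).preimage (continuous_const.add continuous_id)

theorem measure_lead (c : ℤ_[p]) (k : ℕ) (σ : ZMod p) :
    pmeas p {t : ℤ_[p] | Lead (t - c) k σ} = (nn (1 / p)) ^ (k + 1) := by
  obtain ⟨b, hb⟩ := lead_set c k σ
  rw [hb, measure_preimage_add, measure_dvd]

instance pmeas_noAtoms : NullSingletonClass (pmeas p) := ⟨fun c => by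
  have h : ∀ k : ℕ, pmeas p {c} ≤ nn (1 / p) ^ k := fun k => by
    rw [← measure_dvd k, ← measure_preimage_add (pmeas p) (-c) {t : ℤ_[p] | (p : ℤ_[p]) ^ k ∣ t}]
    refine measure_mono fun t ht => ?_
    have ht' : t = c := ht
    subst ht'
    change (p : ℤ_[p]) ^ k ∣ -t + t
    simp
  have h1 : nn (1 / (p : ℚ≥0)) < 1 := by
    unfold nn
    rw [ENNReal.coe_lt_one_iff]
    have : (1 / (p : ℚ≥0)) < 1 := by
      rw [div_lt_one (by exact_mod_cast hp.out.pos)]; exact_mod_cast hp.out.one_lt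
    exact_mod_cast this
  have := ge_of_tendsto' (ENNReal.tendsto_pow_atTop_nhds_zero_of_lt_one h1) h
  simpa using this⟩

theorem measurable_val : Measurable (fun t : ℤ_[p] => t.valuation) := by
  refine measurable_to_countable' fun m => ?_
  have : (fun t : ℤ_[p] => t.valuation) ⁻¹' {m} =
      (⋃ σ : {σ : ZMod p // σ ≠ 0}, {t : ℤ_[p] | Lead (t - 0) m σ}) ∪
        {t | t = 0 ∧ m = 0} := by
    ext t
    simp only [Set.mem_preimage, Set.mem_singleton_iff, Set.mem_union, Set.mem_iUnion,
      Set.mem_ofPred_eq, sub_zero]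
    constructor
    · rintro rfl
      by_cases h : t = 0
      · right; simp [h]
      · left; exact ⟨⟨ac t, ac_ne_zero h⟩, lead_self h⟩
    · rintro (⟨⟨σ, hσ⟩, h⟩ | ⟨rfl, rfl⟩)
      · exact h.val hσ
      · simp
  rw [this]
  refine (MeasurableSet.iUnion fun σ => (isOpen_lead _ _ _).measurableSet).union ?_
  by_cases hm : m = 0
  · simp [hm]
  · simp [hm]

theorem measurable_ac : Measurable (fun t : ℤ_[p] => ac t) := by
  refine measurable_to_countable' fun s => ?_
  by_cases hs : s = 0
  · subst hs
    have : (fun t : ℤ_[p] => ac t) ⁻¹' {0} = {0} := by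
      ext t
      simp only [Set.mem_preimage, Set.mem_singleton_iff]
      exact ⟨fun h => by by_contra h'; exact ac_ne_zero h' h, fun h => by rw [h, ac_zero]⟩
    rw [this]; exact measurableSet_singleton _
  · have : (fun t : ℤ_[p] => ac t) ⁻¹' {s} = ⋃ m : ℕ, {t : ℤ_[p] | Lead (t - 0) m s} := by
      ext t
      simp only [Set.mem_preimage, Set.mem_singleton_iff, Set.mem_iUnion, Set.mem_ofPred_eq,
        sub_zero]
      constructor
      · rintro rfl
        exact ⟨_, lead_self fun h => hs (by rw [h, ac_zero])⟩
      · rintro ⟨m, h⟩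
        exact h.ac hs
    rw [this]
    exact MeasurableSet.iUnion fun m => (isOpen_lead _ _ _).measurableSet

theorem continuous_ev {n : ℕ} (f : MvPolynomial (Fin n) ℤ) :
    Continuous (fun x : Fin n → ℤ_[p] => ev x f) := by
  induction f using MvPolynomial.induction_on with
  | C a => simp only [ev, MvPolynomial.coe_eval₂Hom, MvPolynomial.eval₂_C]; exact continuous_const
  | add f g hf hg => simp only [map_add]; exact hf.add hg
  | mul_X f i hf =>
    simp only [map_mul]
    refine hf.mul ?_
    simp only [ev, MvPolynomial.coe_eval₂Hom, MvPolynomial.eval₂_X]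
    exact continuous_apply i

variable (p) in
/-- product measure -/
noncomputable abbrev pmeasN (n : ℕ) : Measure (Fin n → ℤ_[p]) := Measure.pi fun _ => pmeas p

theorem measurable_cons {n : ℕ} :
    Measurable (fun q : (Fin n → ℤ_[p]) × ℤ_[p] => (Fin.cons q.2 q.1 : Fin (n + 1) → ℤ_[p])) := by
  rw [measurable_pi_iff]
  intro i
  refine Fin.cases ?_ (fun i => ?_) i
  · simpa using measurable_snd
  · simp only [Fin.cons_succ]
    exact (measurable_pi_apply i).comp measurable_fst

theorem cons_eq {n : ℕ} (x : Fin n → ℤ_[p]) (t : ℤ_[p]) :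
    (MeasurableEquiv.piFinSuccAbove (fun _ : Fin (n + 1) => ℤ_[p]) 0).symm (t, x) =
      Fin.cons t x := by
  simp [MeasurableEquiv.piFinSuccAbove]
  rfl

theorem lintegral_succ {n : ℕ} (f : (Fin (n + 1) → ℤ_[p]) → ℝ≥0∞) (hf : Measurable f) :
    ∫⁻ y, f y ∂(pmeasN p (n + 1)) = ∫⁻ x, ∫⁻ t, f (Fin.cons t x) ∂(pmeas p) ∂(pmeasN p n) := by
  have h := measurePreserving_piFinSuccAbove (fun _ : Fin (n + 1) => pmeas p) 0
  rw [← h.symm.lintegral_comp hf, lintegral_prod_symm]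
  · simp only [cons_eq]
  · exact (hf.comp (MeasurableEquiv.measurable _)).aemeasurable

theorem ae_ev_ne {n : ℕ} : ∀ f : MvPolynomial (Fin n) ℤ, f ≠ 0 →
    ∀ᵐ x ∂(pmeasN p n), ev x f ≠ 0 := by
  induction n with
  | zero =>
    intro f hf
    refine Filter.Eventually.of_forall fun x => ?_
    rw [MvPolynomial.eq_C_of_isEmpty f] at hf ⊢
    simp only [ev, MvPolynomial.coe_eval₂Hom, MvPolynomial.eval₂_C]
    intro h
    apply hf
    have : MvPolynomial.coeff 0 f = 0 := by simpa using h
    rw [this]; simp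
  | succ n ih =>
    intro f hf
    have hm : MeasurableSet {y : Fin (n + 1) → ℤ_[p] | ev y f = 0} :=
      (isClosed_eq (continuous_ev f) continuous_const).measurableSet
    have hF : MvPolynomial.finSuccEquiv ℤ n f ≠ 0 := by simpa using hf
    have h1 := ih _ (Polynomial.leadingCoeff_ne_zero.mpr hF)
    rw [ae_iff]
    simp only [not_not]
    rw [← lintegral_indicator_one hm, lintegral_succ _ (measurable_one.indicator hm)]
    rw [lintegral_eq_zero_iff' (by
      refine Measurable.aemeasurable ?_
      refine Measurable.lintegral_prod_right' (f := fun q : (Fin n → ℤ_[p]) × ℤ_[p] =>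
        Set.indicator {y : Fin (n + 1) → ℤ_[p] | ev y f = 0} 1 (Fin.cons q.2 q.1)) ?_
      refine (measurable_one.indicator hm).comp ?_
      exact measurable_cons)]
    filter_upwards [h1] with x hx
    have h2 : (MvPolynomial.finSuccEquiv ℤ n f).map (ev x) ≠ 0 := fun h => hx (by
      have := congrArg (fun q => q.coeff (MvPolynomial.finSuccEquiv ℤ n f).natDegree) h
      simpa using this)
    have h3 : ∀ᵐ t ∂(pmeas p), t ∉ {t | ((MvPolynomial.finSuccEquiv ℤ n f).map (ev x)).IsRoot t} :=
      measure_eq_zero_iff_ae_notMem.mp ((Polynomial.finite_setOfPred_isRoot h2).measure_zero _)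
    simp only [Pi.zero_apply]
    rw [lintegral_eq_zero_iff' (by
      refine Measurable.aemeasurable ?_
      refine (measurable_one.indicator hm).comp ?_
      exact measurable_cons.comp (measurable_const.prodMk measurable_id))]
    filter_upwards [h3] with t ht
    simp only [Pi.zero_apply]
    rw [Set.indicator_of_notMem]
    simp only [Set.mem_ofPred_eq, ev_cons]
    exact ht

end PadicMeas

open scoped ENNReal NNReal

section FibreSec
set_option linter.unusedSectionVars false
set_option linter.unusedVariables false
open MeasureTheory
variable {p : ℕ} [hp : Fact p.Prime]
variable {X κ Lab : Type} [Fintype κ] [Finite Lab] {δ : X → (κ → ℚ) × Lab}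
variable {Φ : Type} {F : Fam p δ Φ}

theorem Tame.lift {g : X → ℤ_[p]} (hg : Tame δ g) : Tame (optData δ) (fun q => g q.1) :=
  ⟨hg.1.lift, hg.2.lift⟩

theorem dvd_iff_val {a : ℤ_[p]} {k : ℕ} : (p : ℤ_[p]) ^ k ∣ a ↔ (a = 0 ∨ k ≤ a.valuation) := by
  by_cases h : a = 0
  · simp [h]
  · rw [← Ideal.mem_span_singleton, PadicInt.mem_span_pow_iff_le_valuation a h]
    simp [h]

theorem Tame.adm_lead {g : X → ℤ_[p]} (hg : Tame δ g) {σ : ZMod p} (hσ : σ ≠ 0) :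
    Adm (optData δ) (fun q => Lead (g q.1) q.2 σ) := by
  refine (hg.lift.eq_zero.not.and ((hg.lift.1.eq PL.last).and
    (hg.lift.2.comp (fun a => a = σ)))).congr fun q => ?_
  rw [lead_iff hσ]
  simp

theorem Tame.adm_dvd {g : X → ℤ_[p]} (hg : Tame δ g) :
    Adm (optData δ) (fun q => (p : ℤ_[p]) ^ q.2 ∣ g q.1) := by
  refine (hg.lift.eq_zero.or (PL.last.le hg.lift.1)).congr fun q => ?_
  rw [dvd_iff_val]
  simp

theorem lead_succ_iff {a b : ℤ_[p]} {k : ℕ} {σ : ZMod p} (ha : Lead a k σ) :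
    (p : ℤ_[p]) ^ (k + 1) ∣ a - b ↔ Lead b k σ := by
  constructor
  · rintro ⟨u, hu⟩
    have : Lead (p ^ (k + 1) * u : ℤ_[p]) k 0 := ⟨p * u, by ring, by
      rw [toZMod_eq_zero_iff]; exact dvd_mul_right _ _⟩
    have h2 := ha.sub this
    rw [sub_zero, ← hu, sub_sub_cancel] at h2
    exact h2
  · intro hb
    have h := ha.sub hb
    rw [sub_self] at h
    obtain ⟨u, h1, h2⟩ := h
    obtain ⟨w, rfl⟩ := (toZMod_eq_zero_iff u).mp h2
    exact ⟨w, by rw [h1]; ring⟩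

theorem Lead.dvd {a : ℤ_[p]} {k : ℕ} {σ : ZMod p} (ha : Lead a k σ) : (p : ℤ_[p]) ^ k ∣ a := by
  obtain ⟨u, h, -⟩ := ha
  exact ⟨u, h⟩

/-- the ball belongs to center `i` -/
def OkBall {s : Finset Φ} {J : Type} (T : Table F s J) (e : J → ℕ) (i : J) (σ : ZMod p)
    (q : X × ℕ) : Prop :=
  (∀ j, ¬ Lead (T.c j q.1 - T.c i q.1) q.2 σ) ∧
    ∀ j, e j < e i → ¬ (p : ℤ_[p]) ^ q.2 ∣ T.c j q.1 - T.c i q.1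

theorem adm_okBall {s : Finset Φ} {J : Type} [Finite J] (T : Table F s J) (e : J → ℕ) (i : J)
    {σ : ZMod p} (hσ : σ ≠ 0) : Adm (optData δ) (OkBall T e i σ) := by
  refine Adm.and (Adm.all fun j => ((T.diff j i).adm_lead hσ).not) (Adm.all fun j => ?_)
  by_cases h : e j < e i
  · simpa [h] using (T.diff j i).adm_dvd.not
  · simpa [h] using Adm.const True

theorem exists_ball {s : Finset Φ} {J : Type} [Finite J] (T : Table F s J) (e : J → ℕ)
    (he : Function.Injective e) (x : X) (t : ℤ_[p]) (ht : ∀ j, T.c j x ≠ t) :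
    ∃ i, ∃ σ : {σ : ZMod p // σ ≠ 0}, ∃ k : ℕ,
      (OkBall T e i σ.1 (x, k) ∧ Lead (t - T.c i x) k σ.1) ∧
      ∀ i' (σ' : {σ : ZMod p // σ ≠ 0}) k',
        (OkBall T e i' σ'.1 (x, k') ∧ Lead (t - T.c i' x) k' σ'.1) → i' = i ∧ σ' = σ ∧ k' = k := by
  classical
  cases nonempty_fintype J
  have hne : ∀ j, t - T.c j x ≠ 0 := fun j h => ht j (sub_eq_zero.mp h).symm
  obtain ⟨j0, -⟩ := T.zero
  -- characterisation
  have hchar : ∀ i (σ : {σ : ZMod p // σ ≠ 0}) k, Lead (t - T.c i x) k σ.1 →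
      (OkBall T e i σ.1 (x, k) ↔ (∀ j, (t - T.c j x).valuation ≤ k) ∧
        ∀ j, e j < e i → (t - T.c j x).valuation < k) := by
    intro i σ k hl
    refine and_congr (forall_congr' fun j => ?_) (forall_congr' fun j => imp_congr_right fun _ => ?_)
    · have h1 := lead_succ_iff (b := T.c j x - T.c i x) hl
      rw [← h1, sub_sub_sub_cancel_right, dvd_iff_val]
      have := hne j
      simp only [this, false_or]
      omega
    · have h1 : (p : ℤ_[p]) ^ k ∣ T.c j x - T.c i x ↔ (p : ℤ_[p]) ^ k ∣ t - T.c j x := by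
        have h2 := dvd_sub_right (b := t - T.c i x) (c := T.c j x - T.c i x) hl.dvd
        rw [← h2, sub_sub_sub_cancel_right]
      change ¬ (p : ℤ_[p]) ^ k ∣ T.c j x - T.c i x ↔ _
      rw [h1, dvd_iff_val]
      have := hne j
      simp only [this, false_or]
      omega
  obtain ⟨i0, -, hi0⟩ := Finset.exists_max_image (Finset.univ : Finset J)
    (fun j => (t - T.c j x).valuation) ⟨j0, Finset.mem_univ _⟩
  obtain ⟨i, hi, hmin⟩ := Finset.exists_min_image
    (Finset.univ.filter fun j : J => (t - T.c i0 x).valuation ≤ (t - T.c j x).valuation) e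
    ⟨i0, by simp⟩
  simp only [Finset.mem_filter, Finset.mem_univ, true_and] at hi hmin
  have hmax : ∀ j, (t - T.c j x).valuation ≤ (t - T.c i x).valuation :=
    fun j => (hi0 j (Finset.mem_univ _)).trans hi
  have hlt : ∀ j, e j < e i → (t - T.c j x).valuation < (t - T.c i x).valuation := by
    intro j hj
    by_contra hc
    exact absurd (hmin j (hi.trans (not_lt.mp hc))) (not_le.mpr hj)
  have hl := lead_self (hne i)
  refine ⟨i, ⟨_, ac_ne_zero (hne i)⟩, _, ⟨(hchar i ⟨_, ac_ne_zero (hne i)⟩ _ hl).mpr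
    ⟨hmax, hlt⟩, hl⟩, ?_⟩
  rintro i' σ' k' ⟨h1, h2⟩
  obtain ⟨h3, h4⟩ := (hchar i' σ' k' h2).mp h1
  have hk' := h2.val σ'.2
  have hii : i' = i := by
    apply he
    rcases lt_trichotomy (e i') (e i) with h | h | h
    · have := hlt i' h
      have := h3 i
      omega
    · exact h
    · have := h4 i h
      have := hmax i'
      omega
  subst hii
  exact ⟨rfl, Subtype.ext (h2.ac σ'.2).symm, hk'.symm⟩

open Classical in
theorem fibre_formula [Finite Φ] {J : Type} [Fintype J] (T : Table F (s : Finset Φ) J)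
    (hs : ∀ φ, φ ∈ s) :
    ∃ (P : J × {σ : ZMod p // σ ≠ 0} → (Option κ → ℚ) × Lab → Prop)
      (G : J × {σ : ZMod p // σ ≠ 0} → Φ → (Option κ → ℚ) × Lab → ℚ)
      (H : J × {σ : ZMod p // σ ≠ 0} → (Option κ → ℚ) × Lab → Φ → ZMod p),
      (∀ q, Adm id (P q)) ∧ (∀ q φ, PL id (G q φ)) ∧ (∀ q, Adm id (H q)) ∧
      ∀ (x : X) (ψ : (Φ → ℚ) × (Φ → ZMod p) → ℝ≥0∞),
        ∫⁻ t, ψ (fun φ => (((F.f φ x).eval t).valuation : ℚ), fun φ => ac ((F.f φ x).eval t))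
          ∂(pmeas p) =
        ∑ q, ∑' k : ℕ, nn (1 / p) ^ (k + 1) *
          (if P q (optData δ (x, k)) then
            ψ (fun φ => G q φ (optData δ (x, k)), H q (optData δ (x, k))) else 0) := by
  obtain ⟨N, ⟨en⟩⟩ := Finite.exists_equiv_fin J
  let e : J → ℕ := fun j => (en j : ℕ)
  have he : Function.Injective e := Fin.val_injective.comp en.injective
  let W : J × {σ : ZMod p // σ ≠ 0} → Type := fun q => {w : (X × ℕ) × ℤ_[p] //
    Lead (w.2 - T.c q.1 w.1.1) w.1.2 q.2.1 ∧ ∀ j, ¬ Lead (T.c j w.1.1 - T.c q.1 w.1.1) w.1.2 q.2.1}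
  have key : ∀ (q : J × {σ : ZMod p // σ ≠ 0}) (φ : Φ), Tame (fun w : W q => optData δ w.1.1)
      (fun w : W q => (F.f φ w.1.1.1).eval w.1.2) := fun q φ =>
    T.ball φ (hs φ) (fun ψ _ => hs ψ) (fun w : W q => w.1.1.1) q.1 (fun w : W q => w.1.2)
      (fun w : W q => w.1.1.2) q.2.1
      (fun l => (Fam.taylor_tame (fun χ => T.val χ q.1) φ l).lift.pull (fun w : W q => w.1.1))
      ((PL.last (δ := δ)).pull (fun w : W q => w.1.1))
      (fun w => w.2.1) (fun w => w.2.2)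
  choose G hG hG' using fun q φ => (key q φ).1.extend
  choose H hH hH' using fun q => (Adm.pi fun φ => (key q φ).2).extend
  choose P hP hP' using fun q : J × {σ : ZMod p // σ ≠ 0} => (adm_okBall T e q.1 q.2.2).extend
  refine ⟨P, G, H, hP, hG, hH, fun x ψ => ?_⟩
  have h1 : ∀ᵐ t ∂(pmeas p), ψ (fun φ => (((F.f φ x).eval t).valuation : ℚ),
      fun φ => ac ((F.f φ x).eval t)) = ∑' r : (J × {σ : ZMod p // σ ≠ 0}) × ℕ,
        Set.indicator {t : ℤ_[p] | Lead (t - T.c r.1.1 x) r.2 r.1.2.1}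
          (fun _ => if P r.1 (optData δ (x, r.2)) then
            ψ (fun φ => G r.1 φ (optData δ (x, r.2)), H r.1 (optData δ (x, r.2))) else 0) t := by
    have h0 : ∀ᵐ t ∂(pmeas p), t ∉ Set.range (fun j => T.c j x) :=
      measure_eq_zero_iff_ae_notMem.mp ((Set.finite_range _).measure_zero _)
    filter_upwards [h0] with t ht
    obtain ⟨i, σ, k, ⟨hok, hl⟩, huniq⟩ := exists_ball T e he x t (fun j h => ht ⟨j, h⟩)
    rw [tsum_eq_single ((i, σ), k)]
    · rw [Set.indicator_of_mem (by exact hl), if_pos (by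
        change P (i, σ) (optData δ (x, k))
        rw [← hP' (i, σ)]; exact hok)]
      let w : W (i, σ) := ⟨((x, k), t), hl, hok.1⟩
      have e1 := fun φ => hG' (i, σ) φ w
      have e2 := hH' (i, σ) w
      congr 2
      · funext φ; exact e1 φ
    · rintro ⟨⟨i', σ'⟩, k'⟩ hne
      by_cases hl' : Lead (t - T.c i' x) k' σ'.1
      · rw [Set.indicator_of_mem (by exact hl'), if_neg]
        intro h
        change P (i', σ') (optData δ (x, k')) at h
        rw [← hP' (i', σ')] at h
        obtain ⟨rfl, rfl, rfl⟩ := huniq i' σ' k' ⟨h, hl'⟩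
        exact hne rfl
      · rw [Set.indicator_of_notMem (by exact hl')]
  rw [lintegral_congr_ae h1, lintegral_tsum (fun r => (measurable_const.indicator
    (isOpen_lead _ _ _).measurableSet).aemeasurable), ENNReal.tsum_prod', tsum_fintype]
  refine Finset.sum_congr rfl fun q _ => tsum_congr fun k => ?_
  rw [lintegral_indicator (isOpen_lead _ _ _).measurableSet, setLIntegral_const, measure_lead,
    mul_comm]

end FibreSec

open scoped ENNReal NNReal

namespace Cell
variable {κ Lab : Type} [Fintype κ]

theorem eval_add (β : Cell κ Lab) (φ ψ : (κ → ℚ) × Lab → ℝ≥0∞) :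
    β.eval (fun v => φ v + ψ v) = β.eval φ + β.eval ψ := by
  unfold eval
  rw [← ENNReal.tsum_add]
  exact tsum_congr fun ℓ => mul_add _ _ _

theorem eval_zero (β : Cell κ Lab) : β.eval (fun _ => 0) = 0 := by simp [eval]

theorem evalL_zero (L : List (Cell κ Lab)) : evalL L (fun _ => 0) = 0 := by
  induction L with
  | nil => simp
  | cons β L ih => simp [ih, eval_zero]

theorem evalL_add (L : List (Cell κ Lab)) (φ ψ : (κ → ℚ) × Lab → ℝ≥0∞) :
    evalL L (fun v => φ v + ψ v) = evalL L φ + evalL L ψ := by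
  induction L with
  | nil => simp
  | cons β L ih => simp only [evalL_cons, ih, eval_add]; ring

theorem Conic.map_sum {Ψ : ((κ → ℚ) × Lab → ℝ≥0∞) → ℝ≥0∞} (hΨ : Conic Ψ) {J : Type}
    (s : Finset J) (f : J → (κ → ℚ) × Lab → ℝ≥0∞) :
    Ψ (fun v => ∑ j ∈ s, f j v) = ∑ j ∈ s, Ψ (f j) := by
  classical
  obtain ⟨L, hL⟩ := hΨ
  simp only [hL]
  induction s using Finset.induction_on with
  | empty => simp [evalL_zero]
  | insert a s ha ih => simp only [Finset.sum_insert ha, evalL_add, ih]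

theorem Conic.map_mul {Ψ : ((κ → ℚ) × Lab → ℝ≥0∞) → ℝ≥0∞} (hΨ : Conic Ψ) (a : ℝ≥0∞)
    (f : (κ → ℚ) × Lab → ℝ≥0∞) :
    Ψ (fun v => a * f v) = a * Ψ f := by
  obtain ⟨L, hL⟩ := hΨ
  simp only [hL]
  induction L with
  | nil => simp
  | cons β L ih =>
    exact (by
      have h : β.eval (fun v => a * f v) = a * β.eval f := by
        unfold eval
        rw [← ENNReal.tsum_mul_left]
        exact tsum_congr fun ℓ => by ring
      have ih' : evalL L (fun v => a * f v) = a * evalL L f := by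
        clear hL h ih
        induction L with
        | nil => simp
        | cons β L ih =>
          have h : β.eval (fun v => a * f v) = a * β.eval f := by
            unfold eval
            rw [← ENNReal.tsum_mul_left]
            exact tsum_congr fun ℓ => by ring
          simp only [evalL_cons, ih, h, mul_add]
      simp only [evalL_cons, ih', h, mul_add])

end Cell

section ConicThm
set_option linter.unusedSectionVars false
set_option linter.unusedVariables false
open MeasureTheory Cell

variable {p : ℕ} [hp : Fact p.Prime]

/-- valuation and angular component data of a finite set of polynomials -/
noncomputable def dataOf {n : ℕ} (G : Finset (MvPolynomial (Fin n) ℤ)) (x : Fin n → ℤ_[p]) :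
    (G → ℚ) × (G → ZMod p) :=
  (fun g => ((ev x g.1).valuation : ℚ), fun g => ac (ev x g.1))

theorem measurable_dataOf {n : ℕ} (G : Finset (MvPolynomial (Fin n) ℤ))
    (φ : (G → ℚ) × (G → ZMod p) → ℝ≥0∞) :
    Measurable (fun x : Fin n → ℤ_[p] => φ (dataOf G x)) := by
  let D : (Fin n → ℤ_[p]) → (G → ℕ) × (G → ZMod p) :=
    fun x => (fun g => (ev x g.1).valuation, fun g => ac (ev x g.1))
  have hD : Measurable D := by
    refine Measurable.prodMk ?_ ?_
    · rw [measurable_pi_iff]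
      exact fun g => measurable_val.comp (continuous_ev g.1).measurable
    · rw [measurable_pi_iff]
      exact fun g => measurable_ac.comp (continuous_ev g.1).measurable
  have : Measurable (fun q : (G → ℕ) × (G → ZMod p) => φ (fun g => (q.1 g : ℚ), q.2)) :=
    measurable_from_prod_countable_right (fun a => by
      exact Measurable.of_discrete)
  exact this.comp hD

theorem conic_zero (G : Finset (MvPolynomial (Fin 0) ℤ)) (h0 : (0 : MvPolynomial (Fin 0) ℤ) ∉ G) :
    ∃ S0 : Finset ℕ, ∀ p [Fact p.Prime], p ∉ S0 →
      Conic (fun φ : (G → ℚ) × (G → ZMod p) → ℝ≥0∞ => ∫⁻ x, φ (dataOf G x) ∂(pmeasN p 0)) := by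
  classical
  refine ⟨G.biUnion fun g => (MvPolynomial.coeff 0 g).natAbs.primeFactors, fun p hp hS => ?_⟩
  refine ⟨[⟨Empty, fun g => ac (ev (default : Fin 0 → ℤ_[p]) g.1), 1, Empty.elim, Empty.elim,
    Empty.elim, one_ne_zero, fun i => i.elim, fun i => i.elim, fun i => i.elim⟩], fun φ => ?_⟩
  beta_reduce
  rw [lintegral_unique, measure_univ, mul_one]
  simp only [evalL_cons, evalL_nil, add_zero]
  unfold eval
  rw [tsum_eq_single default (fun ℓ h => absurd (Subsingleton.elim _ _) h)]
  unfold wt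
  simp only [Finset.univ_eq_empty, Finset.prod_empty, mul_one, nn_one, one_mul]
  congr 1
  refine Prod.ext (funext fun g => ?_)
    (funext fun g => congrArg (fun y => ac (ev y g.1)) (Subsingleton.elim _ _))
  simp only [dataOf, pt, Finset.univ_eq_empty, Finset.sum_empty, Pi.zero_apply]
  have h1 : ∀ y : Fin 0 → ℤ_[p], ev y g.1 = ((MvPolynomial.coeff 0 g.1 : ℤ) : ℤ_[p]) := by
    intro y
    conv_lhs => rw [MvPolynomial.eq_C_of_isEmpty g.1]
    simp [ev]
  have h2 : MvPolynomial.coeff 0 g.1 ≠ 0 := fun h => h0 (by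
    have h3 := MvPolynomial.eq_C_of_isEmpty g.1
    rw [h, map_zero] at h3
    rw [← h3]; exact g.2)
  have h3 : ¬ (p : ℤ) ∣ MvPolynomial.coeff 0 g.1 := by
    intro h
    apply hS
    rw [Finset.mem_biUnion]
    refine ⟨g.1, g.2, ?_⟩
    rw [Nat.mem_primeFactors]
    exact ⟨hp.out, Int.natCast_dvd.mp h, by simpa using h2⟩
  rw [h1, Nat.cast_eq_zero]
  by_contra hc
  apply h3
  rw [← PadicInt.norm_int_lt_one_iff_dvd (p := p), PadicInt.norm_lt_one_iff_dvd, ← pow_one (p : ℤ_[p]),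
    dvd_iff_val]
  right; omega


theorem conic_succ {n : ℕ} (ih : ∀ G : Finset (MvPolynomial (Fin n) ℤ),
      (0 : MvPolynomial (Fin n) ℤ) ∉ G → ∃ S0 : Finset ℕ, ∀ p [Fact p.Prime], p ∉ S0 →
      Conic (fun φ : (G → ℚ) × (G → ZMod p) → ℝ≥0∞ => ∫⁻ x, φ (dataOf G x) ∂(pmeasN p n)))
    (G : Finset (MvPolynomial (Fin (n + 1)) ℤ)) (h0 : (0 : MvPolynomial (Fin (n + 1)) ℤ) ∉ G) :
    ∃ S0 : Finset ℕ, ∀ p [Fact p.Prime], p ∉ S0 →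
      Conic (fun φ : (G → ℚ) × (G → ZMod p) → ℝ≥0∞ =>
        ∫⁻ x, φ (dataOf G x) ∂(pmeasN p (n + 1))) := by
  classical
  obtain ⟨S, hGS, hS0, hcl⟩ := exists_closure (G.image (MvPolynomial.finSuccEquiv ℤ n)) (by
    rw [Finset.mem_image]
    rintro ⟨g, hg, h⟩
    rw [EmbeddingLike.map_eq_zero_iff] at h
    exact h0 (h ▸ hg))
  set G' : Finset (MvPolynomial (Fin n) ℤ) := S.biUnion fun φ => φ.support.image φ.coeff with hG'
  have hmem : ∀ φ ∈ S, ∀ l, φ.coeff l ≠ 0 → φ.coeff l ∈ G' := fun φ hφ l hl => by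
    rw [hG', Finset.mem_biUnion]
    exact ⟨φ, hφ, Finset.mem_image.mpr ⟨l, Polynomial.mem_support_iff.mpr hl, rfl⟩⟩
  have hG0 : (0 : MvPolynomial (Fin n) ℤ) ∉ G' := by
    rw [hG', Finset.mem_biUnion]
    rintro ⟨φ, -, h⟩
    obtain ⟨l, hl, h⟩ := Finset.mem_image.mp h
    exact Polynomial.mem_support_iff.mp hl h
  obtain ⟨S1, hS1⟩ := ih G' hG0
  refine ⟨S1 ∪ Finset.range (S.sup Polynomial.natDegree + 1), fun p hp hpS => ?_⟩
  rw [Finset.mem_union, not_or, Finset.mem_range, not_lt] at hpS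
  have hcon := hS1 p hpS.1
  let X : Type := {x : Fin n → ℤ_[p] // ∀ g ∈ G', ev x g ≠ 0}
  let δ : X → (G' → ℚ) × (G' → ZMod p) := fun x => dataOf G' x.1
  have hinj : ∀ (x : X) (φ : S) l, φ.1.coeff l ≠ 0 → ev x.1 (φ.1.coeff l) ≠ 0 := fun x φ l hl =>
    x.2 _ (hmem φ.1 φ.2 l hl)
  have hne : ∀ φ : S, φ.1 ≠ 0 := fun φ h => hS0 (h ▸ φ.2)
  have hdeg : ∀ (φ : S) (x : X), (φ.1.map (ev x.1)).natDegree = φ.1.natDegree := fun φ x =>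
    Polynomial.natDegree_map_of_leadingCoeff_ne_zero _
      (hinj x φ _ (Polynomial.leadingCoeff_ne_zero.mpr (hne φ)))
  let F : Fam p δ S :=
    { f := fun φ x => φ.1.map (ev x.1)
      D := fun φ => φ.1.natDegree
      hD := hdeg
      h0 := fun φ x h => by
        have h1 := congrArg (fun q => q.coeff φ.1.natDegree) h
        simp only [Polynomial.coeff_map, Polynomial.coeff_zero] at h1
        exact hinj x φ _ (Polynomial.leadingCoeff_ne_zero.mpr (hne φ)) h1
      hp := fun φ => lt_of_le_of_lt (Finset.le_sup (f := Polynomial.natDegree) φ.2)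
        (Nat.lt_of_succ_le hpS.2)
      tame := fun φ l => by
        simp only [Polynomial.coeff_map]
        by_cases hl : φ.1.coeff l = 0
        · simp only [hl, map_zero]; exact Tame.zero
        · exact ⟨PL.coord (δ := δ) ⟨_, hmem φ.1 φ.2 l hl⟩,
            (Adm.lab (δ := δ)).comp (fun b => b ⟨_, hmem φ.1 φ.2 l hl⟩)⟩
      hder := fun φ j hj => by
        by_cases h : Polynomial.hasseDeriv j φ.1 = 0
        · left; intro x; rw [hasseDeriv_map', h, Polynomial.map_zero]
        · right
          exact ⟨⟨_, hcl.der φ.1 φ.2 (Nat.zero_le _) j hj h⟩, natDegree_hasse_lt φ.1 j hj h,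
            fun x => hasseDeriv_map' _ _ _⟩
      hrem := fun ψ χ hle => by
        obtain ⟨e, q, r, h1, h2⟩ := hcl.rem ψ.1 ψ.2 χ.1 χ.2 (Nat.zero_le _) hle
        refine ⟨e, fun x => q.map (ev x.1), fun x => r.map (ev x.1), fun x => ?_, ?_⟩
        · have h3 := congrArg (Polynomial.map (ev x.1)) h1
          simp only [Polynomial.map_mul, Polynomial.map_add, Polynomial.map_C, map_pow] at h3
          have h4 : (ψ.1.map (ev x.1)).leadingCoeff = ev x.1 ψ.1.leadingCoeff := by
            rw [Polynomial.leadingCoeff, hdeg, Polynomial.coeff_map]; rfl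
          rw [h4]
          convert h3 using 2
          simp
        · by_cases hr : r = 0
          · left; intro x; simp [hr]
          · right; exact ⟨⟨r, (h2 hr).1⟩, (h2 hr).2, fun x => rfl⟩ }
  obtain ⟨J, hJ, ⟨T⟩⟩ := exists_table F _ Finset.univ rfl (fun _ _ _ _ => Finset.mem_univ _)
  cases nonempty_fintype J
  obtain ⟨P, A, H, hP, hA, hH, hform⟩ := fibre_formula T (fun φ => Finset.mem_univ φ)
  let ι : G → S := fun g => ⟨_, hGS (Finset.mem_image_of_mem (MvPolynomial.finSuccEquiv ℤ n) g.2)⟩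
  let U : J × {σ : ZMod p // σ ≠ 0} → ((G → ℚ) × (G → ZMod p) → ℝ≥0∞) →
      (Option G' → ℚ) × (G' → ZMod p) → ℝ≥0∞ := fun q φ w =>
    if P q w then φ (fun g => A q (ι g) w, fun g => H q w (ι g)) else 0
  have hae : ∀ᵐ x ∂(pmeasN p n), ∀ g ∈ G', ev x g ≠ 0 := by
    rw [Filter.eventually_all_finset]
    exact fun g hg => ae_ev_ne g (fun h => hG0 (h ▸ hg))
  have hq : (1 / p : ℚ≥0) ≠ 0 := by
    rw [one_div]; exact inv_ne_zero (by exact_mod_cast hp.out.ne_zero)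
  have hmain : ∀ φ : (G → ℚ) × (G → ZMod p) → ℝ≥0∞,
      ∫⁻ x, φ (dataOf G x) ∂(pmeasN p (n + 1)) =
      nn (1 / p) * ∑ q, ∫⁻ x, (fun v => ∑' k : ℕ, nn (1 / p) ^ k * U q φ (optData id (v, k)))
        (dataOf G' x) ∂(pmeasN p n) := by
    intro φ
    have e1 := hcon.map_sum Finset.univ
      (fun q v => ∑' k : ℕ, nn (1 / p) ^ k * U q φ (optData id (v, k)))
    have e2 := hcon.map_mul (nn (1 / p))
      (fun v => ∑ q, ∑' k : ℕ, nn (1 / p) ^ k * U q φ (optData id (v, k)))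
    beta_reduce at e1 e2
    refine Eq.trans ?_ (e2.trans (congrArg _ e1))
    rw [lintegral_succ _ (measurable_dataOf G φ)]
    refine lintegral_congr_ae ?_
    filter_upwards [hae] with x hx
    have h1 := hform ⟨x, hx⟩ (fun v => φ (fun g => v.1 (ι g), fun g => v.2 (ι g)))
    have h2 : ∀ t, dataOf G (Fin.cons t x : Fin (n + 1) → ℤ_[p]) =
      (fun g => (((F.f (ι g) ⟨x, hx⟩).eval t).valuation : ℚ),
        fun g => ac ((F.f (ι g) ⟨x, hx⟩).eval t)) := by
      intro t
      unfold dataOf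
      simp only [ev_cons]
      rfl
    simp only [h2]
    refine h1.trans ?_
    rw [Finset.mul_sum]
    refine Finset.sum_congr rfl fun q _ => ?_
    rw [← ENNReal.tsum_mul_left]
    refine tsum_congr fun k => ?_
    rw [pow_succ', mul_assoc]
    rfl
  simp only [hmain]
  refine Conic.const_mul (Conic.sum _ fun q _ => ?_) _ hq
  have h3 := ((hcon.opt (1 / p) hq).restrict (hP q)).push (F := fun g => A q (ι g))
    (h := fun w g => H q w (ι g)) (fun g => hA q (ι g)) ((hH q).comp fun b g => b (ι g))
  convert h3 using 1

theorem conic_int (n : ℕ) : ∀ G : Finset (MvPolynomial (Fin n) ℤ),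
      (0 : MvPolynomial (Fin n) ℤ) ∉ G → ∃ S0 : Finset ℕ, ∀ p [Fact p.Prime], p ∉ S0 →
      Conic (fun φ : (G → ℚ) × (G → ZMod p) → ℝ≥0∞ => ∫⁻ x, φ (dataOf G x) ∂(pmeasN p n)) := by
  induction n with
  | zero => exact conic_zero
  | succ n ih => exact conic_succ ih

end ConicThm

open scoped ENNReal NNReal

section LatAlg
set_option linter.unusedSectionVars false
set_option linter.unusedVariables false

variable {p : ℕ} [hp : Fact p.Prime]

/-- row span -/
noncomputable def RS {m d : ℕ} (M : Fin m → Fin d → ℤ_[p]) : Submodule ℤ_[p] (Fin d → ℤ_[p]) :=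
  Submodule.span _ (Set.range M)

/-- index -/
noncomputable def idx {d : ℕ} (H : Submodule ℤ_[p] (Fin d → ℤ_[p])) : ℕ := H.toAddSubgroup.index

theorem RS_eq_range {m d : ℕ} (M : Fin m → Fin d → ℤ_[p]) :
    RS M = LinearMap.range (Matrix.vecMulLinear (Matrix.of M)) := by
  rw [range_vecMulLinear]; rfl

theorem card_quot (a : ℤ_[p]) (ha : a ≠ 0) :
    Nat.card (ℤ_[p] ⧸ Ideal.span ({a} : Set ℤ_[p])) = p ^ a.valuation := by
  have h1 : Ideal.span ({a} : Set ℤ_[p]) = RingHom.ker (PadicInt.toZModPow a.valuation) := by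
    rw [PadicInt.ker_toZModPow, Ideal.span_singleton_eq_span_singleton]
    have h2 := PadicInt.unitCoeff_spec ha
    exact Associated.symm ⟨PadicInt.unitCoeff ha, by rw [mul_comm]; exact h2.symm⟩
  rw [h1, Nat.card_congr (RingHom.quotientKerEquivOfSurjective
    (ZMod.ringHom_surjective (PadicInt.toZModPow (p := p) a.valuation))).toEquiv]
  simp

theorem finrank_lat {d : ℕ} (H : Submodule ℤ_[p] (Fin d → ℤ_[p])) (h : idx H ≠ 0) :
    Module.finrank ℤ_[p] H = Module.finrank ℤ_[p] (Fin d → ℤ_[p]) := by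
  refine le_antisymm (Submodule.finrank_le H) ?_
  have hn : ((idx H : ℕ) : ℤ_[p]) ≠ 0 := by exact_mod_cast h
  let f : (Fin d → ℤ_[p]) →ₗ[ℤ_[p]] H := LinearMap.codRestrict H
    (((idx H : ℕ) : ℤ_[p]) • LinearMap.id) (fun b => by
      have := H.toAddSubgroup.nsmul_index_mem b
      simp only [LinearMap.smul_apply, LinearMap.id_apply, Nat.cast_smul_eq_nsmul]
      exact this)
  refine LinearMap.finrank_le_finrank_of_injective (f := f) ?_
  intro x y hxy
  have h1 := congrArg Subtype.val hxy
  have h2 : ((idx H : ℕ) : ℤ_[p]) • x = ((idx H : ℕ) : ℤ_[p]) • y := h1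
  exact smul_right_injective _ hn h2

theorem idx_RS {d : ℕ} (M : Fin d → Fin d → ℤ_[p]) (hM : (Matrix.of M).det ≠ 0) :
    idx (RS M) = p ^ (Matrix.of M).det.valuation := by
  classical
  set N := RS M with hN
  let f := Matrix.vecMulLinear (Matrix.of M)
  have hinj : Function.Injective f := by
    intro x y hxy
    rw [← sub_eq_zero]
    refine Matrix.eq_zero_of_vecMul_eq_zero hM ?_
    have h : f (x - y) = 0 := by rw [map_sub, hxy, sub_self]
    exact h
  have hr : N = LinearMap.range f := RS_eq_range M
  have hrank : Module.finrank ℤ_[p] N = Module.finrank ℤ_[p] (Fin d → ℤ_[p]) := by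
    rw [hr, LinearMap.finrank_range_of_inj hinj]
  let b := Pi.basisFun ℤ_[p] (Fin d)
  let bt := Submodule.smithNormalFormTopBasis b hrank
  let bb := Submodule.smithNormalFormBotBasis b hrank
  let a := Submodule.smithNormalFormCoeffs b hrank
  have hab : ∀ i, (bb i : Fin d → ℤ_[p]) = a i • bt i := Submodule.smithNormalFormBotBasis_def b hrank
  have ha : ∀ i, a i ≠ 0 := Submodule.smithNormalFormCoeffs_ne_zero b hrank
  have h1 : idx N = ∏ i, p ^ (a i).valuation := by
    change Nat.card ((Fin d → ℤ_[p]) ⧸ N) = _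
    rw [Nat.card_congr (Submodule.quotientEquivPiSpan N b hrank).toEquiv, Nat.card_pi]
    exact Finset.prod_congr rfl fun i _ => card_quot _ (ha i)
  let u : (Fin d → ℤ_[p]) ≃ₗ[ℤ_[p]] (Fin d → ℤ_[p]) :=
    ((LinearEquiv.ofInjective f hinj).trans (LinearEquiv.ofEq _ _ hr.symm)).trans
      (bb.equiv bt (Equiv.refl _))
  let g : (Fin d → ℤ_[p]) →ₗ[ℤ_[p]] (Fin d → ℤ_[p]) := Matrix.toLin bt bt (Matrix.diagonal a)
  have hg : ∀ y : N, g (bb.equiv bt (Equiv.refl _) y) = y := by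
    intro y
    have : g ∘ₗ (bb.equiv bt (Equiv.refl _)).toLinearMap = N.subtype := by
      refine bb.ext fun i => ?_
      simp only [LinearMap.comp_apply, LinearEquiv.coe_coe, Module.Basis.equiv_apply, Equiv.refl_apply,
        Submodule.subtype_apply, hab, g]
      rw [Matrix.toLin_self]
      simp [Matrix.diagonal_apply]
    exact LinearMap.congr_fun this y
  have hfg : f = g ∘ₗ u.toLinearMap := by
    refine LinearMap.ext fun y => ?_
    exact (hg ((LinearEquiv.ofEq _ _ hr.symm) (LinearEquiv.ofInjective f hinj y))).symm
  have hdet : LinearMap.det f = (∏ i, a i) * LinearMap.det u.toLinearMap := by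
    rw [hfg, LinearMap.det_comp]
    congr 1
    rw [LinearMap.det_toLin, Matrix.det_diagonal]
  have hf : LinearMap.det f = (Matrix.of M).det := by
    have : f = Matrix.toLin' (Matrix.of M).transpose := by
      refine LinearMap.ext fun y => ?_
      rw [Matrix.toLin'_apply, Matrix.mulVec_transpose]; rfl
    rw [this, LinearMap.det_toLin', Matrix.det_transpose]
  have hu : IsUnit (LinearMap.det u.toLinearMap) := LinearEquiv.isUnit_det' u
  rw [h1, ← hf, hdet, Finset.prod_pow_eq_pow_sum]
  congr 1
  have h3 : ∀ s : Finset (Fin d), (∏ i ∈ s, a i).valuation = ∑ i ∈ s, (a i).valuation := by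
    intro s
    induction s using Finset.induction_on with
    | empty => simp
    | insert i s hi ih =>
      rw [Finset.prod_insert hi, Finset.sum_insert hi, PadicInt.valuation_mul (ha i)
        (Finset.prod_ne_zero_iff.mpr fun j _ => ha j), ih]
  rw [PadicInt.valuation_mul (Finset.prod_ne_zero_iff.mpr fun j _ => ha j) hu.ne_zero, h3]
  have h4 : (LinearMap.det u.toLinearMap).valuation = 0 := by
    have h5 := PadicInt.norm_eq_zpow_neg_valuation hu.ne_zero
    rw [PadicInt.isUnit_iff.mp hu] at h5
    by_contra hc
    have h6 : (1 : ℝ) < p := by exact_mod_cast hp.out.one_lt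
    have := zpow_lt_one_of_neg₀ h6 (n := -((LinearMap.det u.toLinearMap).valuation : ℤ)) (by omega)
    linarith
  rw [h4, add_zero]

theorem exists_mat {d : ℕ} (H : Submodule ℤ_[p] (Fin d → ℤ_[p])) (h : idx H ≠ 0) :
    ∃ M : Fin d → Fin d → ℤ_[p], (Matrix.of M).det ≠ 0 ∧ RS M = H := by
  classical
  have hrank := finrank_lat H h
  let b := Pi.basisFun ℤ_[p] (Fin d)
  let bb := Submodule.smithNormalFormBotBasis b hrank
  refine ⟨fun i => bb i, ?_, ?_⟩
  · have h1 : LinearIndependent ℤ_[p] (fun i => (bb i : Fin d → ℤ_[p])) :=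
      bb.linearIndependent.map' H.subtype (Submodule.ker_subtype H)
    intro h0
    rw [← Matrix.exists_vecMul_eq_zero_iff] at h0
    obtain ⟨v, hv, h0⟩ := h0
    apply hv
    rw [Fintype.linearIndependent_iff] at h1
    refine funext (h1 v ?_)
    rw [Matrix.vecMul_eq_sum] at h0
    exact h0
  · unfold RS
    have h2 := bb.span_eq
    have h3 := congrArg (Submodule.map H.subtype) h2
    rw [Submodule.map_span, Submodule.map_top, Submodule.range_subtype, ← Set.range_comp] at h3
    exact h3

end LatAlg

open scoped ENNReal NNReal

section LatMeas
set_option linter.unusedSectionVars false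
set_option linter.unusedVariables false
open MeasureTheory

variable {p : ℕ} [hp : Fact p.Prime]

instance pmeas_haar : (pmeas p).IsAddHaarMeasure := by unfold pmeas; infer_instance

variable (p) in
/-- measure on matrices -/
noncomputable abbrev mm (m d : ℕ) : Measure (Fin m → Fin d → ℤ_[p]) :=
  Measure.pi fun _ => pmeasN p d

instance pmeasN_haar (d : ℕ) : (pmeasN p d).IsAddHaarMeasure :=
  Measure.pi.isAddHaarMeasure (fun _ : Fin d => pmeas p)

instance mm_haar (m d : ℕ) : (mm p m d).IsAddHaarMeasure :=
  Measure.pi.isAddHaarMeasure (fun _ : Fin m => pmeasN p d)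

/-- reshape -/
def resh {m d : ℕ} (x : Fin (m * d) → ℤ_[p]) : Fin m → Fin d → ℤ_[p] :=
  fun i j => x (finProdFinEquiv (i, j))

theorem resh_mp (m d : ℕ) : MeasurePreserving (resh (p := p) (m := m) (d := d))
    (pmeasN p (m * d)) (mm p m d) := by
  let f : (Fin (m * d) → ℤ_[p]) →+ (Fin m → Fin d → ℤ_[p]) :=
    { toFun := resh, map_zero' := rfl, map_add' := fun x y => rfl }
  refine AddMonoidHom.measurePreserving (f := f) ?_ ?_ ?_
  · exact continuous_pi fun i => continuous_pi fun j => continuous_apply _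
  · intro y
    refine ⟨fun k => y (finProdFinEquiv.symm k).1 (finProdFinEquiv.symm k).2, ?_⟩
    funext i j
    change y (finProdFinEquiv.symm (finProdFinEquiv (i, j))).1 _ = _
    rw [Equiv.symm_apply_apply]
  · rw [measure_univ, measure_univ]

theorem scale_meas {m d : ℕ} (α : (Fin m → Fin d → ℤ_[p]) →+ (Fin m → Fin d → ℤ_[p]))
    (hc : Continuous α) (hi : Function.Injective α) (S : Set (Fin m → Fin d → ℤ_[p])) :
    mm p m d (α '' S) = mm p m d (Set.range α) * mm p m d S := by
  have he : MeasurableEmbedding α := (hc.isClosedEmbedding hi).measurableEmbedding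
  have h1 : ((mm p m d).comap α).IsAddLeftInvariant := Measure.IsAddLeftInvariant.comap _ he
  have h2 : IsFiniteMeasureOnCompacts ((mm p m d).comap α) :=
    IsFiniteMeasureOnCompacts.comap' _ hc he
  have h3 := Measure.isAddInvariant_eq_smul_of_compactSpace ((mm p m d).comap α) (mm p m d)
  set c := ((mm p m d).comap α).addHaarScalarFactor (mm p m d)
  have h4 : ∀ S, mm p m d (α '' S) = c * mm p m d S := by
    intro S
    have := congrArg (fun μ => μ S) h3
    beta_reduce at this
    rw [he.comap_apply] at this
    rw [this]; rfl
  rw [h4 S, ← Set.image_univ, h4 Set.univ, measure_univ, mul_one]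

theorem nn_inv_mul : nn (1 / (p : ℚ≥0)) * (p : ℝ≥0∞) = 1 := by
  have h4 : (p : ℝ≥0∞) = nn (p : ℚ≥0) := by simp [nn]
  rw [h4, ← nn_mul, one_div, inv_mul_cancel₀ (by exact_mod_cast hp.out.ne_zero), nn_one]

/-- tuples spanning H -/
def TS (m : ℕ) {d : ℕ} (H : Submodule ℤ_[p] (Fin d → ℤ_[p])) : Set (Fin m → Fin d → ℤ_[p]) :=
  {x | RS x = H}

theorem continuous_vecMul' {d : ℕ} (A : Fin d → Fin d → ℤ_[p]) :
    Continuous (fun x : Fin d → ℤ_[p] => Matrix.vecMul x (Matrix.of A)) := by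
  refine continuous_pi fun j => ?_
  simp only [Matrix.vecMul, dotProduct]
  fun_prop

/-- the map x ↦ xA -/
noncomputable def amap (m : ℕ) {d : ℕ} (A : Fin d → Fin d → ℤ_[p]) :
    (Fin m → Fin d → ℤ_[p]) →+ (Fin m → Fin d → ℤ_[p]) where
  toFun x i := Matrix.vecMulLinear (Matrix.of A) (x i)
  map_zero' := by funext i; simp
  map_add' x y := by funext i; simp

theorem amap_cont (m : ℕ) {d : ℕ} (A : Fin d → Fin d → ℤ_[p]) : Continuous (amap m A) :=
  continuous_pi fun i => (continuous_vecMul' A).comp (continuous_apply i)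

theorem vecMul_inj {d : ℕ} (A : Fin d → Fin d → ℤ_[p]) (hA : (Matrix.of A).det ≠ 0) :
    Function.Injective (Matrix.vecMulLinear (Matrix.of A)) := by
  intro x y hxy
  rw [← sub_eq_zero]
  refine Matrix.eq_zero_of_vecMul_eq_zero hA ?_
  have h : Matrix.vecMulLinear (Matrix.of A) (x - y) = 0 := by rw [map_sub, hxy, sub_self]
  exact h

theorem amap_inj (m : ℕ) {d : ℕ} (A : Fin d → Fin d → ℤ_[p]) (hA : (Matrix.of A).det ≠ 0) :
    Function.Injective (amap m A) := fun x y h =>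
  funext fun i => vecMul_inj A hA (congrFun h i)

theorem RS_amap {m d : ℕ} (A : Fin d → Fin d → ℤ_[p]) (x : Fin m → Fin d → ℤ_[p]) :
    RS (amap m A x) = (RS x).map (Matrix.vecMulLinear (Matrix.of A)) := by
  unfold RS
  rw [Submodule.map_span, ← Set.range_comp]; rfl

theorem TS_eq {m d : ℕ} (A : Fin d → Fin d → ℤ_[p]) (hA : (Matrix.of A).det ≠ 0) :
    TS m (RS A) = amap m A '' TS m ⊤ := by
  ext y
  constructor
  · intro hy
    have hy' : RS y = RS A := hy
    have h1 : ∀ i, ∃ x, Matrix.vecMulLinear (Matrix.of A) x = y i := by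
      intro i
      have : y i ∈ RS A := hy' ▸ Submodule.subset_span ⟨i, rfl⟩
      rw [RS_eq_range] at this
      exact this
    choose x hx using h1
    have hxy : amap m A x = y := funext hx
    refine ⟨x, ?_, hxy⟩
    rw [← hxy, RS_amap, RS_eq_range A, LinearMap.range_eq_map] at hy'
    exact Submodule.map_injective_of_injective (vecMul_inj A hA) hy'
  · rintro ⟨x, hx, rfl⟩
    have hx' : RS x = ⊤ := hx
    change RS _ = _
    rw [RS_amap, hx', RS_eq_range A, LinearMap.range_eq_map]

theorem isClosed_RS {d : ℕ} (A : Fin d → Fin d → ℤ_[p]) :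
    IsClosed ((RS A : Submodule ℤ_[p] (Fin d → ℤ_[p])) : Set (Fin d → ℤ_[p])) := by
  rw [RS_eq_range]
  have : ((LinearMap.range (Matrix.vecMulLinear (Matrix.of A)) :
    Submodule ℤ_[p] (Fin d → ℤ_[p])) : Set (Fin d → ℤ_[p])) =
    Set.range (fun x : Fin d → ℤ_[p] => Matrix.vecMul x (Matrix.of A)) := rfl
  rw [this]
  exact (isCompact_range (continuous_vecMul' A)).isClosed

theorem meas_RS {d : ℕ} (A : Fin d → Fin d → ℤ_[p]) (hA : (Matrix.of A).det ≠ 0) :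
    pmeasN p d (RS A : Submodule ℤ_[p] (Fin d → ℤ_[p])) =
      nn (1 / p) ^ (Matrix.of A).det.valuation := by
  set k := (Matrix.of A).det.valuation with hk
  have hi : (RS A).toAddSubgroup.index = p ^ k := idx_RS A hA
  have hpk : p ^ k ≠ 0 := pow_ne_zero _ hp.out.ne_zero
  have : (RS A).toAddSubgroup.FiniteIndex := ⟨by rw [hi]; exact hpk⟩
  have h := (RS A).toAddSubgroup.index_mul_measure (isClosed_RS A).measurableSet (pmeasN p d)
  rw [hi, measure_univ, Nat.cast_pow] at h
  have h3 : nn (1 / p) ^ k * (p : ℝ≥0∞) ^ k = 1 := by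
    rw [← mul_pow, nn_inv_mul, one_pow]
  calc _ = (nn (1 / p) ^ k * (p : ℝ≥0∞) ^ k) * pmeasN p d (RS A : Submodule ℤ_[p] (Fin d → ℤ_[p])) := by
        rw [h3, one_mul]
    _ = nn (1 / p) ^ k * ((p : ℝ≥0∞) ^ k * pmeasN p d ((RS A).toAddSubgroup : Set (Fin d → ℤ_[p]))) := by
        rw [mul_assoc]; rfl
    _ = _ := by rw [h, mul_one]

theorem meas_TS {m d : ℕ} (A : Fin d → Fin d → ℤ_[p]) (hA : (Matrix.of A).det ≠ 0) :
    mm p m d (TS m (RS A)) =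
      nn (1 / p) ^ (m * (Matrix.of A).det.valuation) * mm p m d (TS m ⊤) := by
  rw [TS_eq A hA, scale_meas _ (amap_cont m A) (amap_inj m A hA)]
  congr 1
  have : Set.range (amap m A) = Set.pi Set.univ fun _ : Fin m =>
      ((RS A : Submodule ℤ_[p] (Fin d → ℤ_[p])) : Set (Fin d → ℤ_[p])) := by
    ext y
    simp only [Set.mem_range, Set.mem_pi, Set.mem_univ, true_imp_iff, SetLike.mem_coe]
    rw [RS_eq_range A]
    constructor
    · rintro ⟨x, rfl⟩ i
      exact ⟨x i, rfl⟩
    · intro h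
      choose x hx using h
      exact ⟨x, funext hx⟩
  rw [this, Measure.pi_pi, Finset.prod_const, meas_RS A hA, ← pow_mul, mul_comm]
  simp [mul_comm]

/-- reduction -/
noncomputable def redm {m d : ℕ} (x : Fin m → Fin d → ℤ_[p]) : Fin m → Fin d → ZMod p :=
  fun i j => PadicInt.toZMod (x i j)

theorem TS_top {m d : ℕ} (x : Fin m → Fin d → ℤ_[p]) :
    RS x = ⊤ ↔ Submodule.span (ZMod p) (Set.range (redm x)) = ⊤ := by
  unfold RS
  rw [Submodule.eq_top_iff', Submodule.eq_top_iff']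
  constructor
  · intro h v
    choose w hw using fun j => exists_lift (v j)
    obtain ⟨c, hc⟩ := (Submodule.mem_span_range_iff_exists_fun _).mp (h w)
    rw [Submodule.mem_span_range_iff_exists_fun]
    refine ⟨fun i => PadicInt.toZMod (c i), funext fun j => ?_⟩
    rw [← hw j, ← congrFun hc j]
    simp [redm]
  · intro h
    rw [← Submodule.eq_top_iff', ← top_le_iff]
    refine Submodule.le_of_le_smul_of_le_jacobson_bot (I := IsLocalRing.maximalIdeal ℤ_[p])
      Module.Finite.fg_top (IsLocalRing.maximalIdeal_le_jacobson _) ?_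
    intro w _
    obtain ⟨c, hc⟩ := (Submodule.mem_span_range_iff_exists_fun _).mp
      (h (fun j => PadicInt.toZMod (w j)))
    choose c' hc' using fun i => exists_lift (c i)
    have h1 : ∀ j, (p : ℤ_[p]) ∣ (w - ∑ i, c' i • x i) j := by
      intro j
      rw [← toZMod_eq_zero_iff]
      have := congrFun hc j
      simp only [redm, Finset.sum_apply, Pi.smul_apply, smul_eq_mul] at this
      simp [hc', this]
    choose z hz using h1
    have h2 : w = (∑ i, c' i • x i) + (p : ℤ_[p]) • z := by
      funext j
      have := hz j
      simp only [Pi.add_apply, Pi.smul_apply, Pi.sub_apply, smul_eq_mul] at this ⊢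
      rw [← this]; ring
    rw [h2]
    refine Submodule.add_mem_sup ?_ (Submodule.smul_mem_smul ?_ trivial)
    · exact Submodule.sum_mem _ fun i _ => Submodule.smul_mem _ _ (Submodule.subset_span ⟨i, rfl⟩)
    · rw [PadicInt.maximalIdeal_eq_span_p]; exact Ideal.mem_span_singleton_self _

theorem redm_set {m d : ℕ} (A : Fin m → Fin d → ZMod p) :
    {x : Fin m → Fin d → ℤ_[p] | redm x = A} =
      Set.pi Set.univ fun i => Set.pi Set.univ fun j => {t : ℤ_[p] | Lead (t - 0) 0 (A i j)} := by
  ext x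
  simp only [Set.mem_pi, Set.mem_univ, true_imp_iff, Set.mem_ofPred_eq]
  constructor
  · intro h i j
    exact ⟨x i j, by simp, congrFun (congrFun h i) j⟩
  · intro h
    funext i j
    obtain ⟨u, h1, h2⟩ := h i j
    rw [pow_zero, one_mul, sub_zero] at h1
    change PadicInt.toZMod (x i j) = _
    rw [h1, h2]

theorem meas_redm {m d : ℕ} (A : Fin m → Fin d → ZMod p) :
    MeasurableSet {x : Fin m → Fin d → ℤ_[p] | redm x = A} ∧
    mm p m d {x | redm x = A} = nn (1 / p) ^ (m * d) := by
  rw [redm_set]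
  constructor
  · exact MeasurableSet.univ_pi fun i => MeasurableSet.univ_pi fun j => (isOpen_lead _ _ _).measurableSet
  · rw [Measure.pi_pi]
    simp only [Measure.pi_pi, measure_lead]
    simp [← pow_mul, mul_comm]

theorem TS_top_eq {m d : ℕ} : TS m (⊤ : Submodule ℤ_[p] (Fin d → ℤ_[p])) =
    ⋃ A : {A : Fin m → Fin d → ZMod p // Submodule.span (ZMod p) (Set.range A) = ⊤},
      {x | redm x = A.1} := by
  ext x
  simp only [Set.mem_iUnion, Set.mem_ofPred_eq]
  change RS x = ⊤ ↔ _
  rw [TS_top]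
  exact ⟨fun h => ⟨⟨_, h⟩, rfl⟩, fun ⟨⟨A, hA⟩, h⟩ => by rw [h]; exact hA⟩

theorem meas_TS_top {m d : ℕ} (h : d ≤ m) :
    mm p m d (TS m (⊤ : Submodule ℤ_[p] (Fin d → ℤ_[p]))) =
      ((∏ i : Fin d, (p ^ m - p ^ i.val) : ℕ) : ℝ≥0∞) * nn (1 / p) ^ (m * d) := by
  rw [TS_top_eq, measure_iUnion]
  · simp only [(meas_redm _).2]
    rw [tsum_fintype, Finset.sum_const, nsmul_eq_mul]
    congr 2
    have h1 := card_linearIndependent (K := ZMod p) (V := Fin m → ZMod p) (k := d) (by simpa using h)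
    rw [ZMod.card, Module.finrank_fin_fun] at h1
    rw [← h1, Finset.card_univ, ← Nat.card_eq_fintype_card]
    have key : ∀ A : Fin m → Fin d → ZMod p, Submodule.span (ZMod p) (Set.range A) = ⊤ ↔
        LinearIndependent (ZMod p) (fun j i => A i j) := by
      intro A
      have e1 := Matrix.rank_eq_finrank_span_row (Matrix.of A)
      have e2 := Matrix.rank_eq_finrank_span_cols (Matrix.of A)
      have e3 : Set.finrank (ZMod p) (Set.range (fun j i => A i j)) =
        Module.finrank (ZMod p) (Submodule.span (ZMod p) (Set.range A)) := e2.symm.trans e1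
      rw [linearIndependent_iff_card_eq_finrank_span, e3, Fintype.card_fin]
      constructor
      · intro h; rw [h]; simp
      · intro h
        apply Submodule.eq_top_of_finrank_eq
        rw [← h]; simp
    exact Nat.card_congr ⟨fun A => ⟨fun j i => A.1 i j, (key A.1).mp A.2⟩,
      fun A => ⟨fun j i => A.1 i j, (key _).mpr A.2⟩, fun A => rfl, fun A => rfl⟩
  · intro A B hAB
    rw [Function.onFun, Set.disjoint_left]
    intro x hx hx'
    exact hAB (Subtype.ext (hx.symm.trans hx'))
  · exact fun A => (meas_redm _).1

theorem measurable_TS {m d : ℕ} (H : Submodule ℤ_[p] (Fin d → ℤ_[p])) (hH : idx H ≠ 0) :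
    MeasurableSet (TS m H) := by
  obtain ⟨A, hA, rfl⟩ := exists_mat H hH
  rw [TS_eq A hA]
  refine (((amap_cont m A).isClosedEmbedding (amap_inj m A hA)).measurableEmbedding).measurableSet_image.mpr ?_
  rw [TS_top_eq]
  exact MeasurableSet.iUnion fun A => (meas_redm _).1

end LatMeas

open scoped ENNReal NNReal

section LatSum
set_option linter.unusedSectionVars false
set_option linter.unusedVariables false
open MeasureTheory

variable {p : ℕ} [hp : Fact p.Prime]

variable (p) in
/-- finite index submodules -/
abbrev PLat (d : ℕ) : Type := {H : Submodule ℤ_[p] (Fin d → ℤ_[p]) // idx H ≠ 0}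

/-- log of the index -/
noncomputable def lind {d : ℕ} (H : Submodule ℤ_[p] (Fin d → ℤ_[p])) : ℕ := Nat.log p (idx H)

theorem lind_RS {d : ℕ} (A : Fin d → Fin d → ℤ_[p]) (hA : (Matrix.of A).det ≠ 0) :
    lind (RS A) = (Matrix.of A).det.valuation := by
  rw [lind, idx_RS A hA, Nat.log_pow hp.out.one_lt]

theorem idx_ne {d : ℕ} (A : Fin d → Fin d → ℤ_[p]) (hA : (Matrix.of A).det ≠ 0) :
    idx (RS A) ≠ 0 := by
  rw [idx_RS A hA]; exact pow_ne_zero _ hp.out.ne_zero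

theorem idx_eq {d : ℕ} (H : Submodule ℤ_[p] (Fin d → ℤ_[p])) (h : idx H ≠ 0) :
    idx H = p ^ lind H := by
  obtain ⟨A, hA, rfl⟩ := exists_mat H h
  rw [lind_RS A hA, idx_RS A hA]

/-- determinant polynomial of the first d rows -/
noncomputable def detP {m d : ℕ} (h : d ≤ m) : MvPolynomial (Fin (m * d)) ℤ :=
  Matrix.det (Matrix.of fun i j => MvPolynomial.X (finProdFinEquiv (Fin.castLE h i, j)))

theorem ev_X {n : ℕ} (x : Fin n → ℤ_[p]) (i : Fin n) : ev x (MvPolynomial.X i) = x i := by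
  simp [ev]

theorem ev_detP {m d : ℕ} (h : d ≤ m) (x : Fin (m * d) → ℤ_[p]) :
    ev x (detP h) = Matrix.det (Matrix.of fun i j => resh x (Fin.castLE h i) j) := by
  unfold detP
  rw [RingHom.map_det]
  congr 1
  ext i j
  simp [ev_X, resh]

theorem detP_ne {m d : ℕ} (h : d ≤ m) : detP h ≠ 0 := by
  intro h0
  have h1 := congrArg (MvPolynomial.eval (fun k : Fin (m * d) =>
    if (finProdFinEquiv.symm k).1.val = (finProdFinEquiv.symm k).2.val then (1 : ℤ) else 0)) h0
  rw [detP, RingHom.map_det, map_zero] at h1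
  have h2 : (MvPolynomial.eval (fun k : Fin (m * d) =>
    if (finProdFinEquiv.symm k).1.val = (finProdFinEquiv.symm k).2.val then (1 : ℤ) else 0)).mapMatrix
    (Matrix.of fun i j => MvPolynomial.X (finProdFinEquiv (Fin.castLE h i, j))) =
    (1 : Matrix (Fin d) (Fin d) ℤ) := by
    ext i j
    rw [RingHom.mapMatrix_apply, Matrix.map_apply, Matrix.of_apply, MvPolynomial.eval_X,
      Equiv.symm_apply_apply, Matrix.one_apply]
    simp [Fin.ext_iff]
  rw [h2, Matrix.det_one] at h1
  exact one_ne_zero h1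

theorem ae_resh {m d : ℕ} {P : (Fin m → Fin d → ℤ_[p]) → Prop}
    (h : ∀ᵐ x ∂(pmeasN p (m * d)), P (resh x)) : ∀ᵐ x ∂(mm p m d), P x := by
  have h1 := resh_mp (p := p) m d
  let e : (Fin (m * d) → ℤ_[p]) ≃ᵐ (Fin m → Fin d → ℤ_[p]) :=
    { toFun := resh
      invFun := fun y k => y (finProdFinEquiv.symm k).1 (finProdFinEquiv.symm k).2
      left_inv := fun x => by
        funext k
        exact congrArg x (finProdFinEquiv.apply_symm_apply k)
      right_inv := fun y => by
        funext i j
        simp [resh]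
      measurable_toFun := h1.measurable
      measurable_invFun := by
        change Measurable fun (y : Fin m → Fin d → ℤ_[p]) (k : Fin (m * d)) =>
          y (finProdFinEquiv.symm k).1 (finProdFinEquiv.symm k).2
        rw [measurable_pi_iff]
        intro k
        exact (measurable_pi_apply _).comp (measurable_pi_apply _) }
  have h2 : MeasurePreserving e (pmeasN p (m * d)) (mm p m d) := h1
  rw [← h2.map_eq, e.measurableEmbedding.ae_map_iff]
  exact h

theorem ae_idx {m d : ℕ} (h : d ≤ m) : ∀ᵐ x ∂(mm p m d), idx (RS x) ≠ 0 := by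
  refine ae_resh ?_
  filter_upwards [ae_ev_ne (p := p) (detP h) (detP_ne h)] with x hx
  rw [ev_detP] at hx
  have h1 := idx_ne _ hx
  have h2 : RS (fun i j => resh x (Fin.castLE h i) j) ≤ RS (resh x) := by
    refine Submodule.span_mono ?_
    rintro _ ⟨i, rfl⟩
    exact ⟨Fin.castLE h i, rfl⟩
  intro h3
  have h4 := AddSubgroup.index_dvd_of_le (H := (RS (fun i j => resh x (Fin.castLE h i) j)).toAddSubgroup)
    (K := (RS (resh x)).toAddSubgroup) h2
  have h5 : (RS (resh x)).toAddSubgroup.index = 0 := h3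
  rw [h5, zero_dvd_iff] at h4
  exact h1 h4

theorem gm_ne {m d : ℕ} (h : d ≤ m) :
    mm p m d (TS m (⊤ : Submodule ℤ_[p] (Fin d → ℤ_[p]))) ≠ 0 := by
  rw [meas_TS_top h]
  refine mul_ne_zero ?_ (pow_ne_zero _ (nn_ne_zero ?_))
  · rw [Nat.cast_ne_zero, Finset.prod_ne_zero_iff]
    intro i _
    have : p ^ i.val < p ^ m := Nat.pow_lt_pow_right hp.out.one_lt (by omega)
    omega
  · rw [one_div]; exact inv_ne_zero (by exact_mod_cast hp.out.ne_zero)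

theorem meas_TS' {m d : ℕ} (H : PLat p d) :
    mm p m d (TS m H.1) = nn (1 / p) ^ (m * lind H.1) * mm p m d (TS m ⊤) := by
  obtain ⟨H, hH⟩ := H
  obtain ⟨A, hA, rfl⟩ := exists_mat H hH
  rw [meas_TS A hA, lind_RS A hA]

theorem nnp_ne : nn (1 / (p : ℚ≥0)) ≠ 0 := by
  refine nn_ne_zero ?_
  rw [one_div]; exact inv_ne_zero (by exact_mod_cast hp.out.ne_zero)

theorem TS_disj {m d : ℕ} : Pairwise (Function.onFun Disjoint fun H : PLat p d => TS m H.1) := by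
  intro H K hHK
  rw [Function.onFun, Set.disjoint_left]
  intro x hx hx'
  exact hHK (Subtype.ext (hx.symm.trans hx'))

instance lat_countable (d : ℕ) : Countable (PLat p d) := by
  have h := Measure.countable_meas_pos_of_disjoint_iUnion (μ := mm p d d)
    (As := fun H : PLat p d => TS d H.1) (fun H => measurable_TS H.1 H.2) TS_disj
  have h1 : {i : PLat p d | 0 < mm p d d (TS d i.1)} = Set.univ := by
    ext H
    simp only [Set.mem_ofPred_eq, Set.mem_univ, iff_true]
    rw [meas_TS', pos_iff_ne_zero]
    exact mul_ne_zero (pow_ne_zero _ nnp_ne) (gm_ne le_rfl)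
  rw [h1] at h
  exact Set.countable_univ_iff.mp h

theorem lintegral_lat {m d : ℕ} (h : d ≤ m) (Φ : Submodule ℤ_[p] (Fin d → ℤ_[p]) → ℝ≥0∞) :
    ∫⁻ x, Φ (RS x) ∂(mm p m d) =
      mm p m d (TS m ⊤) * ∑' H : PLat p d, nn (1 / p) ^ (m * lind H.1) * Φ H.1 := by
  have h1 : ∫⁻ x, Φ (RS x) ∂(mm p m d) = ∫⁻ x in ⋃ H : PLat p d, TS m H.1, Φ (RS x) ∂(mm p m d) := by
    rw [Measure.restrict_eq_self_of_ae_mem]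
    filter_upwards [ae_idx (p := p) h] with x hx
    exact Set.mem_iUnion.mpr ⟨⟨RS x, hx⟩, rfl⟩
  rw [h1, lintegral_iUnion (s := fun H : PLat p d => TS m H.1)
    (fun H => measurable_TS H.1 H.2) TS_disj, ← ENNReal.tsum_mul_left]
  refine tsum_congr fun H => ?_
  have h2 : ∫⁻ x in TS m H.1, Φ (RS x) ∂(mm p m d) = ∫⁻ x in TS m H.1, Φ H.1 ∂(mm p m d) :=
    setLIntegral_congr_fun (measurable_TS H.1 H.2) (fun x hx => by
      have hx' : RS x = H.1 := hx
      beta_reduce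
      rw [hx'])
  rw [h2, setLIntegral_const, meas_TS']
  ring

theorem sum_lat {d : ℕ} (Φ : Submodule ℤ_[p] (Fin d → ℤ_[p]) → ℝ≥0∞) :
    ∑' H : PLat p d, Φ H.1 = (mm p d d (TS d ⊤))⁻¹ *
      ∫⁻ x, nn p ^ (d * lind (RS x)) * Φ (RS x) ∂(mm p d d) := by
  rw [lintegral_lat le_rfl (fun H => nn p ^ (d * lind H) * Φ H), ← mul_assoc,
    ENNReal.inv_mul_cancel (gm_ne le_rfl) (measure_ne_top _ _), one_mul]
  refine tsum_congr fun H => ?_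
  rw [← mul_assoc, ← mul_pow]
  have : nn (1 / (p : ℚ≥0)) * nn p = 1 := by
    rw [← nn_mul, one_div, inv_mul_cancel₀ (by exact_mod_cast hp.out.ne_zero), nn_one]
  rw [this, one_pow, one_mul]

/-- values of the zeta function of the additive group at p ^ (-m) -/
theorem zeta0_val {m d : ℕ} (h : d ≤ m) :
    ((∏ i : Fin d, (p ^ m - p ^ i.val) : ℕ) : ℝ≥0∞) * nn (1 / p) ^ (m * d) *
      ∑' H : PLat p d, (nn (1 / p) ^ m) ^ lind H.1 = 1 := by
  have h1 := lintegral_lat (p := p) h (fun _ => 1)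
  rw [lintegral_one, measure_univ, meas_TS_top h] at h1
  rw [h1]
  congr 1
  refine tsum_congr fun H => ?_
  rw [mul_one, pow_mul]

end LatSum

open scoped ENNReal NNReal

section LatMul
set_option linter.unusedSectionVars false
set_option linter.unusedVariables false

variable {p : ℕ} [hp : Fact p.Prime] {d : ℕ}

/-- bilinear multiplication with given structure constants -/
noncomputable def bm (c : Fin d → Fin d → Fin d → ℤ) :
    (Fin d → ℤ_[p]) →ₗ[ℤ_[p]] (Fin d → ℤ_[p]) →ₗ[ℤ_[p]] (Fin d → ℤ_[p]) :=
  LinearMap.mk₂ ℤ_[p] (fun x y k => ∑ i, ∑ j, x i * y j * (c i j k : ℤ_[p]))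
    (fun x x' y => by
      funext k
      simp only [Pi.add_apply, ← Finset.sum_add_distrib]
      exact Finset.sum_congr rfl fun i _ => Finset.sum_congr rfl fun j _ => by ring)
    (fun a x y => by
      funext k
      simp only [Pi.smul_apply, smul_eq_mul, Finset.mul_sum]
      exact Finset.sum_congr rfl fun i _ => Finset.sum_congr rfl fun j _ => by ring)
    (fun x y y' => by
      funext k
      simp only [Pi.add_apply, ← Finset.sum_add_distrib]
      exact Finset.sum_congr rfl fun i _ => Finset.sum_congr rfl fun j _ => by ring)
    (fun a x y => by
      funext k
      simp only [Pi.smul_apply, smul_eq_mul, Finset.mul_sum]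
      exact Finset.sum_congr rfl fun i _ => Finset.sum_congr rfl fun j _ => by ring)

theorem bm_apply (c : Fin d → Fin d → Fin d → ℤ) (x y : Fin d → ℤ_[p]) (k : Fin d) :
    bm c x y k = ∑ i, ∑ j, x i * y j * (c i j k : ℤ_[p]) := rfl

/-- scaling by a power of p -/
noncomputable def sc (r : ℕ) (H : Submodule ℤ_[p] (Fin d → ℤ_[p])) :
    Submodule ℤ_[p] (Fin d → ℤ_[p]) :=
  H.map (((p : ℤ_[p]) ^ r) • (LinearMap.id : (Fin d → ℤ_[p]) →ₗ[ℤ_[p]] (Fin d → ℤ_[p])))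

theorem mem_sc {r : ℕ} {H : Submodule ℤ_[p] (Fin d → ℤ_[p])} {b : Fin d → ℤ_[p]} :
    b ∈ sc r H ↔ ∃ h ∈ H, ((p : ℤ_[p]) ^ r) • h = b := by
  simp [sc, Submodule.mem_map]

theorem psmul_inj (r : ℕ) {x y : Fin d → ℤ_[p]}
    (h : ((p : ℤ_[p]) ^ r) • x = ((p : ℤ_[p]) ^ r) • y) : x = y :=
  smul_right_injective _ (pp_ne r) h

theorem psmul_mem_sc {r : ℕ} {H : Submodule ℤ_[p] (Fin d → ℤ_[p])} {b : Fin d → ℤ_[p]} :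
    ((p : ℤ_[p]) ^ r) • b ∈ sc r H ↔ b ∈ H := by
  rw [mem_sc]
  exact ⟨fun ⟨h, hh, e⟩ => psmul_inj r e ▸ hh, fun h => ⟨b, h, rfl⟩⟩

theorem sc_sc (r s : ℕ) (H : Submodule ℤ_[p] (Fin d → ℤ_[p])) : sc r (sc s H) = sc (r + s) H := by
  ext b
  rw [mem_sc, mem_sc]
  constructor
  · rintro ⟨h, hh, rfl⟩
    obtain ⟨h', hh', rfl⟩ := mem_sc.mp hh
    exact ⟨h', hh', by rw [smul_smul, pow_add]⟩
  · rintro ⟨h, hh, rfl⟩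
    exact ⟨_, mem_sc.mpr ⟨h, hh, rfl⟩, by rw [smul_smul, pow_add]⟩

theorem sc_zero (H : Submodule ℤ_[p] (Fin d → ℤ_[p])) : sc 0 H = H := by
  ext b; rw [mem_sc]; simp

theorem sc_inj {r : ℕ} {H K : Submodule ℤ_[p] (Fin d → ℤ_[p])} (h : sc r H = sc r K) : H = K := by
  ext b
  rw [← psmul_mem_sc (r := r), h, psmul_mem_sc]

theorem sc_le (r : ℕ) (H : Submodule ℤ_[p] (Fin d → ℤ_[p])) : sc r H ≤ H := by
  intro b hb
  obtain ⟨h, hh, rfl⟩ := mem_sc.mp hb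
  exact H.smul_mem _ hh

theorem sc_mono {r : ℕ} {H K : Submodule ℤ_[p] (Fin d → ℤ_[p])} (h : H ≤ K) : sc r H ≤ sc r K :=
  Submodule.map_mono h

theorem idx_sc (r : ℕ) (H : Submodule ℤ_[p] (Fin d → ℤ_[p])) :
    idx (sc r H) = idx H * p ^ (d * r) := by
  let f : (Fin d → ℤ_[p]) →ₗ[ℤ_[p]] (Fin d → ℤ_[p]) := ((p : ℤ_[p]) ^ r) • LinearMap.id
  have h1 : (sc r H).toAddSubgroup = H.toAddSubgroup.map f.toAddMonoidHom := by
    ext b; exact Iff.rfl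
  have h2 : Function.Injective f.toAddMonoidHom := fun x y h => psmul_inj r h
  rw [idx, h1, AddSubgroup.index_map_of_injective _ h2]
  congr 1
  let A : Fin d → Fin d → ℤ_[p] := fun i j => if i = j then (p : ℤ_[p]) ^ r else 0
  have hA : Matrix.of A = Matrix.diagonal (fun _ => (p : ℤ_[p]) ^ r) := by
    ext i j; simp [A, Matrix.diagonal_apply]
  have hdet : (Matrix.of A).det = (p : ℤ_[p]) ^ (d * r) := by
    rw [hA, Matrix.det_diagonal]
    simp [← pow_mul, mul_comm]
  have h3 := idx_RS A (by rw [hdet]; exact pp_ne _)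
  rw [hdet, PadicInt.valuation_pow, PadicInt.valuation_p, mul_one] at h3
  rw [← h3, idx]
  congr 1
  ext b
  rw [RS_eq_range A, hA]
  have h4 : ∀ x : Fin d → ℤ_[p], Matrix.vecMulLinear (Matrix.diagonal fun _ => (p : ℤ_[p]) ^ r) x = f x := by
    intro x
    funext j
    simp only [Matrix.vecMulLinear_apply, Matrix.vecMul_diagonal, f, LinearMap.smul_apply,
      LinearMap.id_apply, Pi.smul_apply, smul_eq_mul, mul_comm]
  constructor
  · rintro ⟨x, rfl⟩; exact ⟨x, h4 x⟩
  · rintro ⟨x, rfl⟩; exact ⟨x, (h4 x).symm⟩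

theorem idx_sc_ne {r : ℕ} {H : Submodule ℤ_[p] (Fin d → ℤ_[p])} : idx (sc r H) ≠ 0 ↔ idx H ≠ 0 := by
  rw [idx_sc]
  simp [hp.out.ne_zero]

theorem lind_sc (r : ℕ) {H : Submodule ℤ_[p] (Fin d → ℤ_[p])} (hH : idx H ≠ 0) :
    lind (sc r H) = lind H + d * r := by
  rw [lind, idx_sc, idx_eq H hH, ← pow_add, Nat.log_pow hp.out.one_lt]

variable (c : Fin d → Fin d → Fin d → ℤ)

/-- closed under p ^ m times multiplication -/
def Cl (m : ℕ) (H : Submodule ℤ_[p] (Fin d → ℤ_[p])) : Prop :=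
  ∀ x ∈ H, ∀ y ∈ H, ((p : ℤ_[p]) ^ m) • bm c x y ∈ H

variable {c}

theorem Cl.mono {m n : ℕ} {H : Submodule ℤ_[p] (Fin d → ℤ_[p])} (h : Cl c m H) (hmn : m ≤ n) :
    Cl c n H := by
  intro x hx y hy
  obtain ⟨k, rfl⟩ := Nat.exists_eq_add_of_le hmn
  rw [add_comm, pow_add, mul_smul]
  exact H.smul_mem _ (h x hx y hy)

theorem cl_sc {m r : ℕ} {H : Submodule ℤ_[p] (Fin d → ℤ_[p])} :
    Cl c m (sc r H) ↔ Cl c (m + r) H := by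
  have key : ∀ x y : Fin d → ℤ_[p], ((p : ℤ_[p]) ^ m) • bm c (((p : ℤ_[p]) ^ r) • x) (((p : ℤ_[p]) ^ r) • y) =
      ((p : ℤ_[p]) ^ r) • (((p : ℤ_[p]) ^ (m + r)) • bm c x y) := by
    intro x y
    simp only [map_smul, LinearMap.smul_apply, smul_smul]
    congr 1; ring
  constructor
  · intro h x hx y hy
    have := h _ (psmul_mem_sc.mpr hx) _ (psmul_mem_sc.mpr hy)
    rwa [key, psmul_mem_sc] at this
  · intro h x hx y hy
    obtain ⟨x', hx', rfl⟩ := mem_sc.mp hx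
    obtain ⟨y', hy', rfl⟩ := mem_sc.mp hy
    rw [key, psmul_mem_sc]
    exact h x' hx' y' hy'

variable (c)

/-- all divisors are closed -/
def Good (m : ℕ) (H : Submodule ℤ_[p] (Fin d → ℤ_[p])) : Prop :=
  ∀ r K, sc r K = H → Cl c m K

/-- the invariant m0 -/
noncomputable def m0 (H : Submodule ℤ_[p] (Fin d → ℤ_[p])) : ℕ := sInf {m | Good c m H}

variable {c}

theorem Good.mono {m n : ℕ} {H : Submodule ℤ_[p] (Fin d → ℤ_[p])} (h : Good c m H) (hmn : m ≤ n) :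
    Good c n H := fun r K hK => (h r K hK).mono hmn

theorem Good.cl {m : ℕ} {H : Submodule ℤ_[p] (Fin d → ℤ_[p])} (h : Good c m H) : Cl c m H :=
  h 0 H (sc_zero H)

theorem good_sc {m s : ℕ} {H : Submodule ℤ_[p] (Fin d → ℤ_[p])} :
    Good c m (sc s H) ↔ Good c m H := by
  constructor
  · intro h r K hK
    exact h (s + r) K (by rw [← sc_sc, hK])
  · intro h r K hK
    rcases le_total s r with hsr | hsr
    · obtain ⟨k, rfl⟩ := Nat.exists_eq_add_of_le hsr
      rw [← sc_sc] at hK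
      exact h k K (sc_inj hK)
    · obtain ⟨k, rfl⟩ := Nat.exists_eq_add_of_le hsr
      rw [← sc_sc] at hK
      rw [sc_inj hK, cl_sc]
      exact h.cl.mono (by omega)

theorem m0_sc (s : ℕ) (H : Submodule ℤ_[p] (Fin d → ℤ_[p])) : m0 c (sc s H) = m0 c H := by
  unfold m0; simp only [good_sc]

theorem pow_lind_mem {H : Submodule ℤ_[p] (Fin d → ℤ_[p])} (hH : idx H ≠ 0) (b : Fin d → ℤ_[p]) :
    ((p : ℤ_[p]) ^ lind H) • b ∈ H := by
  have h := H.toAddSubgroup.nsmul_index_mem b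
  have h1 : H.toAddSubgroup.index = p ^ lind H := idx_eq H hH
  rw [h1, ← Nat.cast_smul_eq_nsmul ℤ_[p], Nat.cast_pow] at h
  exact h

theorem good_lind {H : Submodule ℤ_[p] (Fin d → ℤ_[p])} (hH : idx H ≠ 0) : Good c (lind H) H := by
  rintro r K rfl x hx y hy
  exact sc_le r K (pow_lind_mem hH _)

theorem m0_le_iff {H : Submodule ℤ_[p] (Fin d → ℤ_[p])} (hH : idx H ≠ 0) {m : ℕ} :
    m0 c H ≤ m ↔ Good c m H := by
  constructor
  · intro h
    have h1 : Good c (m0 c H) H := Nat.sInf_mem (s := {m | Good c m H}) ⟨_, good_lind hH⟩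
    exact h1.mono h
  · exact fun h => Nat.sInf_le h

theorem m0_le_lind {H : Submodule ℤ_[p] (Fin d → ℤ_[p])} (hH : idx H ≠ 0) : m0 c H ≤ lind H :=
  (m0_le_iff hH).mpr (good_lind hH)

theorem exists_prim {H : Submodule ℤ_[p] (Fin d → ℤ_[p])} (hH : idx H ≠ 0) :
    ∃ e K, sc e K = H ∧ ∀ m, Cl c m K → Good c m K := by
  classical
  have hex : ∃ n e K, sc e K = H ∧ idx K = n := ⟨_, 0, H, sc_zero H, rfl⟩
  obtain ⟨e, K, hK, hn⟩ := Nat.find_spec hex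
  refine ⟨e, K, hK, fun m hm r K' hK' => ?_⟩
  have h0 : idx K ≠ 0 := by rw [← hK] at hH; exact idx_sc_ne.mp hH
  have h1 : Nat.find hex ≤ idx K' := Nat.find_le ⟨e + r, K', by rw [← sc_sc, hK', hK], rfl⟩
  rw [← hn, ← hK', idx_sc] at h1
  have h2 : K ≤ K' := hK' ▸ sc_le r K'
  have h3 : idx K = idx K' := by
    refine le_antisymm ?_ ?_
    · rw [← hK', idx_sc]; exact h1
    · exact Nat.le_of_dvd (Nat.pos_of_ne_zero h0) (AddSubgroup.index_dvd_of_le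
        (H := K.toAddSubgroup) (K := K'.toAddSubgroup) h2)
  have h4 : K.toAddSubgroup = K'.toAddSubgroup := by
    have h6 := AddSubgroup.relIndex_mul_index (H := K.toAddSubgroup) (K := K'.toAddSubgroup) h2
    have h7 : K.toAddSubgroup.index = K'.toAddSubgroup.index := h3
    have h8 : K.toAddSubgroup.index ≠ 0 := h0
    rw [← h7] at h6
    have h9 : K.toAddSubgroup.relIndex K'.toAddSubgroup = 1 :=
      Nat.eq_of_mul_eq_mul_right (Nat.pos_of_ne_zero h8) (by rw [h6, one_mul])
    exact le_antisymm h2 (AddSubgroup.relIndex_eq_one.mp h9)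
  have h5 : K = K' := by
    ext b
    have : b ∈ K.toAddSubgroup ↔ b ∈ K'.toAddSubgroup := by rw [h4]
    exact this
  rw [← h5]; exact hm

/-- lattices to subrings -/
noncomputable def toSub (c : Fin d → Fin d → Fin d → ℤ) (H : PLat p d) : {H : PLat p d // Cl c 0 H.1} :=
  ⟨⟨sc (m0 c H.1) H.1, idx_sc_ne.mpr H.2⟩, by
    rw [cl_sc, zero_add]
    exact ((m0_le_iff H.2).mp le_rfl).cl⟩

theorem toSub_bij : Function.Bijective (toSub (p := p) c) := by
  constructor
  · intro H K hHK
    have h : sc (m0 c H.1) H.1 = sc (m0 c K.1) K.1 := congrArg (fun S => S.1.1) hHK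
    have h1 : m0 c H.1 = m0 c K.1 := by
      have := congrArg (m0 c) h
      rwa [m0_sc, m0_sc] at this
    rw [h1] at h
    exact Subtype.ext (sc_inj h)
  · rintro ⟨⟨H, hH⟩, hcl⟩
    obtain ⟨e, K, rfl, hK⟩ := exists_prim (c := c) hH
    have hK0 : idx K ≠ 0 := idx_sc_ne.mp hH
    have h1 : m0 c K ≤ e := by
      rw [m0_le_iff hK0]
      refine hK _ ?_
      have h2 : Cl c 0 (sc e K) := hcl
      rwa [cl_sc, zero_add] at h2
    refine ⟨⟨sc (e - m0 c K) K, idx_sc_ne.mpr hK0⟩, ?_⟩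
    apply Subtype.ext
    apply Subtype.ext
    change sc (m0 c (sc (e - m0 c K) K)) (sc (e - m0 c K) K) = sc e K
    rw [m0_sc, sc_sc, Nat.add_sub_cancel' h1]

theorem sum_sub (ψ : ℕ → ℝ≥0∞) :
    ∑' H : {H : PLat p d // Cl c 0 H.1}, ψ (lind H.1.1) =
      ∑' H : PLat p d, ψ (lind H.1 + d * m0 c H.1) := by
  rw [← (Equiv.ofBijective _ (toSub_bij (p := p) (c := c))).tsum_eq]
  refine tsum_congr fun H => ?_
  congr 1
  exact lind_sc _ H.2

theorem sum_shift (χ : ℕ → ℕ → ℝ≥0∞) [∀ H : Submodule ℤ_[p] (Fin d → ℤ_[p]), Decidable (H ≤ sc 1 ⊤)] :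
    ∑' H : PLat p d, χ (lind H.1 + d) (m0 c H.1) =
      ∑' H : PLat p d, if H.1 ≤ sc 1 ⊤ then χ (lind H.1) (m0 c H.1) else 0 := by
  let f : PLat p d → PLat p d := fun H => ⟨sc 1 H.1, idx_sc_ne.mpr H.2⟩
  have hf : Function.Injective f := fun H K h =>
    Subtype.ext (sc_inj (congrArg Subtype.val h))
  have h1 := hf.tsum_eq (f := fun H : PLat p d =>
    if H.1 ≤ sc 1 ⊤ then χ (lind H.1) (m0 c H.1) else 0) (by
      rintro ⟨H, hH⟩ h
      rw [Function.mem_support] at h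
      have h2 : H ≤ sc 1 ⊤ := by
        by_contra hc
        exact h (if_neg hc)
      have h3 : sc 1 (H.comap (((p : ℤ_[p]) ^ 1) • LinearMap.id)) = H := by
        ext b
        rw [mem_sc]
        constructor
        · rintro ⟨h, hh, rfl⟩; exact hh
        · intro hb
          obtain ⟨x, -, rfl⟩ := mem_sc.mp (h2 hb)
          exact ⟨x, hb, rfl⟩
      refine ⟨⟨H.comap (((p : ℤ_[p]) ^ 1) • LinearMap.id), ?_⟩, Subtype.ext h3⟩
      rw [← idx_sc_ne (r := 1), h3]; exact hH)
  rw [← h1]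
  refine tsum_congr fun H => ?_
  change _ = if sc 1 H.1 ≤ sc 1 ⊤ then χ (lind (sc 1 H.1)) (m0 c (sc 1 H.1)) else 0
  rw [if_pos (sc_mono le_top), m0_sc, lind_sc 1 H.2, mul_one]

end LatMul

open scoped ENNReal NNReal

section MatFormula
set_option linter.unusedSectionVars false
set_option linter.unusedVariables false

variable {p : ℕ} [hp : Fact p.Prime] {d : ℕ}

theorem RS_mem (M : Fin d → Fin d → ℤ_[p]) (i : Fin d) : M i ∈ RS M :=
  Submodule.subset_span ⟨i, rfl⟩

theorem RS_le_sc {r : ℕ} (M : Fin d → Fin d → ℤ_[p]) :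
    RS M ≤ sc r ⊤ ↔ ∀ i j, (p : ℤ_[p]) ^ r ∣ M i j := by
  constructor
  · intro h i j
    obtain ⟨x, -, hx⟩ := mem_sc.mp (h (RS_mem M i))
    exact ⟨x j, by rw [← hx]; rfl⟩
  · intro h
    refine Submodule.span_le.mpr ?_
    rintro _ ⟨i, rfl⟩
    choose x hx using h
    refine mem_sc.mpr ⟨x i, trivial, ?_⟩
    funext j
    rw [hx i j]; rfl

theorem sc_RS (e : ℕ) (M : Fin d → Fin d → ℤ_[p]) :
    sc e (RS M) = RS (fun i j => (p : ℤ_[p]) ^ e * M i j) := by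
  unfold sc RS
  rw [Submodule.map_span, ← Set.range_comp]
  rfl

theorem mem_sc_RS {e : ℕ} (M : Fin d → Fin d → ℤ_[p]) (hM : (Matrix.of M).det ≠ 0) (b : Fin d → ℤ_[p]) :
    b ∈ sc e (RS M) ↔ ∀ k, (p : ℤ_[p]) ^ e * (Matrix.of M).det ∣
      Matrix.vecMul b (Matrix.of M).adjugate k := by
  rw [mem_sc]
  constructor
  · rintro ⟨h, hh, rfl⟩ k
    rw [RS_eq_range] at hh
    obtain ⟨y, rfl⟩ := hh
    rw [Matrix.vecMulLinear_apply, Matrix.smul_vecMul, Matrix.vecMul_vecMul, Matrix.mul_adjugate,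
      Matrix.vecMul_smul, Matrix.vecMul_one]
    exact ⟨y k, by simp only [Pi.smul_apply, smul_eq_mul]; ring⟩
  · intro h
    choose y hy using h
    refine ⟨Matrix.vecMul y (Matrix.of M), by rw [RS_eq_range]; exact ⟨y, rfl⟩, ?_⟩
    have h1 : Matrix.vecMul b (Matrix.of M).adjugate = ((p : ℤ_[p]) ^ e * (Matrix.of M).det) • y := by
      funext k; rw [hy k]; rfl
    have h2 := congrArg (fun v => Matrix.vecMul v (Matrix.of M)) h1
    simp only [Matrix.vecMul_vecMul, Matrix.adjugate_mul, Matrix.vecMul_smul, Matrix.vecMul_one,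
      Matrix.smul_vecMul] at h2
    refine smul_right_injective _ hM ?_
    beta_reduce
    rw [h2, smul_smul, mul_comm]

theorem Cl_RS {c : Fin d → Fin d → Fin d → ℤ} {m : ℕ} (M : Fin d → Fin d → ℤ_[p]) :
    Cl c m (RS M) ↔ ∀ i j, ((p : ℤ_[p]) ^ m) • bm c (M i) (M j) ∈ RS M := by
  constructor
  · intro h i j; exact h _ (RS_mem M i) _ (RS_mem M j)
  · intro h x hx y hy
    have h1 : ∀ i, ((p : ℤ_[p]) ^ m) • bm c (M i) y ∈ RS M := by
      intro i
      have : RS M ≤ (RS M).comap (((p : ℤ_[p]) ^ m) • bm c (M i)) := by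
        refine Submodule.span_le.mpr ?_
        rintro _ ⟨j, rfl⟩
        exact h i j
      exact this hy
    have : RS M ≤ (RS M).comap (((p : ℤ_[p]) ^ m) • (bm c).flip y) := by
      refine Submodule.span_le.mpr ?_
      rintro _ ⟨i, rfl⟩
      exact h1 i
    exact this hx

theorem m0_matrix (c : Fin d → Fin d → Fin d → ℤ) {e m : ℕ} (M : Fin d → Fin d → ℤ_[p])
    (hM : (Matrix.of M).det ≠ 0) (he : ∀ i j, (p : ℤ_[p]) ^ e ∣ M i j)
    (he' : ∃ i j, ¬ (p : ℤ_[p]) ^ (e + 1) ∣ M i j) :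
    m0 c (RS M) ≤ m ↔ ∀ i j k, (p : ℤ_[p]) ^ e * (Matrix.of M).det ∣
      (p : ℤ_[p]) ^ m * Matrix.vecMul (bm c (M i) (M j)) (Matrix.of M).adjugate k := by
  choose M0 hM0 using he
  have hMM : M = fun i j => (p : ℤ_[p]) ^ e * M0 i j := by funext i j; exact hM0 i j
  have hH : RS M = sc e (RS M0) := by rw [sc_RS, ← hMM]
  have hid : idx (RS M0) ≠ 0 := by
    have := idx_ne M hM
    rw [hH] at this
    exact idx_sc_ne.mp this
  have h1 : m0 c (RS M) ≤ m ↔ Cl c m (RS M0) := by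
    rw [hH, m0_sc, m0_le_iff hid]
    constructor
    · exact Good.cl
    · intro h r K hK
      rcases Nat.eq_zero_or_pos r with rfl | hr
      · rw [sc_zero] at hK; rw [hK]; exact h
      · exfalso
        obtain ⟨i, j, hij⟩ := he'
        have h2 : RS M0 ≤ sc 1 ⊤ := by
          obtain ⟨s, rfl⟩ := Nat.exists_eq_add_of_le hr
          rw [← hK, ← sc_sc]
          exact sc_mono le_top
        have h3 := (RS_le_sc M0).mp h2 i j
        apply hij
        rw [hM0 i j, pow_add]
        exact mul_dvd_mul_left _ h3
  rw [h1, Cl_RS]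
  refine forall_congr' fun i => forall_congr' fun j => ?_
  have h4 : ((p : ℤ_[p]) ^ m) • bm c (M i) (M j) =
      ((p : ℤ_[p]) ^ (e + e)) • (((p : ℤ_[p]) ^ m) • bm c (M0 i) (M0 j)) := by
    have h5 : ∀ i, M i = ((p : ℤ_[p]) ^ e) • M0 i := by intro i; rw [hMM]; rfl
    rw [h5 i, h5 j]
    simp only [map_smul, LinearMap.smul_apply, smul_smul]
    congr 1; ring
  rw [← psmul_mem_sc (r := e + e), ← h4, ← sc_sc, ← hH, mem_sc_RS M hM]
  refine forall_congr' fun k => ?_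
  rw [Matrix.smul_vecMul]; rfl

end MatFormula

open scoped ENNReal NNReal

section FinMin
variable {X κ Lab : Type} [Fintype κ] {δ : X → (κ → ℚ) × Lab} [Finite Lab]

theorem PL.finmin {J : Type} [Finite J] {g : J → X → ℚ} (hg : ∀ j, PL δ (g j)) {f : X → ℚ}
    (hf : ∀ x, ∃ j, f x = g j x) (hle : ∀ x j, f x ≤ g j x) : PL δ f := by
  refine PL.cover (P := fun j x => ∀ k, g j x ≤ g k x) (g := g)
    (fun j => Adm.all fun k => (hg j).le (hg k)) hg ?_ ?_
  · intro x
    obtain ⟨j, hj⟩ := hf x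
    exact ⟨j, fun k => hj ▸ hle x k⟩
  · intro x j h
    obtain ⟨i, hi⟩ := hf x
    exact le_antisymm (hle x j) (hi ▸ h i)

theorem PL.finmax {J : Type} [Finite J] {g : J → X → ℚ} (hg : ∀ j, PL δ (g j)) {f : X → ℚ}
    (hf : ∀ x, ∃ j, f x = g j x) (hle : ∀ x j, g j x ≤ f x) : PL δ f := by
  have := PL.finmin (δ := δ) (g := fun j x => (-1) * g j x) (f := fun x => (-1) * f x)
    (fun j => (hg j).smul (-1))
    (fun x => by
      obtain ⟨j, hj⟩ := hf x
      exact ⟨j, by rw [hj]⟩)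
    (fun x j => by have := hle x j; linarith)
  exact (this.smul (-1)).congr fun x => by ring

end FinMin

section Interface
set_option linter.unusedSectionVars false
set_option linter.unusedVariables false
open MeasureTheory

variable {p : ℕ} [hp : Fact p.Prime] {d : ℕ}

/-- generic matrix -/
noncomputable def genM (d : ℕ) : Matrix (Fin d) (Fin d) (MvPolynomial (Fin (d * d)) ℤ) :=
  Matrix.of fun i j => MvPolynomial.X (finProdFinEquiv (i, j))

/-- structure polynomial -/
noncomputable def polP (c : Fin d → Fin d → Fin d → ℤ) (q : Fin d × Fin d × Fin d) :
    MvPolynomial (Fin (d * d)) ℤ :=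
  Matrix.vecMul (fun l => ∑ a, ∑ b, genM d q.1 a * genM d q.2.1 b * (c a b l : MvPolynomial (Fin (d * d)) ℤ))
    (genM d).adjugate q.2.2

theorem map_genM (x : Fin (d * d) → ℤ_[p]) : (ev x).mapMatrix (genM d) = Matrix.of (resh x) := by
  ext i j
  simp [genM, ev_X, resh]

theorem ev_genM (x : Fin (d * d) → ℤ_[p]) (i j : Fin d) : ev x (genM d i j) = resh x i j := by
  simp [genM, ev_X, resh]

theorem ev_det (x : Fin (d * d) → ℤ_[p]) : ev x (genM d).det = (Matrix.of (resh x)).det := by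
  rw [RingHom.map_det, map_genM]

theorem ev_polP (c : Fin d → Fin d → Fin d → ℤ) (q : Fin d × Fin d × Fin d) (x : Fin (d * d) → ℤ_[p]) :
    ev x (polP c q) = Matrix.vecMul (bm c (resh x q.1) (resh x q.2.1)) (Matrix.of (resh x)).adjugate q.2.2 := by
  unfold polP
  rw [RingHom.map_vecMul]
  have h1 : (genM d).adjugate.map (ev x) = (Matrix.of (resh x)).adjugate := by
    have := RingHom.map_adjugate (ev x) (genM d)
    rw [map_genM] at this
    exact this
  rw [h1]
  congr 1
  funext l
  simp only [Function.comp_apply, map_sum, map_mul, ev_genM, map_intCast, bm_apply]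

theorem genM_det_ne : (genM d).det ≠ 0 := by
  have h := detP_ne (le_refl d)
  exact h

/-- polynomials needed -/
noncomputable def GG (c : Fin d → Fin d → Fin d → ℤ) : Finset (MvPolynomial (Fin (d * d)) ℤ) := by
  classical
  exact insert (genM d).det (Finset.univ.image (fun q : Fin d × Fin d => genM d q.1 q.2) ∪
    (Finset.univ.image (polP c)).filter (fun g => g ≠ 0))

theorem det_mem (c : Fin d → Fin d → Fin d → ℤ) : (genM d).det ∈ GG c := by simp [GG]

theorem gen_mem (c : Fin d → Fin d → Fin d → ℤ) (i j : Fin d) : genM d i j ∈ GG c := by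
  classical
  simp only [GG, Finset.mem_insert, Finset.mem_union, Finset.mem_image]
  exact Or.inr (Or.inl ⟨(i, j), Finset.mem_univ _, rfl⟩)

theorem pol_mem (c : Fin d → Fin d → Fin d → ℤ) (q) (h : polP c q ≠ 0) : polP c q ∈ GG c := by
  classical
  simp only [GG, Finset.mem_insert, Finset.mem_union, Finset.mem_image, Finset.mem_filter]
  exact Or.inr (Or.inr ⟨⟨q, Finset.mem_univ _, rfl⟩, h⟩)

theorem zero_nmem (c : Fin d → Fin d → Fin d → ℤ) : (0 : MvPolynomial (Fin (d * d)) ℤ) ∉ GG c := by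
  classical
  simp only [GG, Finset.mem_insert, Finset.mem_union, Finset.mem_image, Finset.mem_filter]
  rintro (h | ⟨q, -, h⟩ | ⟨-, h⟩)
  · exact genM_det_ne h.symm
  · simp [genM] at h
  · exact h rfl

/-- generic points -/
abbrev GX (p : ℕ) [Fact p.Prime] (c : Fin d → Fin d → Fin d → ℤ) : Type :=
  {x : Fin (d * d) → ℤ_[p] // ∀ g ∈ GG c, ev x g ≠ 0}

/-- data of generic points -/
noncomputable def gδ (c : Fin d → Fin d → Fin d → ℤ) (x : GX p c) : (GG c → ℚ) × (GG c → ZMod p) :=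
  dataOf (GG c) x.1

theorem pl_val (c : Fin d → Fin d → Fin d → ℤ) {g} (hg : g ∈ GG c) :
    PL (gδ (p := p) c) (fun x => ((ev x.1 g).valuation : ℚ)) :=
  PL.coord (δ := gδ (p := p) c) ⟨g, hg⟩

theorem lind_gx (c : Fin d → Fin d → Fin d → ℤ) (x : GX p c) :
    lind (RS (resh x.1)) = (ev x.1 (genM d).det).valuation := by
  have h := x.2 _ (det_mem c)
  rw [ev_det] at h ⊢
  exact lind_RS _ h

theorem m0_key (c : Fin d → Fin d → Fin d → ℤ) (x : GX p c) (q : Fin d × Fin d)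
    (hq : ∀ q' : Fin d × Fin d,
      (ev x.1 (genM d q.1 q.2)).valuation ≤ (ev x.1 (genM d q'.1 q'.2)).valuation)
    (e : ℕ) (he : (ev x.1 (genM d q.1 q.2)).valuation = e) (m : ℕ) :
    m0 c (RS (resh x.1)) ≤ m ↔ ∀ t, polP c t ≠ 0 →
      (ev x.1 (genM d).det).valuation + e ≤ m + (ev x.1 (polP c t)).valuation := by
  have hdet := x.2 _ (det_mem c)
  have hdet' := hdet
  rw [ev_det] at hdet'
  have hent : ∀ i j, ev x.1 (genM d i j) ≠ 0 := fun i j => x.2 _ (gen_mem c i j)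
  rw [m0_matrix c (e := e) (resh x.1) hdet' ?_ ?_]
  · have h1 : ∀ t, ((p : ℤ_[p]) ^ e * (Matrix.of (resh x.1)).det ∣ (p : ℤ_[p]) ^ m *
        Matrix.vecMul (bm c (resh x.1 t.1) (resh x.1 t.2.1)) (Matrix.of (resh x.1)).adjugate t.2.2) ↔
        (polP c t ≠ 0 → (ev x.1 (genM d).det).valuation + e ≤ m + (ev x.1 (polP c t)).valuation) := by
      intro t
      rw [← ev_polP, ← ev_det]
      by_cases h0 : polP c t = 0
      · rw [h0, map_zero, mul_zero]
        exact ⟨fun _ h => absurd rfl h, fun _ => dvd_zero _⟩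
      have h2 := x.2 _ (pol_mem c t h0)
      have h3 : (p : ℤ_[p]) ^ e * ev x.1 (genM d).det ∣ (p : ℤ_[p]) ^ m * ev x.1 (polP c t) ↔
          (p : ℤ_[p]) ^ (e + (ev x.1 (genM d).det).valuation) ∣ (p : ℤ_[p]) ^ m * ev x.1 (polP c t) := by
        rw [pow_add]
        have h4 := PadicInt.unitCoeff_spec hdet
        conv_lhs => rw [h4]
        rw [mul_comm ((PadicInt.unitCoeff hdet : (ℤ_[p])ˣ) : ℤ_[p]), ← mul_assoc]
        exact Units.mul_right_dvd
      rw [h3, dvd_iff_val, PadicInt.valuation_p_pow_mul _ _ h2]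
      have h5 : (p : ℤ_[p]) ^ m * ev x.1 (polP c t) ≠ 0 := mul_ne_zero (pp_ne m) h2
      constructor
      · rintro (h | h) _
        · exact absurd h h5
        · rwa [add_comm]
      · intro h
        right
        have := h h0
        rwa [add_comm] at this
    constructor
    · intro h t; exact (h1 t).mp (h t.1 t.2.1 t.2.2)
    · intro h i j k; exact (h1 (i, j, k)).mpr (h (i, j, k))
  · intro i j
    rw [← ev_genM, dvd_iff_val]
    exact Or.inr (he ▸ hq (i, j))
  · refine ⟨q.1, q.2, ?_⟩
    rw [← ev_genM, dvd_iff_val, he]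
    rintro (h | h)
    · exact hent _ _ h
    · omega

theorem m0_zero (hd : d = 0) (c : Fin d → Fin d → Fin d → ℤ) (x : GX p c) :
    m0 c (RS (resh x.1)) = 0 := by
  have h := x.2 _ (det_mem c)
  rw [ev_det] at h
  have hs : Subsingleton (Fin d → ℤ_[p]) := by subst hd; infer_instance
  refine Nat.le_zero.mp ?_
  rw [m0_le_iff (idx_ne _ h)]
  intro r K hK a ha b hb
  rw [Subsingleton.elim (_ • _) (0 : Fin d → ℤ_[p])]
  exact K.zero_mem

theorem pl_m0_aux (c : Fin d → Fin d → Fin d → ℤ) (e : GX p c → ℕ)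
    (he : PL (gδ (p := p) c) (fun x => (e x : ℚ)))
    (key : ∀ (x : GX p c) m, m0 c (RS (resh x.1)) ≤ m ↔ ∀ t, polP c t ≠ 0 →
      (ev x.1 (genM d).det).valuation + e x ≤ m + (ev x.1 (polP c t)).valuation) :
    PL (gδ (p := p) c) (fun x => (m0 c (RS (resh x.1)) : ℚ)) := by
  classical
  let g : Option (Fin d × Fin d × Fin d) → GX p c → ℚ :=
    fun o x => o.elim 0 fun t => if polP c t = 0 then 0 else
      ((ev x.1 (genM d).det).valuation : ℚ) + e x - (ev x.1 (polP c t)).valuation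
  have hg0 : ∀ x, g none x = 0 := fun x => rfl
  have hg1 : ∀ t x, polP c t = 0 → g (some t) x = 0 := fun t x h => if_pos h
  have hg2 : ∀ t x, polP c t ≠ 0 → g (some t) x =
    ((ev x.1 (genM d).det).valuation : ℚ) + e x - (ev x.1 (polP c t)).valuation := fun t x h => if_neg h
  clear_value g
  refine PL.finmax (g := g) ?_ ?_ ?_
  · rintro (_ | t)
    · exact PL.zero.congr hg0
    · by_cases h0 : polP c t = 0
      · exact PL.zero.congr fun x => hg1 t x h0
      · exact (((pl_val c (det_mem c)).add he).sub (pl_val c (pol_mem c t h0))).congr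
          fun x => hg2 t x h0
  · intro x
    by_cases h0 : m0 c (RS (resh x.1)) = 0
    · exact ⟨none, by rw [hg0, h0, Nat.cast_zero]⟩
    · have h1 : ¬ m0 c (RS (resh x.1)) ≤ m0 c (RS (resh x.1)) - 1 := by omega
      rw [key] at h1
      push Not at h1
      obtain ⟨t, ht, h1⟩ := h1
      have h2 := (key x _).mp le_rfl t ht
      refine ⟨some t, ?_⟩
      rw [hg2 t x ht]
      have h3 : (ev x.1 (genM d).det).valuation + e x =
        m0 c (RS (resh x.1)) + (ev x.1 (polP c t)).valuation := by omega
      have h4 : ((ev x.1 (genM d).det).valuation : ℚ) + e x =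
        m0 c (RS (resh x.1)) + (ev x.1 (polP c t)).valuation := by exact_mod_cast h3
      rw [h4]; ring
  · rintro x (_ | t)
    · rw [hg0]; positivity
    · by_cases ht : polP c t = 0
      · rw [hg1 t x ht]; positivity
      · have h2 := (key x _).mp le_rfl t ht
        have h4 : ((ev x.1 (genM d).det).valuation : ℚ) + e x ≤
          m0 c (RS (resh x.1)) + (ev x.1 (polP c t)).valuation := by exact_mod_cast h2
        rw [hg2 t x ht, sub_le_iff_le_add]; exact h4

theorem pl_m0 (c : Fin d → Fin d → Fin d → ℤ) :
    PL (gδ (p := p) c) (fun x => (m0 c (RS (resh x.1)) : ℚ)) := by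
  rcases Nat.eq_zero_or_pos d with hd | hd
  · exact PL.zero.congr fun x => by rw [m0_zero hd, Nat.cast_zero]
  have : Nonempty (Fin d × Fin d) := ⟨(⟨0, hd⟩, ⟨0, hd⟩)⟩
  obtain ⟨E, hE⟩ : ∃ E : Fin d × Fin d → GX p c → ℕ, ∀ q x, E q x =
    (ev x.1 (genM d q.1 q.2)).valuation := ⟨_, fun _ _ => rfl⟩
  have hPL : ∀ q, PL (gδ (p := p) c) (fun x => (E q x : ℚ)) := fun q =>
    (pl_val c (gen_mem c q.1 q.2)).congr fun x => by rw [hE]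
  have hmin : ∀ x : GX p c, ∃ q : Fin d × Fin d, ∀ q' : Fin d × Fin d, E q x ≤ E q' x := by
    intro x
    exact Finite.exists_min (fun q : Fin d × Fin d => E q x)
  choose q hq using hmin
  refine pl_m0_aux c (fun x => E (q x) x) ?_ ?_
  · refine PL.finmin (g := fun q x => (E q x : ℚ)) hPL (fun x => ⟨q x, rfl⟩) (fun x j => ?_)
    exact Nat.cast_le.mpr (hq x j)
  · intro x m
    refine m0_key c x (q x) (fun q' => ?_) _ (hE _ _).symm m
    rw [← hE, ← hE]
    exact hq x q'

end Interface

open scoped ENNReal NNReal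

section Interface2
set_option linter.unusedSectionVars false
set_option linter.unusedVariables false
open MeasureTheory Cell

variable {p : ℕ} [hp : Fact p.Prime] {d : ℕ}

theorem lint_resh (F : (Fin d → Fin d → ℤ_[p]) → ℝ≥0∞) :
    ∫⁻ x, F x ∂(mm p d d) = ∫⁻ x, F (resh x) ∂(pmeasN p (d * d)) := by
  have h1 := resh_mp (p := p) d d
  let e : (Fin (d * d) → ℤ_[p]) ≃ᵐ (Fin d → Fin d → ℤ_[p]) :=
    { toFun := resh
      invFun := fun y k => y (finProdFinEquiv.symm k).1 (finProdFinEquiv.symm k).2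
      left_inv := fun x => by
        funext k
        exact congrArg x (finProdFinEquiv.apply_symm_apply k)
      right_inv := fun y => by
        funext i j
        simp [resh]
      measurable_toFun := h1.measurable
      measurable_invFun := by
        change Measurable fun (y : Fin d → Fin d → ℤ_[p]) (k : Fin (d * d)) =>
          y (finProdFinEquiv.symm k).1 (finProdFinEquiv.symm k).2
        rw [measurable_pi_iff]
        intro k
        exact (measurable_pi_apply _).comp (measurable_pi_apply _) }
  have h2 : MeasurePreserving e (pmeasN p (d * d)) (mm p d d) := h1
  exact (h2.lintegral_comp_emb e.measurableEmbedding F).symm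

theorem ae_gx (c : Fin d → Fin d → Fin d → ℤ) :
    ∀ᵐ x ∂(pmeasN p (d * d)), ∀ g ∈ GG c, ev x g ≠ 0 := by
  rw [Finset.eventually_all]
  intro g hg
  exact ae_ev_ne g fun h => zero_nmem c (h ▸ hg)

theorem adm_le (c : Fin d → Fin d → Fin d → ℤ) :
    Adm (gδ (p := p) c) (fun x => RS (resh x.1) ≤ sc 1 ⊤) := by
  have h1 : ∀ q : Fin d × Fin d, Adm (gδ (p := p) c)
      (fun x => (0 : ℚ) < (ev x.1 (genM d q.1 q.2)).valuation) := fun q =>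
    PL.zero.lt (pl_val c (gen_mem c q.1 q.2))
  refine (Adm.all h1).congr fun x => propext ?_
  rw [RS_le_sc]
  have h2 : ∀ i j, (p : ℤ_[p]) ^ 1 ∣ resh x.1 i j ↔ (0 : ℚ) < (ev x.1 (genM d i j)).valuation := by
    intro i j
    have h3 := x.2 _ (gen_mem c i j)
    rw [← ev_genM, dvd_iff_val]
    simp only [h3, false_or, Nat.cast_pos]
    exact Iff.rfl
  simp only [h2, Prod.forall]

theorem gm_rat : ∃ q : ℚ≥0, q ≠ 0 ∧ (mm p d d (TS d ⊤))⁻¹ = nn q := by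
  have h1 := meas_TS_top (p := p) (le_refl d)
  have h2 := gm_ne (p := p) (le_refl d)
  set a : ℚ≥0 := ((∏ i : Fin d, (p ^ d - p ^ i.val) : ℕ) : ℚ≥0) * (1 / p) ^ (d * d) with ha
  have h3 : mm p d d (TS d ⊤) = nn a := by
    rw [h1, ha, nn_mul, nn_pow]
    have h0 : ∀ n : ℕ, (n : ℝ≥0∞) = nn n := fun n => by simp only [nn, NNRat.cast_natCast, ENNReal.coe_natCast]
    rw [h0]
  have h4 : a ≠ 0 := by
    intro h0
    rw [h3, h0] at h2
    exact h2 (by simp [nn])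
  refine ⟨a⁻¹, inv_ne_zero h4, ?_⟩
  rw [h3]
  unfold nn
  rw [← ENNReal.coe_inv (by simpa using h4)]
  push_cast
  rfl

/-- weights of a lattice -/
noncomputable def latW (c : Fin d → Fin d → Fin d → ℤ) (H : Submodule ℤ_[p] (Fin d → ℤ_[p])) :
    (Bool → ℚ) × Unit :=
  (fun b => if b then (lind H : ℚ) + d * m0 c H else lind H, ())

open Classical in
theorem lat_conic (c : Fin d → Fin d → Fin d → ℤ) : ∃ S0 : Finset ℕ, ∀ p [Fact p.Prime], p ∉ S0 →
    Conic (fun φ : (Bool → ℚ) × Unit → ℝ≥0∞ =>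
      ∑' H : PLat p d, if H.1 ≤ sc 1 ⊤ then φ (latW c H.1) else 0) := by
  obtain ⟨S0, hS0⟩ := conic_int (d * d) (GG c) (zero_nmem c)
  refine ⟨S0, fun p hp hpS => ?_⟩
  have hΨ := hS0 p hpS
  have hw := Conic.weight hΨ (f := fun v => (d : ℚ) * v.1 ⟨_, det_mem c⟩)
    ((PL.coord _).smul _) (P := fun v => ∃ k : ℕ, v.1 ⟨_, det_mem c⟩ = k) (by
      refine (lintegral_congr fun x => ?_).trans lintegral_zero
      exact if_pos ⟨(ev x (genM d).det).valuation, rfl⟩)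
    (fun v => d * ⌊v.1 ⟨_, det_mem c⟩⌋₊) (fun v hv => by
      obtain ⟨k, hk⟩ := hv
      rw [hk]; simp) p (by exact_mod_cast hp.out.ne_zero)
  obtain ⟨P, hP, hP'⟩ := (adm_le (p := p) c).extend
  have hF : ∀ b : Bool, ∃ F : (GG c → ℚ) × (GG c → ZMod p) → ℚ, PL id F ∧
      ∀ x : GX p c, (latW c (RS (resh x.1))).1 b = F (gδ c x) := by
    have hl : PL (gδ (p := p) c) (fun x => (lind (RS (resh x.1)) : ℚ)) :=
      (pl_val c (det_mem c)).congr fun x => by rw [lind_gx c x]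
    rintro (_ | _)
    · exact hl.extend
    · exact (hl.add ((pl_m0 c).smul d)).extend
  choose F hF hF' using hF
  obtain ⟨q, hq, hq'⟩ := gm_rat (p := p) (d := d)
  obtain ⟨L, hL⟩ := ((hw.restrict hP).push hF (Adm.const ())).const_mul q hq
  refine ⟨L, fun φ => ?_⟩
  rw [← hL φ]
  beta_reduce
  rw [sum_lat (fun H => if H ≤ sc 1 ⊤ then φ (latW c H) else 0), hq', lint_resh]
  congr 1
  refine lintegral_congr_ae ?_
  filter_upwards [ae_gx (p := p) c] with x hx
  have h1 := hP' ⟨x, hx⟩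
  have h2 := lind_gx c ⟨x, hx⟩
  have h3 := fun b => hF' b ⟨x, hx⟩
  dsimp only [gδ] at h1 h2 h3
  have h4 : latW c (RS (resh x)) = (fun b => F b (dataOf (GG c) x), ()) := by
    refine Prod.ext ?_ rfl
    funext b
    exact h3 b
  rw [h4, h2]
  simp only [h1]
  congr 2

end Interface2

open scoped ENNReal NNReal


section Transport
set_option linter.unusedSectionVars false
set_option linter.unusedVariables false

variable {p : ℕ} [hp : Fact p.Prime] {d : ℕ} {Λ : Type*} [NonUnitalNonAssocRing Λ]
  (e : Λ ≃+ (Fin d → ℤ))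

/-- structure constants -/
noncomputable def strc (i j k : Fin d) : ℤ := e (e.symm (Pi.single i 1) * e.symm (Pi.single j 1)) k

/-- embedding into the p-adic completion -/
noncomputable def iot (p : ℕ) [Fact p.Prime] : Λ →+ (Fin d → ℤ_[p]) where
  toFun a j := ((e a j : ℤ) : ℤ_[p])
  map_zero' := by funext j; simp
  map_add' a b := by funext j; simp

theorem iot_apply (a : Λ) (j : Fin d) : iot e p a j = ((e a j : ℤ) : ℤ_[p]) := rfl

theorem e_mul (a b : Λ) (k : Fin d) : e (a * b) k = ∑ i, ∑ j, e a i * e b j * strc e i j k := by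
  have h : ∀ a : Λ, a = ∑ i, e a i • e.symm (Pi.single i 1) := by
    intro a
    apply e.injective
    rw [map_sum]
    simp only [map_zsmul, AddEquiv.apply_symm_apply]
    funext j
    simp [Finset.sum_apply, Pi.single_apply]
  conv_lhs => rw [h a, h b]
  rw [Finset.sum_mul_sum]
  simp only [map_sum, Finset.sum_apply, smul_mul_assoc, mul_smul_comm, map_zsmul, Pi.smul_apply,
    smul_eq_mul, strc]
  exact Finset.sum_congr rfl fun i _ => Finset.sum_congr rfl fun j _ => by ring

theorem iot_mul (a b : Λ) : iot e p (a * b) = bm (strc e) (iot e p a) (iot e p b) := by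
  funext k
  rw [iot_apply, e_mul, bm_apply]
  push_cast
  rfl

theorem iot_zsmul_mem (n : ℕ) (b : Fin d → ℤ_[p]) : ∃ a : Λ, b - iot e p a ∈ sc n (⊤ : Submodule ℤ_[p] (Fin d → ℤ_[p])) := by
  refine ⟨e.symm fun j => ((b j).appr n : ℤ), ?_⟩
  have h : ∀ j, ∃ y, (p : ℤ_[p]) ^ n * y = b j - ((b j).appr n : ℤ_[p]) := fun j => by
    have := PadicInt.appr_spec n (b j)
    rw [Ideal.mem_span_singleton'] at this
    obtain ⟨y, hy⟩ := this
    exact ⟨y, by rw [← hy, mul_comm]⟩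
  choose y hy using h
  refine mem_sc.mpr ⟨y, trivial, ?_⟩
  funext j
  rw [Pi.smul_apply, smul_eq_mul, hy, Pi.sub_apply, iot_apply]
  simp

theorem iot_mem_sc {n : ℕ} {a : Λ} (h : iot e p a ∈ sc n (⊤ : Submodule ℤ_[p] (Fin d → ℤ_[p]))) :
    ∃ y : Λ, a = (p ^ n) • y := by
  obtain ⟨x, -, hx⟩ := mem_sc.mp h
  have h1 : ∀ j, ((p : ℤ) ^ n) ∣ e a j := fun j => by
    rw [← PadicInt.pow_p_dvd_int_iff]
    exact ⟨x j, by rw [← iot_apply, ← hx]; rfl⟩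
  choose y hy using h1
  refine ⟨e.symm y, e.injective ?_⟩
  rw [map_nsmul, AddEquiv.apply_symm_apply]
  funext j
  rw [hy j]
  simp

theorem idx_comap {n : ℕ} (H : Submodule ℤ_[p] (Fin d → ℤ_[p])) (hn : sc n ⊤ ≤ H) :
    (H.toAddSubgroup.comap (iot e p)).index = idx H := by
  rw [AddSubgroup.index_comap, ← AddSubgroup.relIndex_sup_right]
  have : (iot e p).range ⊔ H.toAddSubgroup = ⊤ := by
    rw [eq_top_iff]
    intro b _
    obtain ⟨a, ha⟩ := iot_zsmul_mem e n b
    rw [AddSubgroup.mem_sup]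
    exact ⟨iot e p a, ⟨a, rfl⟩, b - iot e p a, hn ha, by abel⟩
  rw [this, AddSubgroup.relIndex_top_right]; rfl

theorem sc_lind_le {H : Submodule ℤ_[p] (Fin d → ℤ_[p])} (hH : idx H ≠ 0) : sc (lind H) ⊤ ≤ H := by
  intro b hb
  obtain ⟨x, -, rfl⟩ := mem_sc.mp hb
  exact pow_lind_mem hH x

/-- completion of a subgroup -/
noncomputable def compl (n : ℕ) (S : AddSubgroup Λ) : Submodule ℤ_[p] (Fin d → ℤ_[p]) where
  carrier := {b | ∃ a ∈ S, b - iot e p a ∈ sc n (⊤ : Submodule ℤ_[p] (Fin d → ℤ_[p]))}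
  zero_mem' := ⟨0, S.zero_mem, by rw [map_zero, sub_zero]; exact Submodule.zero_mem _⟩
  add_mem' := by
    rintro x y ⟨a, ha, hx⟩ ⟨b, hb, hy⟩
    refine ⟨a + b, S.add_mem ha hb, ?_⟩
    rw [map_add, add_sub_add_comm]
    exact Submodule.add_mem _ hx hy
  smul_mem' := by
    rintro r x ⟨a, ha, hx⟩
    refine ⟨(r.appr n) • a, S.nsmul_mem ha _, ?_⟩
    have h1 : r • x - iot e p ((r.appr n) • a) =
        r • (x - iot e p a) + (r - (r.appr n : ℤ_[p])) • iot e p a := by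
      rw [map_nsmul, smul_sub, sub_smul, Nat.cast_smul_eq_nsmul]
      abel
    rw [h1]
    refine Submodule.add_mem _ (Submodule.smul_mem _ _ hx) ?_
    have := PadicInt.appr_spec n r
    rw [Ideal.mem_span_singleton'] at this
    obtain ⟨y, hy⟩ := this
    rw [← hy, mul_comm, mul_smul]
    exact mem_sc.mpr ⟨_, trivial, rfl⟩

theorem mem_compl {n : ℕ} {S : AddSubgroup Λ} {b : Fin d → ℤ_[p]} :
    b ∈ compl e n S ↔ ∃ a ∈ S, b - iot e p a ∈ sc n (⊤ : Submodule ℤ_[p] (Fin d → ℤ_[p])) := Iff.rfl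

theorem sc_le_compl (n : ℕ) (S : AddSubgroup Λ) : sc n ⊤ ≤ compl (p := p) e n S := by
  intro b hb
  exact mem_compl e |>.mpr ⟨0, S.zero_mem, by rwa [map_zero, sub_zero]⟩

theorem comap_compl {n : ℕ} {S : AddSubgroup Λ} (hS : S.index = p ^ n) :
    (compl e n S).toAddSubgroup.comap (iot e p) = S := by
  ext x
  constructor
  · rintro ⟨a, ha, h⟩
    rw [← map_sub] at h
    obtain ⟨y, hy⟩ := iot_mem_sc e h
    have h1 := S.nsmul_index_mem y
    rw [hS, ← hy] at h1
    have := S.add_mem h1 ha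
    rwa [sub_add_cancel] at this
  · intro h
    exact ⟨x, h, by rw [sub_self]; exact Submodule.zero_mem _⟩

theorem compl_comap {H : Submodule ℤ_[p] (Fin d → ℤ_[p])} (hH : idx H ≠ 0) :
    compl e (lind H) (H.toAddSubgroup.comap (iot e p)) = H := by
  ext b
  rw [mem_compl]
  constructor
  · rintro ⟨a, ha, h⟩
    have := H.add_mem (sc_lind_le hH h) ha
    rwa [sub_add_cancel] at this
  · intro h
    obtain ⟨a, ha⟩ := iot_zsmul_mem e (lind H) b
    refine ⟨a, ?_, ha⟩
    have := H.sub_mem h (sc_lind_le hH ha)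
    rwa [sub_sub_cancel] at this

theorem cl_compl {n : ℕ} (S : NonUnitalSubring Λ) : Cl (strc e) 0 (compl (p := p) e n S.toAddSubgroup) := by
  rintro x ⟨a, ha, hx⟩ y ⟨b, hb, hy⟩
  rw [pow_zero, one_smul]
  refine ⟨a * b, S.mul_mem ha hb, ?_⟩
  obtain ⟨u, -, hu⟩ := mem_sc.mp hx
  obtain ⟨w, -, hw⟩ := mem_sc.mp hy
  have h1 : x = iot e p a + (p : ℤ_[p]) ^ n • u := by rw [hu]; abel
  have h2 : y = iot e p b + (p : ℤ_[p]) ^ n • w := by rw [hw]; abel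
  refine mem_sc.mpr ⟨bm (strc e) u y + bm (strc e) (iot e p a) w, trivial, ?_⟩
  rw [iot_mul]
  conv_rhs => rw [h1]
  rw [map_add, LinearMap.add_apply, map_smul (bm (strc e)), LinearMap.smul_apply]
  conv_rhs => rw [h2]
  rw [map_add (bm (strc e) (iot e p a)), map_smul (bm (strc e) (iot e p a)), ← h2, smul_add]
  abel

theorem subring_count (n : ℕ) : subringCount Λ (p ^ n) =
    Nat.card {H : {H : PLat p d // Cl (strc e) 0 H.1} // lind H.1.1 = n} := by
  symm
  let F : {H : {H : PLat p d // Cl (strc e) 0 H.1} // lind H.1.1 = n} →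
      {S : NonUnitalSubring Λ // S.toAddSubgroup.index = p ^ n} := fun H =>
    ⟨{ H.1.1.1.toAddSubgroup.comap (iot e p) with
        mul_mem' := by
          intro a b ha hb
          have := H.1.2 _ ha _ hb
          rw [pow_zero, one_smul, ← iot_mul] at this
          exact this }, by
      change (H.1.1.1.toAddSubgroup.comap (iot e p)).index = p ^ n
      rw [idx_comap e H.1.1.1 (sc_lind_le H.1.1.2), idx_eq _ H.1.1.2, H.2]⟩
  refine Nat.card_congr (Equiv.ofBijective F ⟨?_, ?_⟩)
  · rintro ⟨⟨⟨H, hH⟩, hc⟩, hn⟩ ⟨⟨⟨K, hK⟩, hc'⟩, hn'⟩ hHK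
    have h1 : H.toAddSubgroup.comap (iot e p) = K.toAddSubgroup.comap (iot e p) :=
      congrArg (fun S => S.1.toAddSubgroup) hHK
    have h2 : H = K := by
      rw [← compl_comap e hH, ← compl_comap e hK, h1]
      dsimp only at hn hn'
      rw [hn, hn']
    subst h2
    rfl
  · rintro ⟨S, hS⟩
    have h0 : idx (compl (p := p) e n S.toAddSubgroup) = p ^ n := by
      rw [← idx_comap e _ (sc_le_compl e n _), comap_compl e hS, hS]
    refine ⟨⟨⟨⟨compl e n S.toAddSubgroup, ?_⟩, cl_compl e S⟩, ?_⟩, ?_⟩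
    · rw [h0]; exact pow_ne_zero _ hp.out.ne_zero
    · change lind (compl (p := p) e n S.toAddSubgroup) = n
      rw [lind, h0, Nat.log_pow hp.out.one_lt]
    · apply Subtype.ext
      have h1 := comap_compl (p := p) e hS
      apply SetLike.ext
      intro x
      have h2 : x ∈ (compl (p := p) e n S.toAddSubgroup).toAddSubgroup.comap (iot e p) ↔ x ∈ S.toAddSubgroup := by
        rw [h1]
      exact h2

end Transport

section Counts
set_option linter.unusedSectionVars false

variable {p : ℕ} [hp : Fact p.Prime] {d : ℕ}

theorem lind_fin (n : ℕ) : {H : PLat p d | lind H.1 = n}.Finite := by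
  have h := zeta0_val (p := p) (le_refl d)
  have h1 : ∑' H : PLat p d, (nn (1 / p) ^ d) ^ lind H.1 ≠ ⊤ := by
    intro h2
    rw [h2, ENNReal.mul_top] at h
    · exact ENNReal.top_ne_one h
    · intro h0
      rw [h0, zero_mul] at h
      exact zero_ne_one h
  have h3 := ENNReal.finite_const_le_of_tsum_ne_top h1 (ε := (nn (1 / p) ^ d) ^ n)
    (pow_ne_zero _ (pow_ne_zero _ nnp_ne))
  refine h3.subset ?_
  intro H hH
  have : lind H.1 = n := hH
  change (nn (1 / p) ^ d) ^ n ≤ (nn (1 / p) ^ d) ^ lind H.1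
  rw [this]

theorem tsum_fib {α : Type} (f : α → ℕ) (hf : ∀ n, Finite {a // f a = n}) (ψ : ℕ → ℝ≥0∞) :
    ∑' a, ψ (f a) = ∑' n, (Nat.card {a // f a = n} : ℝ≥0∞) * ψ n := by
  rw [← (Equiv.sigmaFiberEquiv f).tsum_eq]
  refine (ENNReal.tsum_sigma (fun n (a : {a // f a = n}) => ψ (f a.1))).trans ?_
  refine tsum_congr fun n => ?_
  have := hf n
  rw [tsum_congr (fun a : {a // f a = n} => by rw [a.2] : ∀ a : {a // f a = n}, ψ (f a.1) = ψ n),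
    ENNReal.tsum_const, ENat.card_eq_coe_natCard]
  rfl

/-- number of lattices -/
noncomputable def latCount (p : ℕ) [Fact p.Prime] (d n : ℕ) : ℕ := Nat.card {H : PLat p d // lind H.1 = n}

theorem sum_latCount (ψ : ℕ → ℝ≥0∞) : ∑' H : PLat p d, ψ (lind H.1) =
    ∑' n, (latCount p d n : ℝ≥0∞) * ψ n :=
  tsum_fib (fun H : PLat p d => lind H.1) (fun n => (lind_fin n).to_subtype) ψ

theorem main_conic {Λ : Type*} [NonUnitalNonAssocRing Λ] (e : Λ ≃+ (Fin d → ℤ)) :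
    ∃ S0 : Finset ℕ, ∀ p [Fact p.Prime], p ∉ S0 → ∃ L : List (Cell Bool Unit),
      (∀ ψ : ℕ → ℝ≥0∞, ∑' n, (subringCount Λ (p ^ n) : ℝ≥0∞) * ψ (n + d) =
        Cell.evalL L (fun v => ψ ⌊v.1 true⌋₊)) ∧
      (∀ ψ : ℕ → ℝ≥0∞, ∑' n, (latCount p d n : ℝ≥0∞) * ψ (n + d) =
        Cell.evalL L (fun v => ψ ⌊v.1 false⌋₊)) ∧
      Cell.evalL L (fun v => open Classical in if (∃ a b : ℕ, v.1 false = a ∧ v.1 true = b ∧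
        a ≤ b ∧ b ≤ (d + 1) * a) then 0 else 1) = 0 := by
  classical
  obtain ⟨S0, hS0⟩ := lat_conic (strc e)
  refine ⟨S0, fun p hp hpS => ?_⟩
  obtain ⟨L, hL⟩ := hS0 p hpS
  beta_reduce at hL
  refine ⟨L, ?_, ?_, ?_⟩
  · intro ψ
    rw [← hL]
    have h1 := tsum_fib (fun H : {H : PLat p d // Cl (strc e) 0 H.1} => lind H.1.1)
      (fun n => by
        have := (lind_fin (p := p) (d := d) n).to_subtype
        refine Finite.of_injective (β := {H : PLat p d | lind H.1 = n}) (fun H => ⟨H.1.1, H.2⟩) ?_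
        intro H K h
        exact Subtype.ext (Subtype.ext (congrArg (fun q => q.1) h))) (fun n => ψ (n + d))
    rw [tsum_congr (fun n => by rw [subring_count e n] : ∀ n, (subringCount Λ (p ^ n) : ℝ≥0∞) * ψ (n + d) =
      (Nat.card {H : {H : PLat p d // Cl (strc e) 0 H.1} // lind H.1.1 = n} : ℝ≥0∞) * ψ (n + d)), ← h1,
      sum_sub (fun n => ψ (n + d))]
    have h2 := sum_shift (p := p) (c := strc e) (fun l m => ψ (l + d * m))
    rw [tsum_congr (fun H => by congr 1; ring : ∀ H : PLat p d, ψ (lind H.1 + d * m0 (strc e) H.1 + d) =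
      ψ (lind H.1 + d + d * m0 (strc e) H.1)), h2]
    refine tsum_congr fun H => ?_
    congr 2
    simp only [latW, if_true]
    have h3 : (lind H.1 : ℚ) + d * m0 (strc e) H.1 = ((lind H.1 + d * m0 (strc e) H.1 : ℕ) : ℚ) := by push_cast; ring
    rw [h3, Nat.floor_natCast]
  · intro ψ
    rw [← hL, ← sum_latCount (fun n => ψ (n + d))]
    have h2 := sum_shift (p := p) (c := strc e) (fun l m => ψ l)
    rw [h2]
    refine tsum_congr fun H => ?_
    congr 2
  · rw [← hL, ENNReal.tsum_eq_zero]
    intro H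
    split_ifs with h1 h2
    · rfl
    · exfalso
      apply h2
      refine ⟨lind H.1, lind H.1 + d * m0 (strc e) H.1, by simp [latW], by simp [latW], by omega, ?_⟩
      have := Nat.mul_le_mul_left d (m0_le_lind (c := strc e) H.2)
      linarith
    · rfl

end Counts

open scoped ENNReal NNReal

section GeoSeries
set_option linter.unusedSectionVars false
set_option linter.unusedVariables false

theorem nn_inj {a b : ℚ≥0} (h : nn a = nn b) : a = b := by
  unfold nn at h
  exact_mod_cast h

theorem nn_add (a b : ℚ≥0) : nn (a + b) = nn a + nn b := by
  unfold nn; push_cast; rfl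

theorem nn_zero : nn 0 = 0 := by unfold nn; simp

/-- coefficients of products of geometric series -/
noncomputable def geoT (ι : Type) [Fintype ι] (w : ι → ℕ) (ρ : ι → ℚ≥0) (m : ℕ) : ℝ≥0∞ :=
  ∑' ℓ : ι → ℕ, (∏ i, nn (ρ i) ^ ℓ i) * (if ∑ i, ℓ i * w i = m then 1 else 0)

/-- conclusion about products of geometric series -/
def GeoOK (ι : Type) [Fintype ι] : Prop := ∀ (w : ι → ℕ) (ρ : ι → ℚ≥0), (∀ i, ρ i ≠ 0) →
  (∀ m, geoT ι w ρ m ≠ ⊤) → ∃ f : ℕ → ℚ≥0, (∀ m, geoT ι w ρ m = nn (f m)) ∧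
    (PowerSeries.mk fun m => (f m : ℚ)) *
      ((∏ i, if w i = 0 then 1 else (1 - Polynomial.C (ρ i : ℚ) * Polynomial.X ^ w i) : Polynomial ℚ) :
        PowerSeries ℚ) = PowerSeries.C (∏ i, if w i = 0 then (1 - (ρ i : ℚ))⁻¹ else 1)

theorem geoT_equiv {α β : Type} [Fintype α] [Fintype β] (e : α ≃ β) (w : β → ℕ) (ρ : β → ℚ≥0) (m : ℕ) :
    geoT β w ρ m = geoT α (fun i => w (e i)) (fun i => ρ (e i)) m := by
  unfold geoT
  rw [← (Equiv.arrowCongr e (Equiv.refl ℕ)).tsum_eq]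
  refine tsum_congr fun ℓ => ?_
  have h1 : ∏ i, nn (ρ i) ^ (Equiv.arrowCongr e (Equiv.refl ℕ)) ℓ i = ∏ i, nn (ρ (e i)) ^ ℓ i := by
    rw [← e.prod_comp]
    simp
  have h2 : ∑ i, (Equiv.arrowCongr e (Equiv.refl ℕ)) ℓ i * w i = ∑ i, ℓ i * w (e i) := by
    rw [← e.sum_comp]
    simp
  rw [h1, h2]

theorem geoOK_equiv {α β : Type} [Fintype α] [Fintype β] (e : α ≃ β) (h : GeoOK α) : GeoOK β := by
  intro w ρ hρ hT
  obtain ⟨f, hf, hf'⟩ := h (fun i => w (e i)) (fun i => ρ (e i)) (fun i => hρ _)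
    (fun m => by rw [← geoT_equiv]; exact hT m)
  refine ⟨f, fun m => by rw [geoT_equiv e, hf], ?_⟩
  rw [← e.prod_comp, ← e.prod_comp (fun i => if w i = 0 then (1 - (ρ i : ℚ))⁻¹ else 1)]
  exact hf'

theorem geoOK_empty : GeoOK PEmpty := by
  intro w ρ hρ hT
  have h1 : ∀ m, geoT PEmpty w ρ m = nn (if m = 0 then 1 else 0) := by
    intro m
    unfold geoT
    rw [tsum_eq_single (default : PEmpty → ℕ) (fun b hb => absurd (Subsingleton.elim _ _) hb)]
    simp only [Finset.univ_eq_empty, Finset.prod_empty, Finset.sum_empty, one_mul, eq_comm (a := 0)]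
    split_ifs
    · exact nn_one.symm
    · exact nn_zero.symm
  refine ⟨_, h1, ?_⟩
  simp only [Finset.univ_eq_empty, Finset.prod_empty]
  rw [Polynomial.coe_one, mul_one, map_one]
  ext m
  rw [PowerSeries.coeff_mk, PowerSeries.coeff_one]
  split_ifs <;> simp

theorem geoT_option {α : Type} [Fintype α] (w : Option α → ℕ) (ρ : Option α → ℚ≥0) (m : ℕ) :
    geoT (Option α) w ρ m = ∑' k : ℕ, nn (ρ none) ^ k *
      (if k * w none ≤ m then geoT α (fun i => w (some i)) (fun i => ρ (some i)) (m - k * w none) else 0) := by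
  unfold geoT
  rw [← (Equiv.piOptionEquivProd (β := fun _ : Option α => ℕ)).symm.tsum_eq, ENNReal.tsum_prod']
  refine tsum_congr fun k => ?_
  have h1 : ∀ b : α → ℕ, (∏ i : Option α, nn (ρ i) ^ ((Equiv.piOptionEquivProd (β := fun _ : Option α => ℕ)).symm (k, b)) i)
      = nn (ρ none) ^ k * ∏ i, nn (ρ (some i)) ^ b i := by
    intro b
    rw [Fintype.prod_option]; rfl
  have h2 : ∀ b : α → ℕ, (∑ i : Option α, ((Equiv.piOptionEquivProd (β := fun _ : Option α => ℕ)).symm (k, b)) i * w i)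
      = k * w none + ∑ i, b i * w (some i) := by
    intro b
    rw [Fintype.sum_option]; rfl
  simp only [h1, h2]
  split_ifs with h
  · rw [← ENNReal.tsum_mul_left]
    refine tsum_congr fun b => ?_
    rw [mul_assoc]
    congr 3
    exact propext (by omega)
  · rw [mul_zero, ENNReal.tsum_eq_zero]
    intro b
    rw [if_neg (by omega), mul_zero]

theorem geoT_zero_ne {α : Type} [Fintype α] (w : α → ℕ) (ρ : α → ℚ≥0) : geoT α w ρ 0 ≠ 0 := by
  unfold geoT
  intro h
  rw [ENNReal.tsum_eq_zero] at h
  have := h 0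
  simp at this

theorem geoOK_option {α : Type} [Fintype α] (h : GeoOK α) : GeoOK (Option α) := by
  intro w ρ hρ hT
  have hle : ∀ m, geoT α (fun i => w (some i)) (fun i => ρ (some i)) m ≤ geoT (Option α) w ρ m := by
    intro m
    rw [geoT_option]
    refine le_trans ?_ (ENNReal.le_tsum 0)
    simp
  obtain ⟨f, hf, hf'⟩ := h (fun i => w (some i)) (fun i => ρ (some i)) (fun i => hρ _)
    (fun m => ne_top_of_le_ne_top (hT m) (hle m))
  by_cases hw : w none = 0
  · have h1 : ∀ m, geoT (Option α) w ρ m = (∑' k : ℕ, nn (ρ none) ^ k) * nn (f m) := by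
      intro m
      rw [geoT_option, ← ENNReal.tsum_mul_right]
      refine tsum_congr fun k => ?_
      simp [hw, hf]
    have h0 : nn (f 0) ≠ 0 := by rw [← hf]; exact geoT_zero_ne _ _
    have h2 : ρ none < 1 := by
      by_contra hc
      have h3 : (∑' k : ℕ, nn (ρ none) ^ k) = ⊤ := by
        rw [ENNReal.tsum_geometric, ENNReal.inv_eq_top, tsub_eq_zero_iff_le]
        unfold nn
        have : (1 : ℚ≥0) ≤ ρ none := not_lt.mp hc
        have h4 : (1 : ℝ≥0) ≤ (ρ none : ℝ≥0) := by exact_mod_cast this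
        exact_mod_cast h4
      apply hT 0
      rw [h1, h3, ENNReal.top_mul h0]
    have h5 : (∑' k : ℕ, nn (ρ none) ^ k) = nn ((1 - ρ none)⁻¹) := by
      rw [ENNReal.tsum_geometric]
      have h6 : nn (1 - ρ none) + nn (ρ none) = 1 := by
        rw [← nn_add, tsub_add_cancel_of_le h2.le, nn_one]
      have h7 : 1 - nn (ρ none) = nn (1 - ρ none) := by
        rw [← h6, ENNReal.add_sub_cancel_right (nn_ne_top _)]
      rw [h7]
      have h8 : nn (1 - ρ none) * nn ((1 - ρ none)⁻¹) = 1 := by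
        rw [← nn_mul, mul_inv_cancel₀ (tsub_pos_of_lt h2).ne', nn_one]
      exact (ENNReal.eq_inv_of_mul_eq_one_left (by rw [mul_comm]; exact h8)).symm
    refine ⟨fun m => (1 - ρ none)⁻¹ * f m, fun m => by rw [h1, h5, nn_mul], ?_⟩
    rw [Fintype.prod_option, Fintype.prod_option, if_pos hw, if_pos hw, one_mul, map_mul, ← hf', ← mul_assoc]
    congr 1
    ext m
    rw [PowerSeries.coeff_mk, PowerSeries.coeff_C_mul, PowerSeries.coeff_mk]
    push_cast [h2.le]
    rfl
  · have hw' : 0 < w none := Nat.pos_of_ne_zero hw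
    have h1 : ∀ m, geoT (Option α) w ρ m = nn (f m) +
        nn (ρ none) * (if w none ≤ m then geoT (Option α) w ρ (m - w none) else 0) := by
      intro m
      rw [geoT_option, tsum_eq_zero_add' ENNReal.summable]
      congr 1
      · simp [hf]
      · split_ifs with hm
        · rw [geoT_option, ← ENNReal.tsum_mul_left]
          refine tsum_congr fun k => ?_
          rw [pow_succ, mul_comm (nn (ρ none) ^ k), mul_assoc]
          congr 2
          rw [Nat.sub_sub, Nat.add_comm (w none), ← Nat.succ_mul]
          refine if_congr ?_ rfl rfl
          rw [Nat.succ_mul]; omega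
        · rw [mul_zero, ENNReal.tsum_eq_zero]
          intro k
          rw [if_neg, mul_zero]
          intro hk
          apply hm
          refine le_trans ?_ hk
          exact Nat.le_mul_of_pos_left _ (Nat.succ_pos k)
    have h2 : ∀ m, ∃ q, geoT (Option α) w ρ m = nn q := by
      intro m
      induction m using Nat.strong_induction_on with
      | _ m ih =>
        rw [h1]
        split_ifs with hm
        · obtain ⟨q, hq⟩ := ih (m - w none) (by omega)
          exact ⟨f m + ρ none * q, by rw [hq, nn_add, nn_mul]⟩
        · exact ⟨f m, by rw [mul_zero, add_zero]⟩
    choose g hg using h2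
    have h3 : ∀ m, g m = f m + ρ none * (if w none ≤ m then g (m - w none) else 0) := by
      intro m
      apply nn_inj
      rw [← hg, h1, nn_add, nn_mul]
      congr 2
      split_ifs
      · exact hg _
      · exact nn_zero.symm
    refine ⟨g, hg, ?_⟩
    rw [Fintype.prod_option, Fintype.prod_option, if_neg hw, if_neg hw, one_mul, ← hf', Polynomial.coe_mul,
      ← mul_assoc]
    congr 1
    ext m
    rw [PowerSeries.coeff_mk, Polynomial.coe_sub, Polynomial.coe_mul, Polynomial.coe_one, Polynomial.coe_C,
      Polynomial.coe_pow, Polynomial.coe_X, mul_sub, mul_one, map_sub, PowerSeries.coeff_mk,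
      mul_left_comm, PowerSeries.coeff_C_mul, PowerSeries.coeff_mul_X_pow', PowerSeries.coeff_mk]
    have h4 : (g m : ℚ) = f m + ρ none * (if w none ≤ m then (g (m - w none) : ℚ) else 0) := by
      rw [h3 m]
      push_cast
      congr 2
      split_ifs <;> simp
    rw [h4]; ring

theorem geoOK (ι : Type) [Fintype ι] : GeoOK ι := by
  have h : ∀ (ι : Type) [Finite ι], ∀ [Fintype ι], GeoOK ι := by
    intro ι _
    refine Finite.induction_empty_option (P := fun ι => ∀ [Fintype ι], GeoOK ι) ?_ ?_ ?_ ι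
    · intro α β e h _
      have := Fintype.ofEquiv β e.symm
      exact geoOK_equiv e h
    · intro inst
      have h0 := geoOK_empty
      convert h0
    · intro α _ h inst
      rw [Subsingleton.elim inst instFintypeOption]
      exact geoOK_option h
  exact h ι

end GeoSeries

open scoped ENNReal NNReal

section ValSeries
set_option linter.unusedSectionVars false
set_option linter.unusedVariables false
open Polynomial

/-- a power series is rational, of degree at most zero, with the given value at infinity -/
def Val (F : PowerSeries ℚ) (v : ℚ) : Prop := ∃ P Q : ℚ[X], Q.coeff 0 ≠ 0 ∧
  F * (Q : PowerSeries ℚ) = (P : PowerSeries ℚ) ∧ P.natDegree ≤ Q.natDegree ∧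
  P.coeff Q.natDegree = v * Q.leadingCoeff

theorem Val.zero : Val 0 0 := ⟨0, 1, by simp, by simp, by simp, by simp⟩

theorem Val.add {F G : PowerSeries ℚ} {v w : ℚ} (hF : Val F v) (hG : Val G w) : Val (F + G) (v + w) := by
  obtain ⟨P, Q, h1, h2, h3, h4⟩ := hF
  obtain ⟨P', Q', h1', h2', h3', h4'⟩ := hG
  have hQ : Q ≠ 0 := by rintro rfl; simp at h1
  have hQ' : Q' ≠ 0 := by rintro rfl; simp at h1'
  have hd : (Q * Q').natDegree = Q.natDegree + Q'.natDegree := natDegree_mul hQ hQ'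
  refine ⟨P * Q' + P' * Q, Q * Q', by rw [mul_coeff_zero]; exact mul_ne_zero h1 h1', ?_, ?_, ?_⟩
  · rw [coe_mul, coe_add, coe_mul, coe_mul, ← h2, ← h2']; ring
  · rw [hd]
    refine natDegree_add_le_of_degree_le ?_ ?_
    · exact natDegree_mul_le_of_le h3 le_rfl
    · rw [add_comm]; exact natDegree_mul_le_of_le h3' le_rfl
  · rw [hd, coeff_add, coeff_mul_add_eq_of_natDegree_le h3 le_rfl, add_comm Q.natDegree,
      coeff_mul_add_eq_of_natDegree_le h3' le_rfl, h4, h4', leadingCoeff_mul, ← leadingCoeff, ← leadingCoeff]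
    ring

open Classical in
/-- contribution of a cell to the value at infinity -/
noncomputable def cellv {κ Lab : Type} (β : Cell κ Lab) (Z : β.ι → Prop) : ℚ :=
  if ∀ i, ¬ Z i → β.θ i = 1 then
    (β.c : ℚ) * (∏ i, if Z i then (1 - (β.ρ i : ℚ))⁻¹ else 1) / ∏ i, (if Z i then 1 else -(β.ρ i : ℚ))
  else 0

theorem geo_natDegree (w : ℕ) (ρ : ℚ) (hρ : ρ ≠ 0) :
    (if w = 0 then 1 else (1 - C ρ * X ^ w) : ℚ[X]).natDegree = w ∧
    (if w = 0 then 1 else (1 - C ρ * X ^ w) : ℚ[X]).leadingCoeff = (if w = 0 then 1 else -ρ) ∧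
    (if w = 0 then 1 else (1 - C ρ * X ^ w) : ℚ[X]).coeff 0 = 1 := by
  split_ifs with h
  · simp [h]
  · have h1 : (1 - C ρ * X ^ w : ℚ[X]).natDegree = w := by
      rw [natDegree_sub_eq_right_of_natDegree_lt]
      · exact natDegree_C_mul_X_pow w ρ hρ
      · rw [natDegree_C_mul_X_pow w ρ hρ, natDegree_one]; omega
    refine ⟨h1, ?_, ?_⟩
    · rw [leadingCoeff, h1]
      simp [coeff_one, h]
    · simp [coeff_X_pow, Ne.symm h]

theorem cell_val {κ Lab : Type} [Fintype κ] (β : Cell κ Lab) (b : κ) (g : (β.ι → ℕ) → ℕ)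
    (hg : ∀ ℓ, (β.pt ℓ).1 b = g ℓ) (w : β.ι → ℕ) (hw : ∀ ℓ, g ℓ = g 0 + ∑ i, ℓ i * w i)
    (hs : (g 0 : ℚ) = ∑ i, β.θ i * w i) (Z : β.ι → Prop) (hZ : ∀ i, w i = 0 ↔ Z i)
    (hfin : ∀ m : ℕ, β.eval (fun v => if ⌊v.1 b⌋₊ = m then 1 else 0) ≠ ⊤) :
    ∃ F : ℕ → ℚ≥0, (∀ m : ℕ, β.eval (fun v => if ⌊v.1 b⌋₊ = m then 1 else 0) = nn (F m)) ∧
      Val (PowerSeries.mk fun m => (F m : ℚ)) (cellv β Z) := by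
  have hZ' : Z = fun i => w i = 0 := by funext i; exact propext (hZ i).symm
  subst hZ'
  have h1 : ∀ m, β.eval (fun v => if ⌊v.1 b⌋₊ = m then 1 else 0) =
      nn β.c * (if g 0 ≤ m then geoT β.ι w β.ρ (m - g 0) else 0) := by
    intro m
    unfold Cell.eval Cell.wt
    have h2 : ∀ ℓ, ⌊(β.pt ℓ).1 b⌋₊ = g 0 + ∑ i, ℓ i * w i := by
      intro ℓ; rw [hg, Nat.floor_natCast, hw]
    simp only [h2]
    split_ifs with h
    · unfold geoT
      rw [← ENNReal.tsum_mul_left]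
      refine tsum_congr fun ℓ => ?_
      rw [mul_assoc]
      congr 3
      exact propext (by omega)
    · rw [mul_zero, ENNReal.tsum_eq_zero]
      intro ℓ
      rw [if_neg (by omega), mul_zero]
  have h3 : ∀ m, geoT β.ι w β.ρ m ≠ ⊤ := by
    intro m hm
    apply hfin (m + g 0)
    rw [h1, if_pos (by omega), Nat.add_sub_cancel, hm, ENNReal.mul_top (nn_ne_zero β.hc)]
  obtain ⟨f, hf, hf'⟩ := geoOK β.ι w β.ρ β.hρ h3
  refine ⟨fun m => β.c * (if g 0 ≤ m then f (m - g 0) else 0), ?_, ?_⟩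
  · intro m
    rw [h1, nn_mul]
    congr 1
    split_ifs
    · exact hf _
    · exact nn_zero.symm
  have hρ : ∀ i, (β.ρ i : ℚ) ≠ 0 := fun i => by exact_mod_cast β.hρ i
  have hne : ∀ i, (if w i = 0 then 1 else (1 - C (β.ρ i : ℚ) * X ^ w i) : ℚ[X]) ≠ 0 := by
    intro i h0
    have := (geo_natDegree (w i) _ (hρ i)).2.2
    rw [h0] at this
    simp at this
  obtain ⟨Q, hQ⟩ : ∃ Q : ℚ[X], Q = ∏ i, if w i = 0 then 1 else (1 - C (β.ρ i : ℚ) * X ^ w i) := ⟨_, rfl⟩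
  obtain ⟨K, hK⟩ : ∃ K : ℚ, K = ∏ i, if w i = 0 then (1 - (β.ρ i : ℚ))⁻¹ else 1 := ⟨_, rfl⟩
  rw [← hQ, ← hK] at hf'
  have hdeg : Q.natDegree = ∑ i, w i := by
    rw [hQ, natDegree_prod _ _ (fun i _ => hne i)]
    exact Finset.sum_congr rfl fun i _ => (geo_natDegree (w i) _ (hρ i)).1
  have hlead : Q.leadingCoeff = ∏ i, if w i = 0 then 1 else -(β.ρ i : ℚ) := by
    rw [hQ, leadingCoeff_prod]
    exact Finset.prod_congr rfl fun i _ => (geo_natDegree (w i) _ (hρ i)).2.1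
  have hc0 : Q.coeff 0 = 1 := by
    rw [hQ, coeff_zero_prod]
    exact Finset.prod_eq_one fun i _ => (geo_natDegree (w i) _ (hρ i)).2.2
  have hQ0 : Q ≠ 0 := by rintro rfl; simp at hc0
  have hle : ∀ i ∈ Finset.univ, β.θ i * w i ≤ (w i : ℚ) := by
    intro i _
    exact mul_le_of_le_one_left (Nat.cast_nonneg _) (β.hθ1 i)
  have hsle : g 0 ≤ ∑ i, w i := by
    have : (g 0 : ℚ) ≤ ∑ i, (w i : ℚ) := by rw [hs]; exact Finset.sum_le_sum hle
    exact_mod_cast this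
  have hseq : g 0 = ∑ i, w i ↔ ∀ i, ¬ w i = 0 → β.θ i = 1 := by
    have h4 : g 0 = ∑ i, w i ↔ ∑ i, β.θ i * w i = ∑ i, (w i : ℚ) := by
      rw [← hs]; exact_mod_cast Iff.rfl
    rw [h4, Finset.sum_eq_sum_iff_of_le hle]
    refine ⟨fun h i hi => ?_, fun h i _ => ?_⟩
    · have := h i (Finset.mem_univ _)
      have hi' : (w i : ℚ) ≠ 0 := by exact_mod_cast hi
      exact mul_right_cancel₀ hi' (by rw [this, one_mul])
    · by_cases hi : w i = 0
      · simp [hi]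
      · rw [h i hi, one_mul]
  refine ⟨C ((β.c : ℚ) * K) * X ^ g 0, Q, by rw [hc0]; exact one_ne_zero, ?_, ?_, ?_⟩
  · have h5 : (PowerSeries.mk fun m => ((β.c * (if g 0 ≤ m then f (m - g 0) else 0) : ℚ≥0) : ℚ)) =
        PowerSeries.C (β.c : ℚ) * ((PowerSeries.mk fun m => (f m : ℚ)) * PowerSeries.X ^ g 0) := by
      ext m
      rw [PowerSeries.coeff_mk, PowerSeries.coeff_C_mul, PowerSeries.coeff_mul_X_pow', PowerSeries.coeff_mk]
      push_cast
      congr 1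
      split_ifs <;> simp
    rw [h5, coe_mul, coe_C, coe_pow, coe_X, map_mul, ← hf']
    ring
  · rw [hdeg]
    exact (natDegree_C_mul_X_pow_le _ _).trans hsle
  · rw [coeff_C_mul_X_pow, hdeg]
    have hl0 : Q.leadingCoeff ≠ 0 := leadingCoeff_ne_zero.mpr hQ0
    by_cases h : g 0 = ∑ i, w i
    · have hv : cellv β (fun i => w i = 0) = (β.c : ℚ) * K / Q.leadingCoeff := by
        unfold cellv
        rw [if_pos (hseq.mp h), hK, hlead]
        beta_reduce
        congr!
      rw [hv, if_pos h.symm, div_mul_cancel₀ _ hl0]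
    · have hv : cellv β (fun i => w i = 0) = 0 := by
        unfold cellv
        rw [if_neg (fun h' => h (hseq.mpr h'))]
      rw [hv, if_neg (fun h' => h h'.symm), zero_mul]

/-- integrality data on a cell -/
def CellInt {κ Lab : Type} [Fintype κ] (β : Cell κ Lab) (b : κ) (Z : β.ι → Prop) : Prop :=
  ∃ (g : (β.ι → ℕ) → ℕ) (w : β.ι → ℕ), (∀ ℓ, (β.pt ℓ).1 b = g ℓ) ∧ (∀ ℓ, g ℓ = g 0 + ∑ i, ℓ i * w i) ∧
    ((g 0 : ℚ) = ∑ i, β.θ i * w i) ∧ ∀ i, w i = 0 ↔ Z i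

theorem list_val {κ Lab : Type} [Fintype κ] (L : List (Cell κ Lab)) (b : κ) (Z : (β : Cell κ Lab) → β.ι → Prop)
    (hL : ∀ β ∈ L, CellInt β b (Z β))
    (hfin : ∀ m : ℕ, Cell.evalL L (fun v => if ⌊v.1 b⌋₊ = m then 1 else 0) ≠ ⊤) :
    ∃ F : ℕ → ℚ≥0, (∀ m : ℕ, Cell.evalL L (fun v => if ⌊v.1 b⌋₊ = m then 1 else 0) = nn (F m)) ∧
      Val (PowerSeries.mk fun m => (F m : ℚ)) ((L.map fun β => cellv β (Z β)).sum) := by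
  induction L with
  | nil =>
    refine ⟨fun _ => 0, fun m => by rw [Cell.evalL_nil, nn_zero], ?_⟩
    have : (PowerSeries.mk fun m => ((0 : ℚ≥0) : ℚ)) = 0 := by ext; simp
    rw [this]
    exact Val.zero
  | cons β L ih =>
    simp only [Cell.evalL_cons] at hfin
    obtain ⟨g, w, h1, h2, h3, h4⟩ := hL β (by simp)
    obtain ⟨F, hF, hF'⟩ := cell_val β b g h1 w h2 h3 (Z β) h4 (fun m => (ENNReal.add_ne_top.mp (hfin m)).1)
    obtain ⟨G, hG, hG'⟩ := ih (fun γ hγ => hL γ (by simp [hγ])) (fun m => (ENNReal.add_ne_top.mp (hfin m)).2)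
    refine ⟨fun m => F m + G m, fun m => by rw [Cell.evalL_cons, hF, hG, nn_add], ?_⟩
    rw [List.map_cons, List.sum_cons]
    have := hF'.add hG'
    have h5 : (PowerSeries.mk fun m => ((F m + G m : ℚ≥0) : ℚ)) =
      (PowerSeries.mk fun m => (F m : ℚ)) + (PowerSeries.mk fun m => (G m : ℚ)) := by ext; simp
    rw [h5]
    exact this

theorem cells_int (D : ℕ) (β : Cell Bool Unit)
    (h : ∀ ℓ, ∃ a b : ℕ, (β.pt ℓ).1 false = a ∧ (β.pt ℓ).1 true = b ∧ a ≤ b ∧ b ≤ D * a) :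
    CellInt β false (fun i => β.A i false = 0) ∧ CellInt β true (fun i => β.A i false = 0) := by
  choose a b ha hb hab hba using h
  obtain ⟨w, h1, h2, h3⟩ := β.exists_nat_linear (Pi.single false 1) a (fun ℓ => by
    rw [single_one_dotProduct]; exact ha ℓ)
  obtain ⟨u, h1', h2', h3'⟩ := β.exists_nat_linear (Pi.single true 1) b (fun ℓ => by
    rw [single_one_dotProduct]; exact hb ℓ)
  have h4 : ∀ i, w i = 0 ↔ β.A i false = 0 := by
    intro i
    have := h3 i
    rw [single_one_dotProduct] at this
    rw [this]; exact_mod_cast Iff.rfl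
  have key : ∀ i N, a (Pi.single i N) = a 0 + N * w i ∧ b (Pi.single i N) = b 0 + N * u i := by
    intro i N
    rw [h1, h1']
    constructor
    · congr 1
      rw [Finset.sum_eq_single i (fun j _ hj => by rw [Pi.single_eq_of_ne hj, zero_mul]) (by simp), Pi.single_eq_same]
    · congr 1
      rw [Finset.sum_eq_single i (fun j _ hj => by rw [Pi.single_eq_of_ne hj, zero_mul]) (by simp), Pi.single_eq_same]
  have h5 : ∀ i, u i = 0 ↔ w i = 0 := by
    intro i
    refine ⟨fun h => ?_, fun h => ?_⟩
    · by_contra hw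
      have k := key i (b 0 + 1)
      have k' := hab (Pi.single i (b 0 + 1))
      rw [k.1, k.2, h, mul_zero] at k'
      have : b 0 + 1 ≤ (b 0 + 1) * w i := Nat.le_mul_of_pos_right _ (Nat.pos_of_ne_zero hw)
      omega
    · by_contra hu
      have k := key i (D * a 0 + 1)
      have k' := hba (Pi.single i (D * a 0 + 1))
      rw [k.1, k.2, h, mul_zero, add_zero] at k'
      have : D * a 0 + 1 ≤ (D * a 0 + 1) * u i := Nat.le_mul_of_pos_right _ (Nat.pos_of_ne_zero hu)
      omega
  exact ⟨⟨a, w, ha, h1, h2, h4⟩, ⟨b, u, hb, h1', h2', fun i => (h5 i).trans (h4 i)⟩⟩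

end ValSeries

open scoped ENNReal NNReal

section ValLat
set_option linter.unusedSectionVars false
set_option linter.unusedVariables false
open Polynomial

theorem hasSum_ptw {f g : ℕ → ℝ} {s : ℝ} (h : ∀ n, f n = g n) (hg : HasSum g s) : HasSum f s := by
  rw [funext h]; exact hg

theorem hasSum_series_X {F : PowerSeries ℚ} {y s : ℝ} (h : HasSum (fun n => ((F.coeff n : ℚ) : ℝ) * y ^ n) s) :
    HasSum (fun n => (((F * PowerSeries.X).coeff n : ℚ) : ℝ) * y ^ n) (s * y) := by
  rw [← hasSum_nat_add_iff' 1]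
  simp only [PowerSeries.coeff_succ_mul_X, Finset.sum_range_one, PowerSeries.coeff_zero_mul_X, Rat.cast_zero,
    zero_mul, sub_zero, pow_succ, ← mul_assoc]
  exact h.mul_right y

theorem hasSum_series_mul {F : PowerSeries ℚ} {y s : ℝ} (h : HasSum (fun n => ((F.coeff n : ℚ) : ℝ) * y ^ n) s)
    (Q : ℚ[X]) :
    HasSum (fun n => (((F * (Q : PowerSeries ℚ)).coeff n : ℚ) : ℝ) * y ^ n) (s * aeval y Q) := by
  induction Q using Polynomial.induction_on with
  | C a =>
    simp only [coe_C, PowerSeries.coeff_mul_C, aeval_C]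
    have := h.mul_right (a : ℝ)
    refine hasSum_ptw (fun n => ?_) this
    push_cast; ring
  | add P Q hP hQ =>
    rw [map_add, mul_add, coe_add, mul_add]
    have := hP.add hQ
    refine hasSum_ptw (fun n => ?_) this
    rw [map_add]; push_cast; ring
  | monomial n a hn =>
    have := hasSum_series_X hn
    rw [pow_succ, ← mul_assoc, map_mul, aeval_X, coe_mul, coe_X, ← mul_assoc, ← mul_assoc]
    exact this

theorem series_eval {F : PowerSeries ℚ} {y s : ℝ} (h : HasSum (fun n => ((F.coeff n : ℚ) : ℝ) * y ^ n) s)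
    {P Q : ℚ[X]} (hPQ : F * (Q : PowerSeries ℚ) = P) : s * aeval y Q = aeval y P := by
  have h1 := hasSum_series_mul h Q
  have h2 : HasSum (fun n => (((1 : PowerSeries ℚ).coeff n : ℚ) : ℝ) * y ^ n) 1 := by
    have := hasSum_single (f := fun n => (((1 : PowerSeries ℚ).coeff n : ℚ) : ℝ) * y ^ n) 0
      (fun n hn => by simp [PowerSeries.coeff_one, hn])
    simpa using this
  have h3 := hasSum_series_mul h2 P
  rw [one_mul, one_mul] at h3
  rw [hPQ] at h1
  exact h1.unique h3

variable {p : ℕ} [hp : Fact p.Prime] {d : ℕ}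

theorem lat_hasSum (F : PowerSeries ℚ) (hF : ∀ m, F.coeff m = if d ≤ m then (latCount p d (m - d) : ℚ) else 0)
    (m : ℕ) (hm : d ≤ m) :
    ∃ s : ℝ, HasSum (fun n => ((F.coeff n : ℚ) : ℝ) * (((1 / p : ℚ) ^ m : ℚ) : ℝ) ^ n) s ∧
      s * ∏ i : Fin d, ((p : ℝ) ^ m - (p : ℝ) ^ i.val) = 1 := by
  have hp0 : 0 < p := hp.out.pos
  have h1 := zeta0_val (p := p) (d := d) hm
  rw [sum_latCount (fun n => (nn (1/p)^m) ^ n)] at h1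
  obtain ⟨y, hy⟩ : ∃ y : ℝ≥0, y = ((1 / p : ℚ≥0) : ℝ≥0) ^ m := ⟨_, rfl⟩
  have hyn : nn (1/p) ^ m = (y : ℝ≥0∞) := by
    rw [hy]; unfold nn; push_cast; rfl
  have hyr : (((1 / p : ℚ) ^ m : ℚ) : ℝ) = (y : ℝ) := by
    rw [hy]; push_cast; rfl
  rw [hyr]
  rw [pow_mul, hyn] at h1
  obtain ⟨c, hc⟩ : ∃ c : ℕ, c = ∏ i : Fin d, (p ^ m - p ^ i.val) := ⟨_, rfl⟩
  have hcr : (c : ℝ) = ∏ i : Fin d, ((p : ℝ) ^ m - (p : ℝ) ^ i.val) := by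
    rw [hc]; push_cast
    refine Finset.prod_congr rfl fun i _ => ?_
    rw [Nat.cast_sub (Nat.pow_le_pow_right hp0 (by omega))]; push_cast; rfl
  rw [← hc] at h1
  rw [← hcr]
  have h2 : ∑' n, (latCount p d n : ℝ≥0∞) * (y : ℝ≥0∞) ^ n = ((∑' n, (latCount p d n : ℝ≥0) * y ^ n : ℝ≥0) : ℝ≥0∞) ∧
      Summable (fun n => (latCount p d n : ℝ≥0) * y ^ n) := by
    have hne : ∑' n, (((latCount p d n : ℝ≥0) * y ^ n : ℝ≥0) : ℝ≥0∞) ≠ ⊤ := by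
      intro h
      push_cast at h
      rw [h, ENNReal.mul_top] at h1
      · exact absurd h1 (by simp)
      · intro h0
        rw [h0, zero_mul] at h1
        exact zero_ne_one h1
    have hs := ENNReal.tsum_coe_ne_top_iff_summable.mp hne
    refine ⟨?_, hs⟩
    rw [ENNReal.coe_tsum hs]
    push_cast
    rfl
  obtain ⟨T, hT⟩ : ∃ T : ℝ≥0, T = ∑' n, (latCount p d n : ℝ≥0) * y ^ n := ⟨_, rfl⟩
  have h3 : HasSum (fun n => (latCount p d n : ℝ≥0) * y ^ n) T := by rw [hT]; exact h2.2.hasSum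
  rw [h2.1, ← hT] at h1
  have h4 : (c : ℝ) * (y : ℝ) ^ d * T = 1 := by
    have : ((c * y ^ d * T : ℝ≥0) : ℝ≥0∞) = 1 := by push_cast; exact h1
    exact_mod_cast this
  refine ⟨(y : ℝ) ^ d * T, ?_, by rw [← h4]; ring⟩
  have h5 : HasSum (fun n => (latCount p d n : ℝ) * (y : ℝ) ^ n) T := by exact_mod_cast h3
  rw [← hasSum_nat_add_iff' d]
  have h6 : ∑ i ∈ Finset.range d, ((F.coeff i : ℚ) : ℝ) * (y : ℝ) ^ i = 0 := by
    refine Finset.sum_eq_zero fun i hi => ?_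
    rw [hF, if_neg (by have := Finset.mem_range.mp hi; omega)]; simp
  rw [h6, sub_zero]
  have h7 := h5.mul_left ((y : ℝ) ^ d)
  refine hasSum_ptw (fun n => ?_) h7
  rw [hF, if_pos (by omega), Nat.add_sub_cancel, pow_add]
  push_cast
  ring

theorem lat_val_ne (F : PowerSeries ℚ) (hF : ∀ m, F.coeff m = if d ≤ m then (latCount p d (m - d) : ℚ) else 0)
    (v : ℚ) (hv : Val F v) : v ≠ 0 := by
  obtain ⟨P, Q, hQ0, hPQ, hdeg, hco⟩ := hv
  have hpq : (p : ℚ) ≠ 0 := by exact_mod_cast hp.out.ne_zero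
  obtain ⟨R, hR⟩ : ∃ R : ℚ[X], R = ∏ i : Fin d, (if 1 = 0 then 1 else (1 - C ((p : ℚ) ^ i.val) * X ^ 1)) := ⟨_, rfl⟩
  have hpi : ∀ i : Fin d, (p : ℚ) ^ i.val ≠ 0 := fun i => pow_ne_zero _ hpq
  have hRd : R.natDegree = d := by
    rw [hR, natDegree_prod]
    · rw [Finset.sum_congr rfl fun i _ => (geo_natDegree 1 _ (hpi i)).1]; simp
    · intro i _ h0
      have := (geo_natDegree 1 _ (hpi i)).1
      rw [h0] at this
      simp at this
  have key : P * R = Q * X ^ d := by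
    refine Polynomial.eq_of_infinite_eval_eq _ _ ?_
    have hinj : Function.Injective (fun k : ℕ => (1 / p : ℚ) ^ (d + k)) := by
      intro a b hab
      have hp1 : (1 / p : ℚ) < 1 := by
        rw [div_lt_one (by exact_mod_cast hp.out.pos)]; exact_mod_cast hp.out.one_lt
      have := (pow_right_strictAnti₀ (by positivity) hp1).injective hab
      omega
    refine (Set.infinite_range_of_injective hinj).mono ?_
    rintro _ ⟨k, rfl⟩
    obtain ⟨s, hs, hs'⟩ := lat_hasSum F hF (d + k) (by omega)
    have h1 := series_eval hs hPQ
    obtain ⟨y, hy⟩ : ∃ y : ℚ, y = (1 / p : ℚ) ^ (d + k) := ⟨_, rfl⟩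
    change eval ((1 / p : ℚ) ^ (d + k)) _ = eval ((1 / p : ℚ) ^ (d + k)) _
    rw [← hy] at h1 ⊢
    have hyp : y * (p : ℚ) ^ (d + k) = 1 := by
      rw [hy, ← mul_pow, one_div, inv_mul_cancel₀ hpq, one_pow]
    have e : ∀ G : ℚ[X], aeval (y : ℝ) G = ((eval y G : ℚ) : ℝ) := by
      intro G
      have := Polynomial.aeval_algebraMap_apply_eq_algebraMap_eval (A := ℝ) y G
      simpa using this
    rw [e, e] at h1
    have h2 : s * ((eval y R : ℚ) : ℝ) = (y : ℝ) ^ d := by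
      have h3 : ((eval y R : ℚ) : ℝ) = (y : ℝ) ^ d * ∏ i : Fin d, ((p : ℝ) ^ (d + k) - (p : ℝ) ^ i.val) := by
        rw [hR, eval_prod]
        push_cast
        have h5 : (y : ℝ) ^ d = ∏ i : Fin d, (y : ℝ) := by simp
        rw [h5, ← Finset.prod_mul_distrib]
        refine Finset.prod_congr rfl fun i _ => ?_
        have hyp' : (y : ℝ) * (p : ℝ) ^ (d + k) = 1 := by exact_mod_cast hyp
        rw [mul_sub, hyp']
        simp
        ring
      rw [h3, mul_left_comm, hs', mul_one]
    have h6 : ((eval y (P * R) : ℚ) : ℝ) = ((eval y (Q * X ^ d) : ℚ) : ℝ) := by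
      rw [eval_mul, eval_mul, eval_pow, eval_X]
      push_cast
      rw [← h1, ← h2]; ring
    exact_mod_cast h6
  rintro rfl
  have h7 := congrArg (fun G => G.coeff (Q.natDegree + d)) key
  simp only [coeff_mul_X_pow] at h7
  rw [coeff_mul_add_eq_of_natDegree_le hdeg hRd.le, hco, zero_mul, zero_mul] at h7
  have : Q = 0 := leadingCoeff_eq_zero.mp h7.symm
  rw [this] at hQ0
  simp at hQ0

end ValLat

open scoped ENNReal NNReal

section Final
set_option linter.unusedSectionVars false
set_option linter.unusedVariables false
open Polynomial

theorem coprime_form {d : ℕ} (a : ℕ → ℚ) (v : ℚ) (hv : v ≠ 0)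
    (h : Val (PowerSeries.mk fun m => if d ≤ m then a (m - d) else 0) v) :
    ∃ P Q : ℚ[X], IsCoprime P Q ∧ Q.coeff 0 = 1 ∧
      (PowerSeries.mk a) * (Q : PowerSeries ℚ) = (P : PowerSeries ℚ) ∧ P.natDegree + d = Q.natDegree := by
  obtain ⟨P, Q, h0, h1, h2, h3⟩ := h
  have hQ : Q ≠ 0 := by rintro rfl; simp at h0
  have hco : P.coeff Q.natDegree ≠ 0 := by
    rw [h3]; exact mul_ne_zero hv (leadingCoeff_ne_zero.mpr hQ)
  have hdeg : P.natDegree = Q.natDegree := le_antisymm h2 (le_natDegree_of_ne_zero hco)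
  have hP : P ≠ 0 := by rintro rfl; simp at hco
  have h4 : (PowerSeries.mk fun m => if d ≤ m then a (m - d) else 0) = PowerSeries.mk a * PowerSeries.X ^ d := by
    ext m
    rw [PowerSeries.coeff_mk, PowerSeries.coeff_mul_X_pow', PowerSeries.coeff_mk]
  rw [h4] at h1
  have h5 : X ^ d ∣ P := by
    rw [X_pow_dvd_iff]
    intro k hk
    have := congrArg (PowerSeries.coeff k) h1
    rw [mul_right_comm, PowerSeries.coeff_mul_X_pow', if_neg (by omega), coeff_coe] at this
    exact this.symm
  obtain ⟨P1, rfl⟩ := h5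
  have hP1 : P1 ≠ 0 := right_ne_zero_of_mul hP
  have h6 : PowerSeries.mk a * (Q : PowerSeries ℚ) = P1 := by
    have hX : (PowerSeries.X : PowerSeries ℚ) ^ d ≠ 0 := pow_ne_zero _ PowerSeries.X_ne_zero
    apply mul_left_cancel₀ hX
    rw [coe_mul, coe_pow, coe_X] at h1
    rw [← h1]; ring
  have h7 : P1.natDegree + d = Q.natDegree := by
    rw [← hdeg, natDegree_mul (pow_ne_zero _ X_ne_zero) hP1, natDegree_X_pow, add_comm]
  obtain ⟨G, hG⟩ : ∃ G, G = EuclideanDomain.gcd P1 Q := ⟨_, rfl⟩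
  obtain ⟨P2, hP2⟩ : G ∣ P1 := by rw [hG]; exact EuclideanDomain.gcd_dvd_left _ _
  obtain ⟨Q2, hQ2⟩ : G ∣ Q := by rw [hG]; exact EuclideanDomain.gcd_dvd_right _ _
  have hG0 : G ≠ 0 := by rintro rfl; rw [zero_mul] at hQ2; exact hQ hQ2
  have hP20 : P2 ≠ 0 := by rintro rfl; rw [mul_zero] at hP2; exact hP1 hP2
  have hQ20 : Q2 ≠ 0 := by rintro rfl; rw [mul_zero] at hQ2; exact hQ hQ2
  have hcop : IsCoprime P2 Q2 := by
    obtain ⟨A, B, hAB⟩ : ∃ A B, G = P1 * A + Q * B := by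
      rw [hG]; exact ⟨_, _, EuclideanDomain.gcd_eq_gcd_ab P1 Q⟩
    refine ⟨A, B, ?_⟩
    apply mul_left_cancel₀ hG0
    have h8 : G * (A * P2 + B * Q2) = (G * P2) * A + (G * Q2) * B := by ring
    rw [h8, ← hP2, ← hQ2, ← hAB, mul_one]
  have h8 : PowerSeries.mk a * (Q2 : PowerSeries ℚ) = P2 := by
    have hGs : (G : PowerSeries ℚ) ≠ 0 := by
      intro h; exact hG0 (Polynomial.coe_eq_zero_iff.mp h)
    apply mul_left_cancel₀ hGs
    rw [hQ2, hP2, coe_mul, coe_mul] at h6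
    rw [← h6]; ring
  have h9 : P2.natDegree + d = Q2.natDegree := by
    rw [hQ2, hP2, natDegree_mul hG0 hP20, natDegree_mul hG0 hQ20] at h7
    omega
  have h10 : Q2.coeff 0 ≠ 0 := by
    rw [hQ2, mul_coeff_zero] at h0
    exact right_ne_zero_of_mul h0
  have hi : (Q2.coeff 0)⁻¹ ≠ 0 := inv_ne_zero h10
  have hu : IsUnit (C (Q2.coeff 0)⁻¹) := isUnit_C.mpr (isUnit_iff_ne_zero.mpr hi)
  refine ⟨C (Q2.coeff 0)⁻¹ * P2, C (Q2.coeff 0)⁻¹ * Q2, ?_, ?_, ?_, ?_⟩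
  · rw [isCoprime_mul_unit_left hu]; exact hcop
  · rw [coeff_C_mul, inv_mul_cancel₀ h10]
  · rw [coe_mul, coe_mul, ← h8]; ring
  · rw [natDegree_C_mul hi, natDegree_C_mul hi, h9]

theorem tsum_ind {d : ℕ} (a : ℕ → ℕ) (m : ℕ) :
    ∑' n, (a n : ℝ≥0∞) * (fun k => if k = m then 1 else 0) (n + d) = nn (if d ≤ m then (a (m - d) : ℚ≥0) else 0) := by
  split_ifs with h
  · rw [tsum_eq_single (m - d)]
    · beta_reduce
      rw [if_pos (by omega), mul_one]
      unfold nn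
      push_cast; rfl
    · intro n hn
      beta_reduce
      rw [if_neg (by omega), mul_zero]
  · rw [nn_zero, ENNReal.tsum_eq_zero]
    intro n
    beta_reduce
    rw [if_neg (by omega), mul_zero]

theorem series_of_list {d : ℕ} (L : List (Cell Bool Unit)) (b : Bool) (a : ℕ → ℕ)
    (h : ∀ ψ : ℕ → ℝ≥0∞, ∑' n, (a n : ℝ≥0∞) * ψ (n + d) = Cell.evalL L (fun v => ψ ⌊v.1 b⌋₊))
    (hL : ∀ β ∈ L, CellInt β b (fun i => β.A i false = 0)) :
    Val (PowerSeries.mk fun m => if d ≤ m then (a (m - d) : ℚ) else 0)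
      ((L.map fun β => cellv β (fun i => β.A i false = 0)).sum) := by
  have h1 : ∀ m : ℕ, Cell.evalL L (fun v => if ⌊v.1 b⌋₊ = m then 1 else 0) =
      nn (if d ≤ m then (a (m - d) : ℚ≥0) else 0) := by
    intro m
    rw [← tsum_ind]
    exact (h (fun k => if k = m then 1 else 0)).symm
  obtain ⟨F, hF, hF'⟩ := list_val L b (fun β i => β.A i false = 0) hL
    (fun m => by rw [h1]; exact nn_ne_top _)
  have h2 : (PowerSeries.mk fun m => if d ≤ m then (a (m - d) : ℚ) else 0) = PowerSeries.mk fun m => (F m : ℚ) := by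
    ext m
    rw [PowerSeries.coeff_mk, PowerSeries.coeff_mk]
    have : F m = if d ≤ m then (a (m - d) : ℚ≥0) else 0 := nn_inj (by rw [← hF, h1])
    rw [this]
    split_ifs <;> simp
  rw [h2]
  exact hF'

end Final

theorem main_final (d : ℕ) (Λ : Type*) [NonUnitalNonAssocRing Λ] (hΛ : Nonempty (Λ ≃+ (Fin d → ℤ))) :
    ∃ S : Finset ℕ, ∀ p : ℕ, p.Prime → p ∉ S → ∃ P Q : Polynomial ℚ, IsCoprime P Q ∧ Q.coeff 0 = 1 ∧
      (PowerSeries.mk fun i => (subringCount Λ (p ^ i) : ℚ)) * (Q : PowerSeries ℚ) = (P : PowerSeries ℚ) ∧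
      P.natDegree + d = Q.natDegree := by
  obtain ⟨e⟩ := hΛ
  obtain ⟨S0, hS0⟩ := main_conic e
  refine ⟨S0, fun p hp hpS => ?_⟩
  haveI : Fact p.Prime := ⟨hp⟩
  obtain ⟨L, h1, h2, h3⟩ := hS0 p hpS
  have h4 : ∀ β ∈ L, CellInt β false (fun i => β.A i false = 0) ∧ CellInt β true (fun i => β.A i false = 0) := by
    intro β hβ
    refine cells_int (d + 1) β fun ℓ => ?_
    have h5 := Cell.evalL_eq_zero h3 hβ ℓ
    by_contra hcon
    rw [if_neg hcon] at h5
    exact one_ne_zero h5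
  have hf := series_of_list L false (fun n => latCount p d n) h2 (fun β hβ => (h4 β hβ).1)
  have ht := series_of_list L true (fun n => subringCount Λ (p ^ n)) h1 (fun β hβ => (h4 β hβ).2)
  have hv := lat_val_ne (p := p) (d := d) _ (fun m => by rw [PowerSeries.coeff_mk]) _ hf
  exact coprime_form (fun i => (subringCount Λ (p ^ i) : ℚ)) _ hv ht

/-- **Degree of local subring zeta functions.** Let `Λ` be a ring (not necessarily
associative, commutative or unital) whose additive group is `ℤ^d`. For almost all primes `p`,
the local subring zeta function of `Λ` at `p`, written as a rational function
`P_p/Q_p` in `Y = p^{-s}` in lowest terms with `Q_p(0) = 1`, has degree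
`deg P_p - deg Q_p = -d`. -/
theorem local_subring_zeta_degree
    (d : ℕ) (Λ : Type*) [NonUnitalNonAssocRing Λ] (hΛ : Nonempty (Λ ≃+ (Fin d → ℤ))) :
    ∃ S : Finset ℕ, ∀ p : ℕ, p.Prime → p ∉ S →
      ∃ P Q : Polynomial ℚ, IsCoprime P Q ∧ Q.coeff 0 = 1 ∧
        (PowerSeries.mk fun i => (subringCount Λ (p ^ i) : ℚ)) * (Q : PowerSeries ℚ)
          = (P : PowerSeries ℚ) ∧
        P.natDegree + d = Q.natDegree := by
  exact main_final d Λ hΛ
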